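/- For every κ > 0 and W > 0 there exist ε₀ > 0, constants 0 < C₁ < C₂, and a family (ψ_ε, μ_ε) indexed by ε ∈ (0, ε₀] such that for each ε ∈ (0, ε₀]: μ_ε > 0 and ψ_ε is a centralized stream function of a steady vortex ring with parameters (ε, W, μ_ε); its cross-section A_ε is a nonempty open simply connected set; its circulation ε^{−2} ∫_{A_ε} x₁ dx equals exactly κ; C₁ ε ≤ (1/2)·diam A_ε < C₂ ε; and moreover sup_{x ∈ A_ε} |x − (κ/(4πW), 0)| → 0 as ε → 0⁺. -/

import Mathlib

open MeasureTheory Real Filter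
open scoped RealInnerProductSpace

noncomputable section

/-- The plane `ℝ²` with the Euclidean norm. -/
abbrev Plane : Type := EuclideanSpace ℝ (Fin 2)

/-- The point `(a, b)` of the plane. -/
def mk2 (a b : ℝ) : Plane := (WithLp.equiv 2 (Fin 2 → ℝ)).symm ![a, b]

/-- The open right half plane `Π = {x : x₁ > 0}`. -/
def halfPlane : Set Plane := {x : Plane | 0 < x 0}

/-- The reflection `x̄ = (−x₁, x₂)` of a point `x = (x₁, x₂)`. -/
def reflPt (x : Plane) : Plane := mk2 (-(x 0)) (x 1)

/-- The Green function `G_*` on the half plane of the operator `−(1/x₁)div((1/x₁)∇)`. -/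
def Gstar (x x' : Plane) : ℝ :=
  x 0 * (x' 0) ^ 2 / (4 * π) *
    ∫ θ in (-π)..π, Real.cos θ /
      Real.sqrt ((x 1 - x' 1) ^ 2 + (x 0) ^ 2 + (x' 0) ^ 2 - 2 * x 0 * x' 0 * Real.cos θ)

/-- The Green function of `−Δ` on the half plane. -/
def Gfun (x x' : Plane) : ℝ :=
  (1 / (4 * π)) * Real.log
    (((x 0 + x' 0) ^ 2 + (x 1 - x' 1) ^ 2) / ((x 0 - x' 0) ^ 2 + (x 1 - x' 1) ^ 2))

/-- The regular part `H_c(x,x') = G_*(x,x') − c² G(x,x')`. -/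
def Hker (c : ℝ) (x x' : Plane) : ℝ := Gstar x x' - c ^ 2 * Gfun x x'

/-- The regular part `H_c`, extended continuously to the diagonal. -/
def HkerExt (c : ℝ) (x x' : Plane) : ℝ := by
  classical
  exact if x = x' then limUnder (nhdsWithin x' {x'}ᶜ) (fun y => Hker c y x')
    else Hker c x x'

/-- The cross-section `A = {x ∈ Π : ψ(x) − (W/2) x₁² ln(1/ε) > μ}`. -/
def crossSection (ψ : Plane → ℝ) (ε W μ : ℝ) : Set Plane :=
  {x : Plane | x ∈ halfPlane ∧ μ < ψ x - W / 2 * (x 0) ^ 2 * Real.log (1 / ε)}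

/-- `ψ` is a stream function of a steady vortex ring with parameters `(ε, W, μ)`. -/
structure IsVortexRingStream (ψ : Plane → ℝ) (ε W μ : ℝ) : Prop where
  continuousOn : ContinuousOn ψ halfPlane
  bounded : Bornology.IsBounded (crossSection ψ ε W μ)
  closure_subset : closure (crossSection ψ ε W μ) ⊆ halfPlane
  repr : ∀ x ∈ halfPlane, ψ x = (∫ x' in crossSection ψ ε W μ, Gstar x x') / ε ^ 2

/-- The circulation `ε⁻² ∫_A x₁ dx` of a vortex ring. -/
def circulation (ψ : Plane → ℝ) (ε W μ : ℝ) : ℝ :=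
  (∫ x in crossSection ψ ε W μ, x 0) / ε ^ 2

/-- `ψ` is centralized: it is even in the second variable. -/
def Centralized (ψ : Plane → ℝ) : Prop :=
  ∀ a b : ℝ, ψ (mk2 a (-b)) = ψ (mk2 a b)

namespace VortexRing

open scoped symmDiff ComplexConjugate Topology

/-- The regular remainder of the azimuthal integral in the Green function. -/
def eker (σ : ℝ) : ℝ :=
  ∫ θ in (-π)..π, (cos θ - cos (θ / 2)) / √(σ ^ 2 + 4 * sin (θ / 2) ^ 2)

/-- The Lipschitz part of the azimuthal integral in the Green function. -/
def bker (σ : ℝ) : ℝ := 2 * log (2 + √(4 + σ ^ 2)) + eker σ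

lemma abs_cos_sub_cos_half_le {θ : ℝ} (h : θ ∈ Set.Icc (-π) π) :
    |cos θ - cos (θ / 2)| ≤ 3 * sin (θ / 2) ^ 2 ∧ cos θ - cos (θ / 2) ≤ 0 := by
  have h1 : 0 ≤ cos (θ / 2) := cos_nonneg_of_mem_Icc ⟨by linarith [h.1], by linarith [h.2]⟩
  have h2 : cos (θ / 2) ≤ 1 := cos_le_one _
  have h3 : cos θ = 2 * cos (θ / 2) ^ 2 - 1 := by rw [← cos_two_mul]; ring_nf
  have h4 := sin_sq_add_cos_sq (θ / 2)
  rw [h3]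
  constructor
  · rw [abs_le]; constructor <;> nlinarith
  · nlinarith

lemma abs_sqrt_sq_add_sub_le (a b s : ℝ) (hs : 0 ≤ s) :
    |√(a ^ 2 + s) - √(b ^ 2 + s)| ≤ |a - b| := by
  have ha : 0 ≤ a ^ 2 + s := by positivity
  have hb : 0 ≤ b ^ 2 + s := by positivity
  apply abs_le_of_sq_le_sq' _ (abs_nonneg _) |> abs_le.mpr
  rw [sq_abs]
  have h1 := Real.sq_sqrt ha
  have h2 := Real.sq_sqrt hb
  have h3 : |a * b| + s ≤ √(a ^ 2 + s) * √(b ^ 2 + s) := by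
    rw [← Real.sqrt_mul ha]
    apply Real.le_sqrt_of_sq_le
    have h5 : 2 * |a * b| ≤ a ^ 2 + b ^ 2 := by
      rw [abs_mul]; nlinarith [sq_nonneg (|a| - |b|), sq_abs a, sq_abs b]
    nlinarith [sq_abs (a * b)]
  nlinarith [le_abs_self (a * b)]

lemma eker_integrable (σ : ℝ) : IntervalIntegrable
    (fun θ => (cos θ - cos (θ / 2)) / √(σ ^ 2 + 4 * sin (θ / 2) ^ 2)) volume (-π) π := by
  rw [intervalIntegrable_iff_integrableOn_Icc_of_le (by linarith [pi_pos])]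
  refine Measure.integrableOn_of_bounded (M := 2) (by simp) ?_ ?_
  · exact Measurable.aestronglyMeasurable (by fun_prop)
  · refine (ae_restrict_iff' measurableSet_Icc).2 (Eventually.of_forall fun θ hθ => ?_)
    rw [norm_eq_abs, abs_div, abs_of_nonneg (Real.sqrt_nonneg _)]
    apply div_le_of_le_mul₀ (Real.sqrt_nonneg _) (by norm_num)
    have h1 := (abs_cos_sub_cos_half_le hθ).1
    have h2 : 2 * |sin (θ / 2)| ≤ √(σ ^ 2 + 4 * sin (θ / 2) ^ 2) := by
      apply Real.le_sqrt_of_sq_le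
      rw [mul_pow, sq_abs]; nlinarith [sq_nonneg σ]
    have h3 := abs_sin_le_one (θ / 2)
    have h4 : sin (θ / 2) ^ 2 = |sin (θ / 2)| ^ 2 := (sq_abs _).symm
    nlinarith [abs_nonneg (sin (θ / 2))]

lemma eker_lipschitz (σ τ : ℝ) : |eker σ - eker τ| ≤ 5 * |σ - τ| := by
  unfold eker
  rw [← intervalIntegral.integral_sub (eker_integrable σ) (eker_integrable τ), ← norm_eq_abs]
  have key : ∀ θ ∈ Set.uIoc (-π) π, ‖(cos θ - cos (θ / 2)) / √(σ ^ 2 + 4 * sin (θ / 2) ^ 2) -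
      (cos θ - cos (θ / 2)) / √(τ ^ 2 + 4 * sin (θ / 2) ^ 2)‖ ≤ 3 / 4 * |σ - τ| := by
    intro θ hθ
    rw [Set.uIoc_of_le (by linarith [pi_pos])] at hθ
    have h0 := abs_cos_sub_cos_half_le ⟨hθ.1.le, hθ.2⟩
    set s := sin (θ / 2)
    set n := cos θ - cos (θ / 2)
    by_cases hs : s = 0
    · have : n = 0 := by
        have := h0.1; rw [hs] at this; simpa using this
      simp [this]
    have hs2 : 0 < s ^ 2 := by positivity
    have l1 : 2 * |s| ≤ √(σ ^ 2 + 4 * s ^ 2) := by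
      apply Real.le_sqrt_of_sq_le
      rw [mul_pow, sq_abs]; nlinarith [sq_nonneg σ]
    have l2 : 2 * |s| ≤ √(τ ^ 2 + 4 * s ^ 2) := by
      apply Real.le_sqrt_of_sq_le
      rw [mul_pow, sq_abs]; nlinarith [sq_nonneg τ]
    have l3 := abs_sqrt_sq_add_sub_le τ σ (4 * s ^ 2) (by positivity)
    have hsp : 0 < |s| := abs_pos.2 hs
    set A := √(σ ^ 2 + 4 * s ^ 2)
    set B := √(τ ^ 2 + 4 * s ^ 2)
    have hA : 0 < A := by linarith
    have hB : 0 < B := by linarith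
    have e1 : n / A - n / B = n * (B - A) / (A * B) := by field_simp
    rw [e1, norm_eq_abs, abs_div, abs_mul, abs_of_pos (mul_pos hA hB), div_le_iff₀ (mul_pos hA hB)]
    have h6 : 4 * s ^ 2 ≤ A * B := by
      rw [← sq_abs]; nlinarith
    have h7 : |B - A| ≤ |σ - τ| := by rwa [abs_sub_comm σ τ]
    calc |n| * |B - A| ≤ 3 * s ^ 2 * |σ - τ| := by
          apply mul_le_mul h0.1 h7 (abs_nonneg _) (by positivity)
      _ ≤ 3 / 4 * |σ - τ| * (A * B) := by nlinarith [abs_nonneg (σ - τ)]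
  refine (intervalIntegral.norm_integral_le_of_norm_le_const key).trans ?_
  have : |π - -π| = 2 * π := by rw [abs_of_pos (by linarith [pi_pos])]; ring
  rw [this]
  nlinarith [abs_nonneg (σ - τ), pi_lt_d2]

lemma eker_nonpos (σ : ℝ) : eker σ ≤ 0 := by
  unfold eker
  rw [intervalIntegral.integral_of_le (by linarith [pi_pos])]
  apply setIntegral_nonpos measurableSet_Ioc
  intro θ hθ
  exact div_nonpos_of_nonpos_of_nonneg (abs_cos_sub_cos_half_le ⟨hθ.1.le, hθ.2⟩).2 (Real.sqrt_nonneg _)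

lemma bker_lipschitz (σ τ : ℝ) : |bker σ - bker τ| ≤ 6 * |σ - τ| := by
  have h1 := eker_lipschitz σ τ
  have h2 : ∀ a b : ℝ, log (2 + √(4 + a ^ 2)) - log (2 + √(4 + b ^ 2)) ≤ |a - b| / 2 := by
    intro a b
    have h3 := abs_sqrt_sq_add_sub_le a b 4 (by norm_num)
    rw [add_comm (a ^ 2), add_comm (b ^ 2)] at h3
    have hA : 0 ≤ √(4 + a ^ 2) := Real.sqrt_nonneg _
    have hB : 0 ≤ √(4 + b ^ 2) := Real.sqrt_nonneg _
    rw [← log_div (by positivity) (by positivity)]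
    refine (log_le_sub_one_of_pos (by positivity)).trans ?_
    rw [div_sub_one (by positivity), div_le_iff₀ (by positivity)]
    have := le_abs_self (√(4 + a ^ 2) - √(4 + b ^ 2))
    nlinarith [abs_nonneg (a - b)]
  have h4 := h2 σ τ
  have h5 := h2 τ σ
  rw [abs_sub_comm] at h5
  have := abs_le.1 h1
  unfold bker
  rw [abs_le]
  constructor <;> linarith [this.1, this.2]

lemma continuous_bker : Continuous bker := by
  have : LipschitzWith 6 bker := LipschitzWith.of_dist_le_mul fun x y => by
    simpa [Real.dist_eq] using bker_lipschitz x y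
  exact this.continuous

lemma integral_cos_half_div_sqrt {σ : ℝ} (hσ : 0 < σ) :
    ∫ θ in (-π)..π, cos (θ / 2) / √(σ ^ 2 + 4 * sin (θ / 2) ^ 2) = 2 * arsinh (2 / σ) := by
  have hd : ∀ θ ∈ Set.uIcc (-π) π, HasDerivAt (fun θ => arsinh (2 * sin (θ / 2) / σ))
      (cos (θ / 2) / √(σ ^ 2 + 4 * sin (θ / 2) ^ 2)) θ := by
    intro θ _
    have h1 : HasDerivAt (fun θ : ℝ => 2 * sin (θ / 2) / σ) (cos (θ / 2) / σ) θ := by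
      have := ((((hasDerivAt_id θ).div_const 2).sin).const_mul 2).div_const σ
      convert! this using 1
      simp only [id]
      ring
    convert! h1.arsinh using 1
    have : σ ^ 2 + 4 * sin (θ / 2) ^ 2 = σ ^ 2 * (1 + (2 * sin (θ / 2) / σ) ^ 2) := by
      field_simp
      ring
    rw [this, Real.sqrt_mul (by positivity), Real.sqrt_sq hσ.le, smul_eq_mul]
    field_simp
  rw [intervalIntegral.integral_eq_sub_of_hasDerivAt hd]
  · rw [neg_div, sin_neg, sin_pi_div_two, mul_neg, neg_div, arsinh_neg]
    ring_nf
  · apply Continuous.intervalIntegrable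
    apply Continuous.div (by fun_prop) (by fun_prop)
    intro θ
    have : 0 < σ ^ 2 + 4 * sin (θ / 2) ^ 2 := by positivity
    exact (Real.sqrt_pos.2 this).ne'

lemma arsinh_two_div {σ : ℝ} (hσ : 0 < σ) :
    arsinh (2 / σ) = -log σ + log (2 + √(4 + σ ^ 2)) := by
  have : 1 + (2 / σ) ^ 2 = (4 + σ ^ 2) / σ ^ 2 := by field_simp; ring
  rw [arsinh, this, Real.sqrt_div (by positivity), Real.sqrt_sq hσ.le, ← add_div,
    log_div (by positivity) hσ.ne']
  ring

lemma integral_cos_div_sqrt {σ : ℝ} (hσ : 0 < σ) :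
    ∫ θ in (-π)..π, cos θ / √(σ ^ 2 + 4 * sin (θ / 2) ^ 2) = 2 * (-log σ + bker σ / 2) := by
  have h1 := integral_cos_half_div_sqrt hσ
  have hi : IntervalIntegrable (fun θ => cos (θ / 2) / √(σ ^ 2 + 4 * sin (θ / 2) ^ 2))
      volume (-π) π := by
    apply Continuous.intervalIntegrable
    apply Continuous.div (by fun_prop) (by fun_prop)
    intro θ
    have : 0 < σ ^ 2 + 4 * sin (θ / 2) ^ 2 := by positivity
    exact (Real.sqrt_pos.2 this).ne'
  have h2 := intervalIntegral.integral_add hi (eker_integrable σ)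
  rw [h1, arsinh_two_div hσ] at h2
  have h3 : (fun θ => cos θ / √(σ ^ 2 + 4 * sin (θ / 2) ^ 2)) =
    fun θ => cos (θ / 2) / √(σ ^ 2 + 4 * sin (θ / 2) ^ 2) +
      (cos θ - cos (θ / 2)) / √(σ ^ 2 + 4 * sin (θ / 2) ^ 2) := by
    funext θ; ring
  rw [h3, h2]
  unfold bker
  unfold eker
  ring

lemma neg_log_add_bker_le {σ : ℝ} (hσ : 0 < σ) : -log σ + bker σ / 2 ≤ log (1 + 4 / σ) := by
  have h1 := eker_nonpos σ
  have h2 : -log σ + log (2 + √(4 + σ ^ 2)) ≤ log (1 + 4 / σ) := by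
    have h3 : √(4 + σ ^ 2) ≤ 2 + σ := by
      apply Real.sqrt_le_iff.2 ⟨by positivity, by nlinarith⟩
    have h4 : 1 + 4 / σ = (σ + 4) / σ := by field_simp
    rw [h4, log_div (by positivity) hσ.ne']
    have := log_le_log (show 0 < 2 + √(4 + σ ^ 2) by positivity)
      (show 2 + √(4 + σ ^ 2) ≤ σ + 4 by linarith)
    linarith
  unfold bker
  linarith

/-- Closed form of the Green function (times `2π`) in terms of the radii `P`, `Q` of the two points
and their distance `d`. -/
def gk (P Q d : ℝ) : ℝ := √P * (Q * √Q) * (-log (d / √(P * Q)) + bker (d / √(P * Q)) / 2)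

lemma Gstar_eq_gk (x x' : Plane) (hx : 0 < x 0) (hx' : 0 < x' 0) (hne : x ≠ x') :
    2 * π * Gstar x x' = gk (x 0) (x' 0) (dist x x') := by
  set P := x 0
  set Q := x' 0
  have hd : 0 < dist x x' := dist_pos.2 hne
  have hPQ : 0 < P * Q := mul_pos hx hx'
  set σ := dist x x' / √(P * Q) with hσ
  have hσp : 0 < σ := div_pos hd (Real.sqrt_pos.2 hPQ)
  have hdd : dist x x' ^ 2 = (P - Q) ^ 2 + (x 1 - x' 1) ^ 2 := by
    rw [EuclideanSpace.dist_eq, Real.sq_sqrt (by positivity)]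
    simp [Fin.sum_univ_two, Real.dist_eq, sq_abs, P, Q]
  have h1 : ∀ θ : ℝ, cos θ / √((x 1 - x' 1) ^ 2 + P ^ 2 + Q ^ 2 - 2 * P * Q * cos θ) =
      (√(P * Q))⁻¹ * (cos θ / √(σ ^ 2 + 4 * sin (θ / 2) ^ 2)) := by
    intro θ
    have hc : cos θ = 1 - 2 * sin (θ / 2) ^ 2 := by
      have := cos_two_mul (θ / 2)
      have h2 := sin_sq_add_cos_sq (θ / 2)
      rw [show 2 * (θ / 2) = θ by ring] at this
      linarith
    have : (x 1 - x' 1) ^ 2 + P ^ 2 + Q ^ 2 - 2 * P * Q * cos θ =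
        (P * Q) * (σ ^ 2 + 4 * sin (θ / 2) ^ 2) := by
      rw [hσ, div_pow, Real.sq_sqrt hPQ.le, hdd, mul_add, mul_div_cancel₀ _ hPQ.ne', hc]
      ring
    rw [this, Real.sqrt_mul hPQ.le, div_mul_eq_div_div_swap, div_eq_inv_mul _ (√(P * Q))]
  have hG : Gstar x x' = P * Q ^ 2 / (4 * π) * ∫ θ in (-π)..π, cos θ /
      √((x 1 - x' 1) ^ 2 + P ^ 2 + Q ^ 2 - 2 * P * Q * cos θ) := rfl
  unfold gk
  simp_rw [hG, h1]
  rw [intervalIntegral.integral_const_mul, integral_cos_div_sqrt hσp]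
  have hsP := Real.mul_self_sqrt hx.le
  have hsQ := Real.mul_self_sqrt hx'.le
  rw [Real.sqrt_mul hx.le]
  have hp : 0 < √P := Real.sqrt_pos.2 hx
  have hq : 0 < √Q := Real.sqrt_pos.2 hx'
  have e1 : P * Q ^ 2 / (4 * π) = √P * (√P * (√Q * √Q) * Q) / (4 * π) := by
    rw [hsQ, ← mul_assoc, ← mul_assoc, hsP]; ring
  rw [Real.sqrt_mul hx.le] at hσ
  rw [e1, ← hσ]
  field_simp
  ring

lemma integrableOn_ball_inv_norm (τ : ℝ) :
    IntegrableOn (fun w : ℂ => ‖w‖⁻¹) (Metric.ball 0 τ) := by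
  rw [integrableOn_fun_norm_addHaar volume (f := fun r : ℝ => r⁻¹)]
  simp only [Complex.finrank_real_complex, Nat.reduceSub, pow_one, smul_eq_mul]
  have : IntegrableOn (fun _ : ℝ => (1 : ℝ)) (Set.Ioo 0 τ) := by
    simp
  refine this.congr_fun (fun r hr => ?_) measurableSet_Ioo
  have : r ≠ 0 := hr.1.ne'
  simp [this]

lemma integral_ball_inv_norm {τ : ℝ} (hτ : 0 ≤ τ) :
    ∫ w in Metric.ball (0 : ℂ) τ, ‖w‖⁻¹ = 2 * π * τ := by
  have h := integral_fun_norm_addHaar (volume : Measure ℂ)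
    (fun r => Set.indicator (Set.Iio τ) (fun r : ℝ => r⁻¹) r)
  rw [← integral_indicator measurableSet_ball]
  have e1 : ∀ w : ℂ, Set.indicator (Metric.ball 0 τ) (fun w : ℂ => ‖w‖⁻¹) w =
      Set.indicator (Set.Iio τ) (fun r : ℝ => r⁻¹) ‖w‖ := by
    intro w
    simp [Set.indicator]
  simp_rw [e1]
  rw [h]
  simp only [Complex.finrank_real_complex, Nat.reduceSub, pow_one, smul_eq_mul]
  have e2 : ∀ y ∈ Set.Ioi (0 : ℝ), y * Set.indicator (Set.Iio τ) (fun r : ℝ => r⁻¹) y =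
      Set.indicator (Set.Ioo 0 τ) (fun _ => (1 : ℝ)) y := by
    intro y hy
    have : y ≠ 0 := (Set.mem_Ioi.1 hy).ne'
    by_cases h : y < τ
    · rw [Set.indicator_of_mem (by simpa using h), Set.indicator_of_mem (show y ∈ Set.Ioo 0 τ from ⟨hy, h⟩)]
      field_simp
    · rw [Set.indicator_of_notMem (by simpa using h), Set.indicator_of_notMem (fun h' => h h'.2)]
      simp
  rw [setIntegral_congr_fun measurableSet_Ioi e2, setIntegral_indicator measurableSet_Ioo,
    Set.inter_eq_self_of_subset_right Set.Ioo_subset_Ioi_self]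
  simp [measureReal_def, hτ]
  ring

lemma integrable_indicator_inv_dist (z : ℂ) (τ : ℝ) :
    Integrable (Set.indicator (Metric.ball z τ) (fun w => ‖z - w‖⁻¹)) := by
  have h := (integrableOn_ball_inv_norm τ).integrable_indicator measurableSet_ball
  have h2 := h.comp_sub_right z
  refine h2.congr (Eventually.of_forall fun w => ?_)
  simp only [Set.indicator, mem_ball_iff_norm, sub_zero, norm_sub_rev z w]

lemma integral_indicator_inv_dist (z : ℂ) {τ : ℝ} (hτ : 0 ≤ τ) :
    ∫ w, Set.indicator (Metric.ball z τ) (fun w => ‖z - w‖⁻¹) w = 2 * π * τ := by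
  rw [← integral_ball_inv_norm hτ, ← integral_indicator measurableSet_ball,
    ← integral_sub_right_eq_self (Set.indicator (Metric.ball (0 : ℂ) τ) fun w => ‖w‖⁻¹) z]
  congr 1
  funext w
  simp only [Set.indicator, mem_ball_iff_norm, sub_zero, norm_sub_rev z w]

lemma inv_dist_le (z w : ℂ) {τ : ℝ} (hτ : 0 < τ) :
    ‖z - w‖⁻¹ ≤ Set.indicator (Metric.ball z τ) (fun w => ‖z - w‖⁻¹) w + τ⁻¹ := by
  by_cases h : w ∈ Metric.ball z τ
  · rw [Set.indicator_of_mem h]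
    have : 0 < τ⁻¹ := inv_pos.2 hτ
    linarith
  · rw [Set.indicator_of_notMem h, zero_add]
    apply inv_anti₀ hτ
    rw [Metric.mem_ball, dist_eq_norm, norm_sub_rev] at h
    linarith

lemma integrableOn_inv_dist (z : ℂ) {E : Set ℂ} (hE : volume E ≠ ⊤) :
    IntegrableOn (fun w => ‖z - w‖⁻¹) E := by
  have h : IntegrableOn (fun w => Set.indicator (Metric.ball z 1) (fun w => ‖z - w‖⁻¹) w + 1⁻¹) E :=
    (integrable_indicator_inv_dist z 1).integrableOn.add (integrableOn_const hE)
  refine h.mono' ?_ (Eventually.of_forall fun w => ?_)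
  · exact Measurable.aestronglyMeasurable (by fun_prop)
  · rw [norm_of_nonneg (by positivity)]
    exact inv_dist_le z w one_pos

lemma setIntegral_inv_dist_le (z : ℂ) {E : Set ℂ} (hE : volume E ≠ ⊤) {τ : ℝ} (hτ : 0 < τ) :
    ∫ w in E, ‖z - w‖⁻¹ ≤ 2 * π * τ + volume.real E / τ := by
  have hi := (integrable_indicator_inv_dist z τ)
  have h1 : ∫ w in E, ‖z - w‖⁻¹ ≤
      ∫ w in E, (Set.indicator (Metric.ball z τ) (fun w => ‖z - w‖⁻¹) w + τ⁻¹) := by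
    apply integral_mono (integrableOn_inv_dist z hE)
    · exact hi.integrableOn.add (integrableOn_const hE)
    · exact fun w => inv_dist_le z w hτ
  have h2 : ∫ w in E, Set.indicator (Metric.ball z τ) (fun w => ‖z - w‖⁻¹) w ≤ 2 * π * τ := by
    rw [← integral_indicator_inv_dist z hτ.le]
    apply setIntegral_le_integral hi
    exact Eventually.of_forall fun w => Set.indicator_nonneg (fun _ _ => by positivity) _
  rw [integral_add hi.integrableOn (integrableOn_const hE), setIntegral_const, smul_eq_mul] at h1
  rw [div_eq_mul_inv]
  linarith

lemma abs_log_le {d : ℝ} (hd : 0 ≤ d) : |log d| ≤ d + d⁻¹ := by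
  rcases hd.eq_or_lt with rfl | hd
  · simp
  have h1 := log_le_sub_one_of_pos hd
  have h2 := log_le_sub_one_of_pos (inv_pos.2 hd)
  rw [log_inv] at h2
  have := inv_pos.2 hd
  rw [abs_le]
  constructor <;> linarith

lemma integrableOn_log_dist (z : ℂ) {E : Set ℂ} (hE : Bornology.IsBounded E) :
    IntegrableOn (fun w => log ‖z - w‖) E := by
  have hf : volume E ≠ ⊤ := hE.measure_lt_top.ne
  obtain ⟨R, hR⟩ := hE.subset_closedBall z
  have h : IntegrableOn (fun w => R + ‖z - w‖⁻¹) (Metric.closedBall z R) :=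
    (integrableOn_const (by exact Metric.isBounded_closedBall.measure_lt_top.ne)).add
      (integrableOn_inv_dist z (by exact Metric.isBounded_closedBall.measure_lt_top.ne))
  refine IntegrableOn.mono_set ?_ hR
  refine h.mono' ?_ ?_
  · exact Measurable.aestronglyMeasurable (by fun_prop)
  · refine (ae_restrict_iff' measurableSet_closedBall).2 (Eventually.of_forall fun w hw => ?_)
    rw [norm_eq_abs]
    refine (abs_log_le (norm_nonneg _)).trans ?_
    rw [Metric.mem_closedBall, dist_eq_norm, norm_sub_rev] at hw
    linarith

lemma log_sub_log_le {a b : ℝ} (ha : 0 < a) (hb : 0 < b) : |log a - log b| ≤ |a - b| * (a⁻¹ + b⁻¹) := by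
  have key : ∀ {a b : ℝ}, 0 < a → 0 < b → log a - log b ≤ |a - b| * (a⁻¹ + b⁻¹) := by
    intro a b ha hb
    rw [← log_div ha.ne' hb.ne']
    refine (log_le_sub_one_of_pos (div_pos ha hb)).trans ?_
    have h1 : a / b - 1 = (a - b) * b⁻¹ := by field_simp
    rw [h1]
    have h2 := inv_pos.2 ha
    have h3 := inv_pos.2 hb
    nlinarith [le_abs_self (a - b), abs_nonneg (a - b)]
  have h1 := key ha hb
  have h2 := key hb ha
  rw [abs_sub_comm b a, add_comm] at h2
  rw [abs_le]
  constructor <;> linarith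

lemma log_dist_sub_le {z₁ z₂ w : ℂ} (h₁ : w ≠ z₁) (h₂ : w ≠ z₂) :
    |log ‖z₁ - w‖ - log ‖z₂ - w‖| ≤ ‖z₁ - z₂‖ * (‖z₁ - w‖⁻¹ + ‖z₂ - w‖⁻¹) := by
  refine (log_sub_log_le (norm_pos_iff.2 (sub_ne_zero.2 h₁.symm))
    (norm_pos_iff.2 (sub_ne_zero.2 h₂.symm))).trans ?_
  gcongr
  refine (abs_norm_sub_norm_le _ _).trans (le_of_eq ?_)
  congr 1; ring

lemma ae_ne_pair (z₁ z₂ : ℂ) (μ : Measure ℂ) [NullSingletonClass μ] : ∀ᵐ w ∂μ, w ≠ z₁ ∧ w ≠ z₂ := by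
  have h : ∀ z : ℂ, ∀ᵐ w ∂μ, w ≠ z := fun z => by
    rw [ae_iff]; simp
  filter_upwards [h z₁, h z₂] with w h1 h2 using ⟨h1, h2⟩

/-- A kernel which is Lipschitz with logarithmic-type singularity has a Lipschitz potential. -/
lemma setIntegral_abs_sub_le {E : Set ℂ} (hE : volume E ≠ ⊤) {f₁ f₂ : ℂ → ℝ}
    {z₁ z₂ : ℂ} {ν : ℝ} (hν : 0 ≤ ν) (hEm : MeasurableSet E)
    (h : ∀ w ∈ E, w ≠ z₁ → w ≠ z₂ → |f₁ w - f₂ w| ≤ ν * (1 + ‖z₁ - w‖⁻¹ + ‖z₂ - w‖⁻¹)) :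
    ∫ w in E, |f₁ w - f₂ w| ≤ ν * (volume.real E + 2 * (2 * π + volume.real E)) := by
  have i1 := integrableOn_inv_dist z₁ hE
  have i2 := integrableOn_inv_dist z₂ hE
  have i0 : IntegrableOn (fun _ : ℂ => (1 : ℝ)) E := integrableOn_const hE
  have h1 := setIntegral_inv_dist_le z₁ hE one_pos
  have h2 := setIntegral_inv_dist_le z₂ hE one_pos
  calc ∫ w in E, |f₁ w - f₂ w| ≤ ∫ w in E, ν * (1 + ‖z₁ - w‖⁻¹ + ‖z₂ - w‖⁻¹) := by
        apply integral_mono_of_nonneg (Eventually.of_forall fun _ => abs_nonneg _)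
        · exact ((i0.add i1).add i2).const_mul ν
        · filter_upwards [ae_ne_pair z₁ z₂ (volume.restrict E), ae_restrict_mem hEm] with w hw hw'
          exact h w hw' hw.1 hw.2
    _ = ν * (volume.real E + ∫ w in E, ‖z₁ - w‖⁻¹) + ν * ∫ w in E, ‖z₂ - w‖⁻¹ := by
        have i01 : IntegrableOn (fun w => 1 + ‖z₁ - w‖⁻¹) E := i0.add i1
        rw [integral_const_mul, integral_add i01 i2, integral_add i0 i1, setIntegral_const]
        simp; ring
    _ ≤ _ := by
        rw [div_one, mul_one] at h1 h2
        nlinarith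

lemma setIntegral_log_dist_sub_le {E : Set ℂ} (hE : Bornology.IsBounded E) (z₁ z₂ : ℂ) {τ : ℝ}
    (hτ : 0 < τ) : ∫ w in E, |log ‖z₁ - w‖ - log ‖z₂ - w‖| ≤
      ‖z₁ - z₂‖ * (2 * (2 * π * τ + volume.real E / τ)) := by
  have hf : volume E ≠ ⊤ := hE.measure_lt_top.ne
  have i1 := integrableOn_inv_dist z₁ hf
  have i2 := integrableOn_inv_dist z₂ hf
  have h1 := setIntegral_inv_dist_le z₁ hf hτ
  have h2 := setIntegral_inv_dist_le z₂ hf hτ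
  calc ∫ w in E, |log ‖z₁ - w‖ - log ‖z₂ - w‖|
      ≤ ∫ w in E, ‖z₁ - z₂‖ * (‖z₁ - w‖⁻¹ + ‖z₂ - w‖⁻¹) := by
        apply integral_mono_of_nonneg (Eventually.of_forall fun _ => abs_nonneg _)
        · exact (i1.add i2).const_mul _
        · filter_upwards [ae_ne_pair z₁ z₂ (volume.restrict E)] with w hw
          exact log_dist_sub_le hw.1 hw.2
    _ = ‖z₁ - z₂‖ * ((∫ w in E, ‖z₁ - w‖⁻¹) + ∫ w in E, ‖z₂ - w‖⁻¹) := by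
        rw [integral_const_mul, integral_add i1 i2]
    _ ≤ _ := by
        gcongr
        linarith

/-- The region `{r² < 1 + 2 η(θ)}` in polar coordinates. -/
def region (η : ℝ → ℝ) : Set ℂ := {z | ‖z‖ ^ 2 < 1 + 2 * η z.arg}

lemma measurableSet_region {η : ℝ → ℝ} (hη : Measurable η) : MeasurableSet (region η) :=
  measurableSet_lt (by fun_prop) ((hη.comp Complex.measurable_arg).const_mul 2 |>.const_add 1)

lemma region_subset_ball {η : ℝ → ℝ} (hb : ∀ θ, |η θ| ≤ 1 / 8) : region η ⊆ Metric.ball 0 2 := by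
  intro z hz
  rw [mem_ball_zero_iff]
  have h1 := (abs_le.1 (hb z.arg)).2
  have h2 : ‖z‖ ^ 2 < 1 + 2 * η z.arg := hz
  nlinarith [norm_nonneg z]

lemma isBounded_region {η : ℝ → ℝ} (hb : ∀ θ, |η θ| ≤ 1 / 8) : Bornology.IsBounded (region η) :=
  Metric.isBounded_ball.subset (region_subset_ball hb)

lemma polar_inner (c : ℝ) (hc : 0 ≤ c) :
    ∫ r in Set.Ioi (0 : ℝ), (if r ^ 2 < c then r else 0) = c / 2 := by
  have h1 : ∀ r ∈ Set.Ioi (0 : ℝ), (if r ^ 2 < c then r else 0) =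
      Set.indicator (Set.Ioo 0 (√c)) (fun r => r) r := by
    intro r hr
    have hr : 0 < r := hr
    by_cases h : r ^ 2 < c
    · rw [if_pos h, Set.indicator_of_mem (show r ∈ Set.Ioo 0 (√c) from ⟨hr, Real.lt_sqrt_of_sq_lt h⟩)]
    · rw [if_neg h, Set.indicator_of_notMem]
      intro h'
      exact h ((Real.lt_sqrt hr.le).1 h'.2)
  rw [setIntegral_congr_fun measurableSet_Ioi h1, setIntegral_indicator measurableSet_Ioo,
    Set.inter_eq_self_of_subset_right Set.Ioo_subset_Ioi_self, ← integral_Ioc_eq_integral_Ioo,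
    ← intervalIntegral.integral_of_le (Real.sqrt_nonneg c), integral_id, Real.sq_sqrt hc]
  ring

/-- Integration in polar coordinates of a function of the angle over a region. -/
lemma region_integral {η G : ℝ → ℝ} (hη : Measurable η) (hb : ∀ θ, |η θ| ≤ 1 / 8)
    (hG : Measurable G) (hi : IntervalIntegrable G volume (-π) π) :
    IntegrableOn (fun w : ℂ => G w.arg) (region η) ∧
      ∫ w in region η, G w.arg = ∫ θ in (-π)..π, (1 / 2 + η θ) * G θ := by
  have hpi : -π ≤ π := by linarith [pi_pos]
  have hm := measurableSet_region hη
  set f : ℂ → ℝ := Set.indicator (region η) (fun w => G w.arg) with hf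
  set F : ℝ × ℝ → ℝ := fun p => (if p.1 ^ 2 < 1 + 2 * η p.2 then p.1 else 0) * G p.2 with hF
  have hT : polarCoord.target = Set.Ioi (0 : ℝ) ×ˢ Set.Ioo (-π) π := rfl
  have hTm : MeasurableSet polarCoord.target := polarCoord.open_target.measurableSet
  have hfF : ∀ p ∈ polarCoord.target, p.1 * f (Complex.polarCoord.symm p) = F p := by
    intro p hp
    have h := Complex.polarCoord.right_inv (x := p) hp
    rw [Complex.polarCoord_apply] at h
    have h1 : ‖Complex.polarCoord.symm p‖ = p.1 := congrArg Prod.fst h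
    have h2 : (Complex.polarCoord.symm p).arg = p.2 := congrArg Prod.snd h
    simp only [hf, hF, Set.indicator, region, Set.mem_ofPred_eq, h1, h2]
    split_ifs <;> simp
  have hFm : Measurable F := by
    apply Measurable.mul _ (hG.comp measurable_snd)
    exact Measurable.ite (measurableSet_lt (by fun_prop)
      ((hη.comp measurable_snd).const_mul 2 |>.const_add 1)) measurable_fst measurable_const
  have hGi : IntegrableOn G (Set.Ioo (-π) π) := by
    rw [← integrableOn_Ioc_iff_integrableOn_Ioo]
    exact (intervalIntegrable_iff_integrableOn_Ioc_of_le hpi).1 hi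
  have hFi : IntegrableOn F polarCoord.target := by
    have h1 : Integrable (Set.indicator (Set.Ioo (0 : ℝ) 2) (fun _ => (2 : ℝ)))
        (volume.restrict (Set.Ioi 0)) :=
      ((integrable_indicator_iff measurableSet_Ioo).2 (integrableOn_const (by simp))).integrableOn
    have h2 := h1.mul_prod hGi.norm
    rw [Measure.prod_restrict] at h2
    rw [hT]
    refine Integrable.mono' h2 hFm.aestronglyMeasurable ?_
    refine (ae_restrict_iff' (hT ▸ hTm)).2 (Eventually.of_forall fun p hp => ?_)
    have hp0 : 0 < p.1 := hp.1
    simp only [hF]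
    rw [norm_mul]
    apply mul_le_mul_of_nonneg_right _ (norm_nonneg _)
    split_ifs with h
    · have h3 := (abs_le.1 (hb p.2)).2
      have h4 : p.1 < 2 := by nlinarith
      rw [Set.indicator_of_mem (show p.1 ∈ Set.Ioo 0 2 from ⟨hp0, h4⟩), norm_of_nonneg hp0.le]
      exact h4.le
    · simp only [norm_zero]
      exact Set.indicator_nonneg (fun _ _ => by norm_num) _
  have hfm : Measurable f := (hG.comp Complex.measurable_arg).indicator hm
  have hfi : Integrable f := by
    refine ⟨hfm.aestronglyMeasurable, ?_⟩
    rw [hasFiniteIntegral_iff_enorm, ← Complex.lintegral_comp_polarCoord_symm]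
    have := hFi.2
    rw [hasFiniteIntegral_iff_enorm] at this
    refine lt_of_eq_of_lt (setLIntegral_congr_fun hTm fun p hp => ?_) this
    rw [← hfF p hp, enorm_mul, Real.enorm_eq_ofReal (le_of_lt hp.1), smul_eq_mul]
  refine ⟨(integrable_indicator_iff hm).1 hfi, ?_⟩
  rw [← integral_indicator hm, ← Complex.integral_comp_polarCoord_symm]
  simp_rw [smul_eq_mul]
  rw [setIntegral_congr_fun hTm hfF, hT]
  have hvol : (volume : Measure (ℝ × ℝ)) = volume.prod volume := rfl
  rw [hvol, ← Measure.prod_restrict, integral_prod_symm]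
  · rw [intervalIntegral.integral_of_le hpi, integral_Ioc_eq_integral_Ioo]
    congr 1
    funext θ
    simp only [hF]
    rw [integral_mul_const, polar_inner]
    · ring
    · have := (abs_le.1 (hb θ)).1
      linarith
  · rw [Measure.prod_restrict]
    exact hFi

lemma region_max {η₁ η₂ : ℝ → ℝ} : region (fun θ => max (η₁ θ) (η₂ θ)) = region η₁ ∪ region η₂ := by
  ext z
  simp only [region, Set.mem_ofPred_eq, Set.mem_union]
  rcases le_total (η₁ z.arg) (η₂ z.arg) with h | h
  · rw [max_eq_right h]
    constructor
    · exact Or.inr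
    · rintro (h' | h') <;> linarith
  · rw [max_eq_left h]
    constructor
    · exact Or.inl
    · rintro (h' | h') <;> linarith

lemma region_min {η₁ η₂ : ℝ → ℝ} : region (fun θ => min (η₁ θ) (η₂ θ)) = region η₁ ∩ region η₂ := by
  ext z
  simp only [region, Set.mem_ofPred_eq, Set.mem_inter_iff]
  rcases le_total (η₁ z.arg) (η₂ z.arg) with h | h
  · rw [min_eq_left h]
    exact ⟨fun h' => ⟨h', by linarith⟩, fun h' => h'.1⟩
  · rw [min_eq_right h]
    exact ⟨fun h' => ⟨by linarith, h'⟩, fun h' => h'.2⟩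

lemma symmDiff_region_integral {η₁ η₂ G : ℝ → ℝ} (h₁ : Measurable η₁) (h₂ : Measurable η₂)
    (hb₁ : ∀ θ, |η₁ θ| ≤ 1 / 8) (hb₂ : ∀ θ, |η₂ θ| ≤ 1 / 8)
    (hG : Measurable G) (hi : IntervalIntegrable G volume (-π) π) :
    IntegrableOn (fun w : ℂ => G w.arg) (region η₁ ∆ region η₂) ∧
      ∫ w in region η₁ ∆ region η₂, G w.arg = ∫ θ in (-π)..π, |η₁ θ - η₂ θ| * G θ := by
  have hbM : ∀ θ, |max (η₁ θ) (η₂ θ)| ≤ 1 / 8 := fun θ => by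
    rcases max_choice (η₁ θ) (η₂ θ) with h | h <;> rw [h]
    exacts [hb₁ θ, hb₂ θ]
  have hbm : ∀ θ, |min (η₁ θ) (η₂ θ)| ≤ 1 / 8 := fun θ => by
    rcases min_choice (η₁ θ) (η₂ θ) with h | h <;> rw [h]
    exacts [hb₁ θ, hb₂ θ]
  have hii : ∀ {η : ℝ → ℝ}, Measurable η → (∀ θ, |η θ| ≤ 1 / 8) →
      IntervalIntegrable (fun θ => (1 / 2 + η θ) * G θ) volume (-π) π := fun {η} hη hb => by
    refine hi.mono_fun ((hη.const_add _).mul hG).aestronglyMeasurable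
      (Eventually.of_forall fun θ => ?_)
    show ‖(1 / 2 + η θ) * G θ‖ ≤ ‖G θ‖
    rw [norm_mul]
    have h := abs_le.1 (hb θ)
    have : ‖1 / 2 + η θ‖ ≤ 1 := by
      rw [norm_eq_abs, abs_le]
      constructor <;> linarith
    nlinarith [norm_nonneg (G θ)]
  have hM := region_integral (h₁.max h₂) hbM hG hi
  have hm := region_integral (h₁.min h₂) hbm hG hi
  have hsub : region η₁ ∩ region η₂ ⊆ region η₁ ∪ region η₂ :=
    Set.inter_subset_left.trans Set.subset_union_left
  have hmm : MeasurableSet (region η₁ ∩ region η₂) :=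
    (measurableSet_region h₁).inter (measurableSet_region h₂)
  rw [region_max] at hM
  rw [region_min] at hm
  have hD : region η₁ ∆ region η₂ = (region η₁ ∪ region η₂) \ (region η₁ ∩ region η₂) :=
    symmDiff_eq_sup_sdiff_inf _ _
  rw [hD]
  refine ⟨hM.1.mono_set Set.sdiff_subset, ?_⟩
  rw [setIntegral_sdiff hmm hM.1 hsub, hM.2, hm.2,
    ← intervalIntegral.integral_sub]
  · congr 1
    funext θ
    rw [← max_sub_min_eq_abs']
    ring
  · exact hii (h₁.max h₂) hbM
  · exact hii (h₁.min h₂) hbm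

/-- The first coordinate in the rescaled picture. -/
def px (δ : ℝ) (z : ℂ) : ℝ := 1 + δ * z.re

/-- The amplitude of the logarithmic singularity of the rescaled kernel. -/
def am (δ : ℝ) (z w : ℂ) : ℝ := √(px δ z) * (px δ w * √(px δ w))

/-- The rescaled kernel. -/
def kd (δ : ℝ) (z w : ℂ) : ℝ := gk (px δ z) (px δ w) (δ * ‖z - w‖)

/-- The deviation of the rescaled kernel from the planar logarithmic kernel. -/
def Rk (δ : ℝ) (z w : ℂ) : ℝ :=
  (am δ z w - 1) * (-log δ - log ‖z - w‖) + am δ z w * (log (px δ z * px δ w) / 2) +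
    (am δ z w * bker (δ * ‖z - w‖ / √(px δ z * px δ w)) - bker 0) / 2

/-- The additive constant of the rescaled kernel. -/
def cst (δ : ℝ) : ℝ := -log δ + bker 0 / 2

lemma kd_eq {δ : ℝ} (hδ : 0 < δ) {z w : ℂ} (hz : 0 < px δ z) (hw : 0 < px δ w) (h : z ≠ w) :
    kd δ z w = -log ‖z - w‖ + Rk δ z w + cst δ := by
  have hd : ‖z - w‖ ≠ 0 := norm_ne_zero_iff.2 (sub_ne_zero.2 h)
  have hPQ : 0 < px δ z * px δ w := mul_pos hz hw
  have hs : √(px δ z * px δ w) ≠ 0 := (Real.sqrt_pos.2 hPQ).ne'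
  unfold kd gk Rk cst
  rw [log_div (mul_ne_zero hδ.ne' hd) hs, log_mul hδ.ne' hd, log_sqrt hPQ.le]
  unfold am
  ring

lemma px_bounds {δ M : ℝ} (hδ : 0 < δ) (hM : δ * M ≤ 1 / 4) {z : ℂ} (hz : ‖z‖ ≤ M) :
    |px δ z - 1| ≤ δ * M ∧ 3 / 4 ≤ px δ z ∧ px δ z ≤ 5 / 4 := by
  have h1 : |px δ z - 1| ≤ δ * M := by
    have : px δ z - 1 = δ * z.re := by unfold px; ring
    rw [this, abs_mul, abs_of_pos hδ]
    exact mul_le_mul_of_nonneg_left ((Complex.abs_re_le_norm z).trans hz) hδ.le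
  have h2 := abs_le.1 (h1.trans hM)
  exact ⟨h1, by linarith, by linarith⟩

lemma px_sub_le {δ : ℝ} (hδ : 0 < δ) (z₁ z₂ : ℂ) : |px δ z₁ - px δ z₂| ≤ δ * ‖z₁ - z₂‖ := by
  have : px δ z₁ - px δ z₂ = δ * (z₁ - z₂).re := by unfold px; rw [Complex.sub_re]; ring
  rw [this, abs_mul, abs_of_pos hδ]
  exact mul_le_mul_of_nonneg_left (Complex.abs_re_le_norm _) hδ.le

lemma sqrt_sub_one_le {x : ℝ} (hx : 0 ≤ x) : |√x - 1| ≤ |x - 1| := by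
  have h : x - 1 = (√x - 1) * (√x + 1) := by
    have := Real.mul_self_sqrt hx
    nlinarith
  conv_rhs => rw [h]
  rw [abs_mul]
  have h0 := Real.sqrt_nonneg x
  rw [abs_of_nonneg (by linarith : 0 ≤ √x + 1)]
  nlinarith [abs_nonneg (√x - 1)]

lemma amplitude_expand {α β t : ℝ} (ht : t ≤ 1 / 4) (hα : |α| ≤ t) (hβ : |β| ≤ t) :
    |(1 + α) * (1 + β) ^ 3 - 1 - (((1 + α) * (1 + α) - 1) / 2 +
      3 * ((1 + β) * (1 + β) - 1) / 2)| ≤ 11 * t ^ 2 := by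
  have hα2 : |α| * |α| ≤ t ^ 2 := by
    rw [sq]; exact mul_le_mul hα hα (abs_nonneg _) ((abs_nonneg _).trans hα)
  have hβ2 : |β| * |β| ≤ t ^ 2 := by
    rw [sq]; exact mul_le_mul hβ hβ (abs_nonneg _) ((abs_nonneg _).trans hβ)
  have hαβ : |α| * |β| ≤ t ^ 2 := by
    rw [sq]; exact mul_le_mul hα hβ (abs_nonneg _) ((abs_nonneg _).trans hα)
  have hβ1 := abs_le.1 (hβ.trans ht)
  have e : (1 + α) * (1 + β) ^ 3 - 1 - (((1 + α) * (1 + α) - 1) / 2 +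
    3 * ((1 + β) * (1 + β) - 1) / 2) = β * β * (3 / 2 + β) + α * β * (3 + 3 * β + β * β)
      - α * α / 2 := by ring
  rw [e]
  have e1 : |β * β * (3 / 2 + β)| ≤ t ^ 2 * 2 := by
    rw [abs_mul, abs_mul]
    have : |3 / 2 + β| ≤ 2 := by
      rw [abs_le]; constructor <;> linarith
    gcongr
  have e2 : |α * β * (3 + 3 * β + β * β)| ≤ t ^ 2 * 4 := by
    rw [abs_mul, abs_mul]
    have : |3 + 3 * β + β * β| ≤ 4 := by
      rw [abs_le]; constructor <;> nlinarith
    gcongr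
  have e3 : |α * α / 2| ≤ t ^ 2 / 2 := by
    rw [abs_div, abs_mul, abs_two]; linarith
  have h1 := abs_sub (β * β * (3 / 2 + β) + α * β * (3 + 3 * β + β * β)) (α * α / 2)
  have h2 := abs_add_le (β * β * (3 / 2 + β)) (α * β * (3 + 3 * β + β * β))
  have := sq_nonneg t
  linarith

lemma am_expand {δ M : ℝ} (hδ : 0 < δ) (hM0 : 0 ≤ M) (hM : δ * M ≤ 1 / 4) {z w : ℂ} (hz : ‖z‖ ≤ M)
    (hw : ‖w‖ ≤ M) :
    |am δ z w - 1 - δ * (z.re / 2 + 3 * w.re / 2)| ≤ 11 * (δ * M) ^ 2 ∧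
      |am δ z w - 1| ≤ 5 * (δ * M) ∧ am δ z w ≤ 9 / 4 := by
  obtain ⟨hz1, hz2, hz3⟩ := px_bounds hδ hM hz
  obtain ⟨hw1, hw2, hw3⟩ := px_bounds hδ hM hw
  have ht : 0 ≤ δ * M := by positivity
  have hp := Real.mul_self_sqrt (show 0 ≤ px δ z by linarith)
  have hq := Real.mul_self_sqrt (show 0 ≤ px δ w by linarith)
  have hα := (sqrt_sub_one_le (show 0 ≤ px δ z by linarith)).trans hz1
  have hβ := (sqrt_sub_one_le (show 0 ≤ px δ w by linarith)).trans hw1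
  have hzr : δ * z.re = px δ z - 1 := by unfold px; ring
  have hwr : δ * w.re = px δ w - 1 := by unfold px; ring
  have ham : am δ z w = √(px δ z) * √(px δ w) ^ 3 := by
    unfold am
    rw [show px δ w * √(px δ w) = (√(px δ w) * √(px δ w)) * √(px δ w) by rw [hq]]; ring
  have key := amplitude_expand hM hα hβ
  simp only [add_sub_cancel] at key
  rw [hp, hq, ← ham] at key
  rw [show δ * (z.re / 2 + 3 * w.re / 2) = (δ * z.re) / 2 + 3 * (δ * w.re) / 2 by ring, hzr, hwr]
  have hk := abs_le.1 key
  have h3 := abs_le.1 hz1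
  have h4 := abs_le.1 hw1
  have h5 : |am δ z w - 1| ≤ 5 * (δ * M) := by
    have ht2 : (δ * M) ^ 2 ≤ (δ * M) / 4 := by nlinarith
    rw [abs_le]; constructor <;> linarith
  refine ⟨key, h5, ?_⟩
  have := (abs_le.1 h5).2
  linarith

lemma am_sub_le {δ M : ℝ} (hδ : 0 < δ) (hM : δ * M ≤ 1 / 4) {z₁ z₂ w : ℂ} (hz₁ : ‖z₁‖ ≤ M)
    (hz₂ : ‖z₂‖ ≤ M) (hw : ‖w‖ ≤ M) :
    |am δ z₁ w - am δ z₂ w| ≤ 2 * (δ * ‖z₁ - z₂‖) := by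
  obtain ⟨-, h1, -⟩ := px_bounds hδ hM hz₁
  obtain ⟨-, h2, -⟩ := px_bounds hδ hM hz₂
  obtain ⟨-, h3, h4⟩ := px_bounds hδ hM hw
  have h5 : am δ z₁ w - am δ z₂ w = (√(px δ z₁) - √(px δ z₂)) * (px δ w * √(px δ w)) := by
    unfold am; ring
  have hq : √(px δ w) ≤ 3 / 2 := by
    rw [Real.sqrt_le_left (by norm_num)]; linarith
  have h6 : |px δ w * √(px δ w)| ≤ 2 := by
    rw [abs_of_nonneg (by positivity)]
    nlinarith [Real.sqrt_nonneg (px δ w)]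
  have h7 : |√(px δ z₁) - √(px δ z₂)| ≤ |px δ z₁ - px δ z₂| := by
    have e1 := Real.mul_self_sqrt (show 0 ≤ px δ z₁ by linarith)
    have e2 := Real.mul_self_sqrt (show 0 ≤ px δ z₂ by linarith)
    have e : px δ z₁ - px δ z₂ = (√(px δ z₁) - √(px δ z₂)) * (√(px δ z₁) + √(px δ z₂)) := by
      linear_combination -e1 + e2
    have g1 : 1 / 2 ≤ √(px δ z₁) := Real.le_sqrt_of_sq_le (by norm_num; linarith)
    have g2 : 1 / 2 ≤ √(px δ z₂) := Real.le_sqrt_of_sq_le (by norm_num; linarith)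
    rw [e, abs_mul, abs_of_nonneg (by linarith : 0 ≤ √(px δ z₁) + √(px δ z₂))]
    nlinarith [abs_nonneg (√(px δ z₁) - √(px δ z₂))]
  have h8 := px_sub_le hδ z₁ z₂
  rw [h5, abs_mul, mul_comm 2]
  gcongr
  exact h7.trans h8

lemma log_sub_log_le_of_ge {a b : ℝ} (ha : 3 / 4 ≤ a) (hb : 3 / 4 ≤ b) :
    |log a - log b| ≤ 3 * |a - b| := by
  refine (log_sub_log_le (by linarith) (by linarith)).trans ?_
  have h1 : a⁻¹ ≤ (3 / 4 : ℝ)⁻¹ := inv_anti₀ (by norm_num) ha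
  have h2 : b⁻¹ ≤ (3 / 4 : ℝ)⁻¹ := inv_anti₀ (by norm_num) hb
  norm_num at h1 h2
  nlinarith [abs_nonneg (a - b)]

lemma sqrt_sub_sqrt_le_of_ge {a b : ℝ} (ha : 9 / 16 ≤ a) (hb : 9 / 16 ≤ b) :
    |√a - √b| ≤ |a - b| := by
  have e1 := Real.mul_self_sqrt (show 0 ≤ a by linarith)
  have e2 := Real.mul_self_sqrt (show 0 ≤ b by linarith)
  have e : a - b = (√a - √b) * (√a + √b) := by linear_combination -e1 + e2
  have g1 : 1 / 2 ≤ √a := Real.le_sqrt_of_sq_le (by norm_num; linarith)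
  have g2 : 1 / 2 ≤ √b := Real.le_sqrt_of_sq_le (by norm_num; linarith)
  rw [e, abs_mul, abs_of_nonneg (by linarith : 0 ≤ √a + √b)]
  nlinarith [abs_nonneg (√a - √b)]

lemma sqrt_px_mul_ge {δ M : ℝ} (hδ : 0 < δ) (hM : δ * M ≤ 1 / 4) {z w : ℂ}
    (hz : ‖z‖ ≤ M) (hw : ‖w‖ ≤ M) :
    9 / 16 ≤ px δ z * px δ w ∧ 3 / 4 ≤ √(px δ z * px δ w) := by
  obtain ⟨-, h1, -⟩ := px_bounds hδ hM hz
  obtain ⟨-, h2, -⟩ := px_bounds hδ hM hw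
  have h : 9 / 16 ≤ px δ z * px δ w := by nlinarith
  exact ⟨h, Real.le_sqrt_of_sq_le (by norm_num; linarith)⟩

lemma log_px_mul_le {δ M : ℝ} (hδ : 0 < δ) (hM : δ * M ≤ 1 / 4) {z w : ℂ}
    (hz : ‖z‖ ≤ M) (hw : ‖w‖ ≤ M) : |log (px δ z * px δ w)| ≤ 6 * (δ * M) := by
  obtain ⟨h1', h1, -⟩ := px_bounds hδ hM hz
  obtain ⟨h2', h2, -⟩ := px_bounds hδ hM hw
  rw [log_mul (by linarith) (by linarith)]
  have a1 := log_sub_log_le_of_ge h1 (show (3 / 4 : ℝ) ≤ 1 by norm_num)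
  have a2 := log_sub_log_le_of_ge h2 (show (3 / 4 : ℝ) ≤ 1 by norm_num)
  rw [log_one, sub_zero] at a1 a2
  have := abs_add_le (log (px δ z)) (log (px δ w))
  linarith

lemma scaled_dist_bounds {δ M : ℝ} (hδ : 0 < δ) (hM : δ * M ≤ 1 / 4) {z w : ℂ}
    (hz : ‖z‖ ≤ M) (hw : ‖w‖ ≤ M) :
    0 ≤ δ * ‖z - w‖ / √(px δ z * px δ w) ∧ δ * ‖z - w‖ / √(px δ z * px δ w) ≤ 3 * (δ * M) := by
  obtain ⟨-, hs⟩ := sqrt_px_mul_ge hδ hM hz hw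
  refine ⟨by positivity, ?_⟩
  rw [div_le_iff₀ (by linarith)]
  have h1 : ‖z - w‖ ≤ 2 * M := (norm_sub_le _ _).trans (by linarith)
  have h2 : δ * ‖z - w‖ ≤ δ * (2 * M) := mul_le_mul_of_nonneg_left h1 hδ.le
  have h0 : 0 ≤ M := (norm_nonneg _).trans hz
  have : 0 ≤ δ * M := by positivity
  nlinarith

lemma scaled_dist_sub_le {δ M : ℝ} (hδ : 0 < δ) (hM : δ * M ≤ 1 / 4) {z₁ z₂ w : ℂ}
    (hz₁ : ‖z₁‖ ≤ M) (hz₂ : ‖z₂‖ ≤ M) (hw : ‖w‖ ≤ M) :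
    |δ * ‖z₁ - w‖ / √(px δ z₁ * px δ w) - δ * ‖z₂ - w‖ / √(px δ z₂ * px δ w)| ≤
      4 * (δ * ‖z₁ - z₂‖) := by
  obtain ⟨g1, s1⟩ := sqrt_px_mul_ge hδ hM hz₁ hw
  obtain ⟨g2, s2⟩ := sqrt_px_mul_ge hδ hM hz₂ hw
  obtain ⟨w1, w2, w3⟩ := px_bounds hδ hM hw
  have h0 := (scaled_dist_bounds hδ hM hz₁ hw).2
  set σ := δ * ‖z₁ - w‖ / √(px δ z₁ * px δ w) with hσ
  have hσ0 : 0 ≤ σ := by positivity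
  have e : σ - δ * ‖z₂ - w‖ / √(px δ z₂ * px δ w) =
      (δ * (‖z₁ - w‖ - ‖z₂ - w‖) + σ * (√(px δ z₂ * px δ w) - √(px δ z₁ * px δ w))) /
        √(px δ z₂ * px δ w) := by
    have n1 : √(px δ z₁ * px δ w) ≠ 0 := ne_of_gt (by linarith)
    have n2 : √(px δ z₂ * px δ w) ≠ 0 := ne_of_gt (by linarith)
    rw [hσ]
    generalize √(px δ z₁ * px δ w) = S₁ at n1
    generalize √(px δ z₂ * px δ w) = S₂ at n2
    field_simp
    ring
  rw [e, abs_div, abs_of_nonneg (Real.sqrt_nonneg _), div_le_iff₀ (by linarith)]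
  refine (abs_add_le _ _).trans ?_
  rw [abs_mul, abs_mul, abs_of_pos hδ, abs_of_nonneg hσ0]
  have k1 : |‖z₁ - w‖ - ‖z₂ - w‖| ≤ ‖z₁ - z₂‖ := by
    refine (abs_norm_sub_norm_le _ _).trans (le_of_eq ?_)
    congr 1; ring
  have k2 := sqrt_sub_sqrt_le_of_ge g2 g1
  have k3 : |px δ z₂ * px δ w - px δ z₁ * px δ w| ≤ 5 / 4 * (δ * ‖z₁ - z₂‖) := by
    rw [← sub_mul, abs_mul, abs_sub_comm, abs_of_pos (show 0 < px δ w by linarith), mul_comm]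
    exact mul_le_mul w3 (px_sub_le hδ _ _) (abs_nonneg _) (by norm_num)
  have k4 : δ * |‖z₁ - w‖ - ‖z₂ - w‖| ≤ δ * ‖z₁ - z₂‖ := mul_le_mul_of_nonneg_left k1 hδ.le
  have k5 : σ * |√(px δ z₂ * px δ w) - √(px δ z₁ * px δ w)| ≤ 3 / 4 * (5 / 4 * (δ * ‖z₁ - z₂‖)) :=
    mul_le_mul (by linarith) (k2.trans k3) (abs_nonneg _) (by norm_num)
  have k6 : 0 ≤ δ * ‖z₁ - z₂‖ := by positivity
  nlinarith

/-- Smallness of a perturbation of the planar logarithmic kernel on the ball of radius `M`. -/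
structure KernelBound (R : ℂ → ℂ → ℝ) (M ν : ℝ) : Prop where
  size : ∀ z w, ‖z‖ ≤ M → ‖w‖ ≤ M → z ≠ w → |R z w| ≤ ν * (1 + |log ‖z - w‖|)
  lip : ∀ z₁ z₂ w, ‖z₁‖ ≤ M → ‖z₂‖ ≤ M → ‖w‖ ≤ M → w ≠ z₁ → w ≠ z₂ →
    |R z₁ w - R z₂ w| ≤ ν * ‖z₁ - z₂‖ * (1 + ‖z₁ - w‖⁻¹ + ‖z₂ - w‖⁻¹)

lemma Rk_expand {δ M : ℝ} (hδ : 0 < δ) (hM1 : 1 ≤ M) (hM : δ * M ≤ 1 / 4)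
    (hL2 : δ * -log δ ≤ 1) {z w : ℂ} (hz : ‖z‖ ≤ M) (hw : ‖w‖ ≤ M) :
    |Rk δ z w - δ * -log δ * (z.re / 2 + 3 * w.re / 2)| ≤
      δ * ((40 + 3 * |bker 0|) * M ^ 2) * (1 + |log ‖z - w‖|) := by
  obtain ⟨h1, h2, h3⟩ := am_expand hδ (by linarith) hM hz hw
  have h4 := log_px_mul_le hδ hM hz hw
  obtain ⟨h5, h6⟩ := scaled_dist_bounds hδ hM hz hw
  have h7 := bker_lipschitz (δ * ‖z - w‖ / √(px δ z * px δ w)) 0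
  rw [sub_zero, abs_of_nonneg h5] at h7
  set b := bker (δ * ‖z - w‖ / √(px δ z * px δ w))
  have e : Rk δ z w - δ * -log δ * (z.re / 2 + 3 * w.re / 2) =
      (am δ z w - 1 - δ * (z.re / 2 + 3 * w.re / 2)) * -log δ + -((am δ z w - 1) * log ‖z - w‖) +
      am δ z w * (log (px δ z * px δ w) / 2) + (am δ z w * (b - bker 0) / 2 +
        (am δ z w - 1) * bker 0 / 2) := by
    unfold Rk; ring
  have ha0 : 0 ≤ am δ z w := by
    obtain ⟨-, h1, -⟩ := px_bounds hδ hM hw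
    unfold am
    exact mul_nonneg (Real.sqrt_nonneg _) (mul_nonneg (by linarith) (Real.sqrt_nonneg _))
  have ht : 0 ≤ δ * M := by positivity
  have hL0 : 0 ≤ -log δ := by
    have : log δ ≤ 0 := log_nonpos hδ.le (by nlinarith)
    linarith
  have t1 : |(am δ z w - 1 - δ * (z.re / 2 + 3 * w.re / 2)) * -log δ| ≤ 11 * (δ * M ^ 2) := by
    rw [abs_mul, abs_of_nonneg hL0]
    calc _ ≤ 11 * (δ * M) ^ 2 * -log δ := mul_le_mul_of_nonneg_right h1 hL0
      _ = 11 * (δ * M ^ 2) * (δ * -log δ) := by ring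
      _ ≤ 11 * (δ * M ^ 2) * 1 := by gcongr
      _ = _ := by ring
  have t2 : |-((am δ z w - 1) * log ‖z - w‖)| ≤ 5 * (δ * M) * |log ‖z - w‖| := by
    rw [abs_neg, abs_mul]; gcongr
  have t3 : |am δ z w * (log (px δ z * px δ w) / 2)| ≤ 9 / 4 * (6 * (δ * M) / 2) := by
    rw [abs_mul, abs_div, abs_two, abs_of_nonneg ha0]; gcongr
  have t4 : |am δ z w * (b - bker 0) / 2| ≤ 9 / 4 * (6 * (3 * (δ * M))) / 2 := by
    rw [abs_div, abs_mul, abs_two, abs_of_nonneg ha0]; gcongr; linarith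
  have t5 : |(am δ z w - 1) * bker 0 / 2| ≤ 5 * (δ * M) * |bker 0| / 2 := by
    rw [abs_div, abs_mul, abs_two]; gcongr
  rw [e]
  refine (abs_add_le _ _).trans ?_
  have a1 := abs_add_le ((am δ z w - 1 - δ * (z.re / 2 + 3 * w.re / 2)) * -log δ +
    -((am δ z w - 1) * log ‖z - w‖)) (am δ z w * (log (px δ z * px δ w) / 2))
  have a2 := abs_add_le ((am δ z w - 1 - δ * (z.re / 2 + 3 * w.re / 2)) * -log δ)
    (-((am δ z w - 1) * log ‖z - w‖))
  have a3 := abs_add_le (am δ z w * (b - bker 0) / 2) ((am δ z w - 1) * bker 0 / 2)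
  have hMM : δ * M ≤ δ * M ^ 2 := by
    apply mul_le_mul_of_nonneg_left _ hδ.le; nlinarith
  have m1 : 5 * (δ * M) * |log ‖z - w‖| ≤ δ * (40 * M ^ 2) * |log ‖z - w‖| := by
    refine mul_le_mul_of_nonneg_right ?_ (abs_nonneg _)
    linarith
  have m2 : δ * M * |bker 0| ≤ δ * M ^ 2 * |bker 0| := by gcongr
  have m3 : 0 ≤ δ * (3 * |bker 0| * M ^ 2) * |log ‖z - w‖| := by positivity
  have m4 : 0 ≤ δ * M ^ 2 * |bker 0| := by positivity
  have m5 : 0 ≤ δ * M ^ 2 := by positivity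
  linarith

lemma Rk_sub_le {δ M : ℝ} (hδ : 0 < δ) (hM1 : 1 ≤ M) (hM : δ * M ≤ 1 / 4) (hL : 1 ≤ -log δ)
    {z₁ z₂ w : ℂ} (hz₁ : ‖z₁‖ ≤ M) (hz₂ : ‖z₂‖ ≤ M) (hw : ‖w‖ ≤ M) (h₁ : w ≠ z₁) (h₂ : w ≠ z₂) :
    |Rk δ z₁ w - Rk δ z₂ w| ≤ δ * -log δ * ((50 + |bker 0|) * M) * ‖z₁ - z₂‖ *
      (1 + ‖z₁ - w‖⁻¹ + ‖z₂ - w‖⁻¹) := by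
  have g1 := am_sub_le hδ hM hz₁ hz₂ hw
  obtain ⟨-, g2, g3⟩ := am_expand hδ (by linarith) hM hz₂ hw
  have g4 := log_px_mul_le hδ hM hz₁ hw
  obtain ⟨g5, g6⟩ := scaled_dist_bounds hδ hM hz₁ hw
  have g7 := bker_lipschitz (δ * ‖z₁ - w‖ / √(px δ z₁ * px δ w)) 0
  have g8 := bker_lipschitz (δ * ‖z₁ - w‖ / √(px δ z₁ * px δ w))
    (δ * ‖z₂ - w‖ / √(px δ z₂ * px δ w))
  have g9 := scaled_dist_sub_le hδ hM hz₁ hz₂ hw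
  have g10 := log_dist_sub_le h₁ h₂
  obtain ⟨-, p1, -⟩ := px_bounds hδ hM hz₁
  obtain ⟨-, p2, -⟩ := px_bounds hδ hM hz₂
  obtain ⟨-, p3, -⟩ := px_bounds hδ hM hw
  have g11 := (log_sub_log_le_of_ge p1 p2).trans
    (mul_le_mul_of_nonneg_left (px_sub_le hδ z₁ z₂) (by norm_num))
  have g12 : |log ‖z₁ - w‖| ≤ 2 * M + ‖z₁ - w‖⁻¹ := by
    refine (abs_log_le (norm_nonneg _)).trans ?_
    have : ‖z₁ - w‖ ≤ 2 * M := (norm_sub_le _ _).trans (by linarith)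
    linarith
  rw [sub_zero, abs_of_nonneg g5] at g7
  set b₁ := bker (δ * ‖z₁ - w‖ / √(px δ z₁ * px δ w)) with hb₁
  set b₂ := bker (δ * ‖z₂ - w‖ / √(px δ z₂ * px δ w)) with hb₂
  have hb : |b₁| ≤ |bker 0| + 5 := by
    have := abs_add_le (b₁ - bker 0) (bker 0)
    rw [sub_add_cancel] at this
    linarith
  have e : Rk δ z₁ w - Rk δ z₂ w = (am δ z₁ w - am δ z₂ w) * (-log δ - log ‖z₁ - w‖) -
      (am δ z₂ w - 1) * (log ‖z₁ - w‖ - log ‖z₂ - w‖) +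
      (am δ z₁ w - am δ z₂ w) * (log (px δ z₁ * px δ w) / 2) +
      am δ z₂ w * ((log (px δ z₁) - log (px δ z₂)) / 2) +
      ((am δ z₁ w - am δ z₂ w) * (b₁ / 2) + am δ z₂ w * ((b₁ - b₂) / 2)) := by
    have e1 : log (px δ z₁) - log (px δ z₂) = log (px δ z₁ * px δ w) - log (px δ z₂ * px δ w) := by
      rw [log_mul (by linarith) (by linarith), log_mul (by linarith) (by linarith)]; ring
    rw [e1]
    unfold Rk
    ring
  have ha0 : 0 ≤ am δ z₂ w := by
    unfold am
    exact mul_nonneg (Real.sqrt_nonneg _) (mul_nonneg (by linarith) (Real.sqrt_nonneg _))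
  set D := δ * ‖z₁ - z₂‖ with hD
  have hD0 : 0 ≤ D := by positivity
  set i₁ := ‖z₁ - w‖⁻¹
  set i₂ := ‖z₂ - w‖⁻¹
  have hi₁ : 0 ≤ i₁ := by positivity
  have hi₂ : 0 ≤ i₂ := by positivity
  have t1 : |(am δ z₁ w - am δ z₂ w) * (-log δ - log ‖z₁ - w‖)| ≤
      2 * D * (-log δ + (2 * M + i₁)) := by
    rw [abs_mul]
    refine mul_le_mul g1 ((abs_sub _ _).trans ?_) (abs_nonneg _) (by positivity)
    rw [abs_of_nonneg (by linarith : 0 ≤ -log δ)]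
    linarith
  have t2 : |(am δ z₂ w - 1) * (log ‖z₁ - w‖ - log ‖z₂ - w‖)| ≤ 5 * M * D * (i₁ + i₂) := by
    rw [abs_mul]
    calc _ ≤ 5 * (δ * M) * (‖z₁ - z₂‖ * (i₁ + i₂)) :=
          mul_le_mul g2 g10 (abs_nonneg _) (by positivity)
      _ = _ := by rw [hD]; ring
  have t3 : |(am δ z₁ w - am δ z₂ w) * (log (px δ z₁ * px δ w) / 2)| ≤ 2 * D * 1 := by
    rw [abs_mul]
    refine mul_le_mul g1 ?_ (abs_nonneg _) (by positivity)
    rw [abs_div, abs_two]; linarith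
  have t4 : |am δ z₂ w * ((log (px δ z₁) - log (px δ z₂)) / 2)| ≤ 9 / 4 * (3 * D / 2) := by
    rw [abs_mul, abs_div, abs_two, abs_of_nonneg ha0]; gcongr
  have t5 : |(am δ z₁ w - am δ z₂ w) * (b₁ / 2)| ≤ 2 * D * ((|bker 0| + 5) / 2) := by
    rw [abs_mul, abs_div, abs_two]; gcongr
  have t6 : |am δ z₂ w * ((b₁ - b₂) / 2)| ≤ 9 / 4 * (6 * (4 * D) / 2) := by
    rw [abs_mul, abs_div, abs_two, abs_of_nonneg ha0]; gcongr; linarith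
  have s1 : |Rk δ z₁ w - Rk δ z₂ w| ≤ 2 * D * (-log δ + (2 * M + i₁)) + 5 * M * D * (i₁ + i₂) +
      2 * D * 1 + 9 / 4 * (3 * D / 2) + 2 * D * ((|bker 0| + 5) / 2) + 9 / 4 * (6 * (4 * D) / 2) := by
    rw [e]
    rw [abs_le] at t1 t2 t3 t4 t5 t6 ⊢
    constructor <;> linarith [t1.1, t1.2, t2.1, t2.2]
  have hLM : 1 ≤ -log δ * M := by nlinarith
  have k1 : D * i₁ ≤ D * (-log δ * M) * i₁ := by
    have := mul_le_mul_of_nonneg_left hLM (mul_nonneg hD0 hi₁); linarith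
  have k2 : M * D * (i₁ + i₂) ≤ D * (-log δ * M) * (i₁ + i₂) := by
    refine mul_le_mul_of_nonneg_right ?_ (by positivity)
    rw [mul_comm M]
    apply mul_le_mul_of_nonneg_left _ hD0
    exact le_mul_of_one_le_left (by linarith) hL
  have k3 : D * -log δ ≤ D * (-log δ * M) := by
    apply mul_le_mul_of_nonneg_left _ hD0
    exact le_mul_of_one_le_right (by linarith) hM1
  have k4 : D * M ≤ D * (-log δ * M) := by
    apply mul_le_mul_of_nonneg_left _ hD0
    exact le_mul_of_one_le_left (by linarith) hL
  have k5 : D * 1 ≤ D * (-log δ * M) := mul_le_mul_of_nonneg_left hLM hD0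
  have k6 : D * 1 * |bker 0| ≤ D * (-log δ * M) * |bker 0| :=
    mul_le_mul_of_nonneg_right k5 (abs_nonneg _)
  set Z := D * (-log δ * M) with hZ
  have hZ0 : 0 ≤ Z := by linarith
  have k7 : 0 ≤ Z * i₁ := by positivity
  have k8 : 0 ≤ Z * i₂ := by positivity
  have k9 : 0 ≤ Z * |bker 0| * i₁ := by positivity
  have k10 : 0 ≤ Z * |bker 0| * i₂ := by positivity
  have s2 : δ * -log δ * ((50 + |bker 0|) * M) * ‖z₁ - z₂‖ * (1 + i₁ + i₂) =
      Z * (50 + |bker 0|) * (1 + i₁ + i₂) := by rw [hZ, hD]; ring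
  rw [s2]
  linarith

lemma kernelBound_Rk {M : ℝ} (hM1 : 1 ≤ M) : ∃ C, 0 < C ∧ ∀ δ, 0 < δ → δ * M ≤ 1 / 4 → 1 ≤ -log δ →
    δ * -log δ ≤ 1 → KernelBound (Rk δ) M (C * (δ * -log δ)) := by
  refine ⟨(50 + 3 * |bker 0|) * M ^ 2, by positivity, fun δ hδ hM hL hL2 => ⟨?_, ?_⟩⟩
  · intro z w hz hw _
    have h := Rk_expand hδ hM1 hM hL2 hz hw
    have h1 : |δ * -log δ * (z.re / 2 + 3 * w.re / 2)| ≤ δ * -log δ * (2 * M ^ 2) := by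
      rw [abs_mul, abs_of_nonneg (by positivity : 0 ≤ δ * -log δ)]
      gcongr
      have a1 := abs_le.1 ((Complex.abs_re_le_norm z).trans hz)
      have a2 := abs_le.1 ((Complex.abs_re_le_norm w).trans hw)
      rw [abs_le]; constructor <;> nlinarith
    have h2 := abs_add_le (Rk δ z w - δ * -log δ * (z.re / 2 + 3 * w.re / 2))
      (δ * -log δ * (z.re / 2 + 3 * w.re / 2))
    rw [sub_add_cancel] at h2
    have h3 : δ * ((40 + 3 * |bker 0|) * M ^ 2) * (1 + |log ‖z - w‖|) ≤
        (δ * -log δ) * ((40 + 3 * |bker 0|) * M ^ 2) * (1 + |log ‖z - w‖|) := by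
      gcongr; nlinarith
    have h4 : 0 ≤ (δ * -log δ) * M ^ 2 := by positivity
    have h5 : 0 ≤ (δ * -log δ) * M ^ 2 * |log ‖z - w‖| := by positivity
    linarith
  · intro z₁ z₂ w hz₁ hz₂ hw h₁ h₂
    refine (Rk_sub_le hδ hM1 hM hL hz₁ hz₂ hw h₁ h₂).trans ?_
    have hb := abs_nonneg (bker 0)
    rw [mul_comm (δ * -log δ)]
    have : (50 + |bker 0|) * M ≤ (50 + 3 * |bker 0|) * M ^ 2 := by
      apply mul_le_mul <;> nlinarith
    have h0 : 0 ≤ -log δ := by linarith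
    gcongr

/-- The point of the unit circle with angle `θ`. -/
def ce (θ : ℝ) : ℂ := circleMap 0 1 θ

lemma norm_ce (θ : ℝ) : ‖ce θ‖ = 1 := by simp [ce]

lemma continuous_ce : Continuous ce := continuous_circleMap 0 1

lemma circleMap_eq_mul_ce (r θ : ℝ) : circleMap 0 r θ = r * ce θ := by simp [ce, circleMap]

lemma periodic_ce : Function.Periodic ce (2 * π) := periodic_circleMap 0 1

lemma intervalIntegral_periodic_eq {f : ℝ → ℝ} (hf : Function.Periodic f (2 * π)) :
    ∫ θ in (-π)..π, f θ = ∫ θ in (0 : ℝ)..(2 * π), f θ := by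
  have h := hf.intervalIntegral_add_eq (-π) 0
  rw [show -π + 2 * π = π by ring, zero_add] at h
  exact h

lemma intervalIntegrable_log_circle (r : ℝ) (z : ℂ) (a b : ℝ) :
    IntervalIntegrable (fun θ => log ‖circleMap 0 r θ - z‖) volume a b := by
  have h : IntervalIntegrable (fun θ => log ‖circleMap 0 r θ - z‖) volume 0 (2 * π) :=
    circleIntegrable_log_norm_sub_const (a := z) (c := 0) r
  have hp : Function.Periodic (fun θ => log ‖circleMap 0 r θ - z‖) (2 * π) := fun θ => by
    simp only [periodic_circleMap 0 r θ]
  exact hp.intervalIntegrable₀ two_pi_pos.ne' h a b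

lemma integral_log_circle {r : ℝ} (hr : 0 < r) (z : ℂ) :
    ∫ θ in (-π)..π, log ‖circleMap 0 r θ - z‖ = 2 * π * log (max r ‖z‖) := by
  have hp : Function.Periodic (fun θ => log ‖circleMap 0 r θ - z‖) (2 * π) := fun θ => by
    simp only [periodic_circleMap 0 r θ]
  have h := circleAverage_log_norm_sub_const_eq_log_radius_add_posLog (a := z) (c := 0) hr.ne'
  rw [circleAverage_def, zero_sub, norm_neg, smul_eq_mul] at h
  rw [intervalIntegral_periodic_eq hp]
  have h2 : log r + posLog (r⁻¹ * ‖z‖) = log (max r ‖z‖) := by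
    rcases le_or_gt ‖z‖ r with hz | hz
    · rw [max_eq_left hz, (posLog_eq_zero_iff _).2, add_zero]
      rw [abs_of_nonneg (by positivity), inv_mul_le_iff₀ hr]
      linarith
    · rw [max_eq_right hz.le, posLog_eq_log, log_mul (by positivity) (by linarith), log_inv]
      · ring
      · rw [abs_of_nonneg (by positivity), le_inv_mul_iff₀ hr]
        linarith
  rw [h2] at h
  have h3 := pi_pos
  rw [← h]
  field_simp

/-- The logarithmic potential of the unit disc. -/
def discPot (z : ℂ) : ℝ := ∫ w in Metric.ball (0 : ℂ) 1, -log ‖z - w‖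

lemma integral_mul_log {ρ : ℝ} (h0 : 0 ≤ ρ) (h1 : ρ ≤ 1) :
    ∫ r in ρ..1, r * log r = -1 / 4 - ρ ^ 2 / 2 * log ρ + ρ ^ 2 / 4 := by
  have hc : Continuous fun r : ℝ => r * log r := Real.continuous_mul_log
  have hF : Continuous fun r : ℝ => r / 2 * (r * log r) - r ^ 2 / 4 := by fun_prop
  rw [intervalIntegral.integral_eq_sub_of_hasDerivAt_of_le h1 hF.continuousOn (f' := fun r => r * log r)]
  · simp; ring
  · intro r hr
    have hr0 : r ≠ 0 := (lt_of_le_of_lt h0 hr.1).ne'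
    have e1 : HasDerivAt (fun r : ℝ => r / 2) (1 / 2) r := (hasDerivAt_id' r).div_const 2
    have e2 : HasDerivAt (fun r : ℝ => r * log r) (1 * log r + r * r⁻¹) r :=
      (hasDerivAt_id' r).mul (Real.hasDerivAt_log hr0)
    have e3 : HasDerivAt (fun r : ℝ => r ^ 2 / 4) (2 * r / 4) r := by
      simpa using (hasDerivAt_pow 2 r).div_const 4
    refine ((e1.mul e2).sub e3).congr_deriv ?_
    field_simp
    ring
  · exact hc.intervalIntegrable _ _

lemma integral_mul_log_max {ρ : ℝ} (h0 : 0 ≤ ρ) :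
    ∫ r in (0 : ℝ)..1, r * log (max r ρ) =
      if ρ ≤ 1 then (ρ ^ 2 - 1) / 4 else log ρ / 2 := by
  split_ifs with h1
  · have e1 : ∫ r in (0 : ℝ)..ρ, r * log (max r ρ) = ∫ r in (0 : ℝ)..ρ, r * log ρ := by
      apply intervalIntegral.integral_congr
      intro r hr
      rw [Set.uIcc_of_le h0] at hr
      simp only [max_eq_right hr.2]
    have e2 : ∫ r in ρ..1, r * log (max r ρ) = ∫ r in ρ..1, r * log r := by
      apply intervalIntegral.integral_congr
      intro r hr
      rw [Set.uIcc_of_le h1] at hr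
      simp only [max_eq_left hr.1]
    have i1 : IntervalIntegrable (fun r => r * log (max r ρ)) volume 0 ρ := by
      refine IntervalIntegrable.congr_ae (f := fun r => r * log ρ)
        ((continuous_id.mul continuous_const).intervalIntegrable _ _) ?_
      refine (ae_restrict_iff' measurableSet_uIoc).2 (Eventually.of_forall fun r hr => ?_)
      rw [Set.uIoc_of_le h0] at hr
      simp only [max_eq_right hr.2]
    have i2 : IntervalIntegrable (fun r => r * log (max r ρ)) volume ρ 1 := by
      refine IntervalIntegrable.congr_ae (f := fun r => r * log r)
        (Real.continuous_mul_log.intervalIntegrable _ _) ?_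
      refine (ae_restrict_iff' measurableSet_uIoc).2 (Eventually.of_forall fun r hr => ?_)
      rw [Set.uIoc_of_le h1] at hr
      simp only [max_eq_left hr.1.le]
    rw [← intervalIntegral.integral_add_adjacent_intervals i1 i2, e1, e2,
      integral_mul_log h0 h1, intervalIntegral.integral_mul_const, integral_id]
    ring
  · have e1 : ∫ r in (0 : ℝ)..1, r * log (max r ρ) = ∫ r in (0 : ℝ)..1, r * log ρ := by
      apply intervalIntegral.integral_congr
      intro r hr
      rw [Set.uIcc_of_le zero_le_one] at hr
      simp only [max_eq_right (hr.2.trans (not_le.1 h1).le)]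
    rw [e1, intervalIntegral.integral_mul_const, integral_id]
    ring

lemma discPot_eq (z : ℂ) :
    discPot z = if ‖z‖ ≤ 1 then π / 2 * (1 - ‖z‖ ^ 2) else -π * log ‖z‖ := by
  have hpi : -π ≤ π := by linarith [pi_pos]
  have hint := (integrableOn_log_dist z (Metric.isBounded_ball (x := (0 : ℂ)) (r := 1))).neg
  have hT : polarCoord.target = Set.Ioi (0 : ℝ) ×ˢ Set.Ioo (-π) π := rfl
  have hTm : MeasurableSet polarCoord.target := polarCoord.open_target.measurableSet
  set f : ℂ → ℝ := Set.indicator (Metric.ball 0 1) (fun w => -log ‖z - w‖) with hf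
  have hfi : Integrable f := (integrable_indicator_iff measurableSet_ball).2 hint
  set F : ℝ × ℝ → ℝ := fun p => p.1 * Set.indicator (Set.Iio 1)
    (fun r => -log ‖circleMap 0 r p.2 - z‖) p.1 with hF
  have hfF : ∀ p ∈ polarCoord.target, p.1 * f (Complex.polarCoord.symm p) = F p := by
    intro p hp
    have h := Complex.polarCoord.right_inv (x := p) hp
    rw [Complex.polarCoord_apply] at h
    have h1 : ‖Complex.polarCoord.symm p‖ = p.1 := congrArg Prod.fst h
    have h2 : Complex.polarCoord.symm p = circleMap 0 p.1 p.2 := by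
      rw [Complex.polarCoord_symm_apply, circleMap, zero_add, Complex.exp_mul_I,
        Complex.ofReal_cos, Complex.ofReal_sin]
    simp only [hf, hF, Set.indicator, mem_ball_zero_iff, h1, Set.mem_Iio]
    rw [h2, norm_sub_rev]
  have hFi : IntegrableOn F polarCoord.target := by
    refine ⟨?_, ?_⟩
    · refine AEStronglyMeasurable.congr (f := fun p : ℝ × ℝ => p.1 * f (Complex.polarCoord.symm p)) ?_
        ((ae_restrict_iff' hTm).2 (Eventually.of_forall hfF))
      have hm : Measurable f := by
        apply Measurable.indicator _ measurableSet_ball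
        fun_prop
      have hs : Measurable fun p : ℝ × ℝ => Complex.polarCoord.symm p := by
        simp_rw [Complex.polarCoord_symm_apply]
        fun_prop
      exact (measurable_fst.mul (hm.comp hs)).aestronglyMeasurable
    · have := hfi.2
      rw [hasFiniteIntegral_iff_enorm, ← Complex.lintegral_comp_polarCoord_symm] at this
      rw [hasFiniteIntegral_iff_enorm]
      refine lt_of_eq_of_lt (setLIntegral_congr_fun hTm fun p hp => ?_) this
      rw [← hfF p hp, enorm_mul, Real.enorm_eq_ofReal (le_of_lt hp.1), smul_eq_mul]
  unfold discPot
  rw [← integral_indicator measurableSet_ball, ← Complex.integral_comp_polarCoord_symm]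
  simp_rw [smul_eq_mul]
  rw [setIntegral_congr_fun hTm hfF, hT]
  have hvol : (volume : Measure (ℝ × ℝ)) = volume.prod volume := rfl
  rw [hvol, ← Measure.prod_restrict, integral_prod]
  swap
  · rw [Measure.prod_restrict]; exact hFi
  have e1 : ∀ r ∈ Set.Ioi (0 : ℝ), ∫ θ in Set.Ioo (-π) π, F (r, θ) =
      Set.indicator (Set.Ioo 0 1) (fun r => -(2 * π) * (r * log (max r ‖z‖))) r := by
    intro r hr
    have hr : 0 < r := hr
    by_cases h : r < 1
    · rw [Set.indicator_of_mem (show r ∈ Set.Ioo 0 1 from ⟨hr, h⟩)]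
      simp only [hF]
      simp_rw [Set.indicator_of_mem (show r ∈ Set.Iio 1 from h)]
      rw [integral_const_mul, ← integral_Ioc_eq_integral_Ioo, ← intervalIntegral.integral_of_le hpi,
        intervalIntegral.integral_neg, integral_log_circle hr]
      ring
    · rw [Set.indicator_of_notMem (fun h' => h h'.2)]
      simp only [hF]
      simp_rw [Set.indicator_of_notMem (show r ∉ Set.Iio 1 from h)]
      simp
  rw [setIntegral_congr_fun measurableSet_Ioi e1, setIntegral_indicator measurableSet_Ioo,
    Set.inter_eq_self_of_subset_right Set.Ioo_subset_Ioi_self, ← integral_Ioc_eq_integral_Ioo,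
    ← intervalIntegral.integral_of_le zero_le_one, intervalIntegral.integral_const_mul,
    integral_mul_log_max (norm_nonneg z)]
  split_ifs <;> ring

lemma abs_setIntegral_sub_le {A B : Set ℂ} (hA : MeasurableSet A) (hB : MeasurableSet B)
    {f : ℂ → ℝ} (hfA : IntegrableOn f A) (hfB : IntegrableOn f B) :
    |(∫ w in A, f w) - ∫ w in B, f w| ≤ ∫ w in A ∆ B, |f w| := by
  have e1 : ∫ w in A, f w = (∫ w in A ∩ B, f w) + ∫ w in A \ B, f w :=
    (integral_inter_add_sdiff hB hfA).symm
  have e2 : ∫ w in B, f w = (∫ w in A ∩ B, f w) + ∫ w in B \ A, f w := by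
    rw [Set.inter_comm]
    exact (integral_inter_add_sdiff hA hfB).symm
  have hd : Disjoint (A \ B) (B \ A) := disjoint_sdiff_sdiff
  have e3 : ∫ w in A ∆ B, |f w| = (∫ w in A \ B, |f w|) + ∫ w in B \ A, |f w| := by
    rw [Set.symmDiff_def]
    exact setIntegral_union hd (hB.diff hA) (hfA.mono_set Set.sdiff_subset).abs
      (hfB.mono_set Set.sdiff_subset).abs
  have h1 := abs_integral_le_integral_abs (f := f) (μ := volume.restrict (A \ B))
  have h2 := abs_integral_le_integral_abs (f := f) (μ := volume.restrict (B \ A))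
  rw [e1, e2, e3]
  rw [abs_le] at *
  constructor <;> linarith [h1.1, h1.2, h2.1, h2.2]

lemma ball_eq_region : Metric.ball (0 : ℂ) 1 = region (fun _ => 0) := by
  ext z
  simp only [mem_ball_zero_iff, region, Set.mem_ofPred_eq, mul_zero, add_zero]
  exact (sq_lt_one_iff₀ (norm_nonneg z)).symm

lemma volume_real_symmDiff_region {η₁ η₂ : ℝ → ℝ} (h₁ : Measurable η₁) (h₂ : Measurable η₂)
    (hb₁ : ∀ θ, |η₁ θ| ≤ 1 / 8) (hb₂ : ∀ θ, |η₂ θ| ≤ 1 / 8) {d : ℝ}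
    (hd : ∀ θ, |η₁ θ - η₂ θ| ≤ d) :
    volume.real (region η₁ ∆ region η₂) ≤ 2 * π * d := by
  have h := (symmDiff_region_integral h₁ h₂ hb₁ hb₂ (G := fun _ => 1) measurable_const
    (by simp)).2
  have hpi : -π ≤ π := by linarith [pi_pos]
  simp only [integral_const, smul_eq_mul, mul_one, MeasurableSet.univ,
    measureReal_restrict_apply, Set.univ_inter] at h
  rw [h]
  have := intervalIntegral.norm_integral_le_of_norm_le_const (a := -π) (b := π) (C := d)
    (f := fun θ => |η₁ θ - η₂ θ|) (fun x _ => by rw [norm_of_nonneg (abs_nonneg _)]; exact hd x)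
  rw [show π - -π = 2 * π by ring, abs_of_pos two_pi_pos] at this
  linarith [le_abs_self (∫ θ in (-π)..π, |η₁ θ - η₂ θ|), Real.norm_eq_abs (∫ θ in (-π)..π, |η₁ θ - η₂ θ|)]

/-- The smallness parameter for boundary perturbations. -/
def rho : ℝ := 1 / 10 ^ 6

/-- Admissible boundary perturbations of the unit circle. -/
structure Adm (η : ℝ → ℝ) : Prop where
  cont : Continuous η
  per : Function.Periodic η (2 * π)
  even : ∀ θ, η (-θ) = η θ
  bd : ∀ θ, |η θ| ≤ rho

lemma Adm.bd8 {η : ℝ → ℝ} (h : Adm η) (θ : ℝ) : |η θ| ≤ 1 / 8 :=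
  (h.bd θ).trans (by norm_num [rho])

lemma adm_zero : Adm (fun _ => 0) :=
  ⟨continuous_const, fun _ => rfl, fun _ => rfl, fun _ => by simp [rho]⟩

/-- The boundary curve of `region η`. -/
def yb (η : ℝ → ℝ) (θ : ℝ) : ℂ := circleMap 0 (√(1 + 2 * η θ)) θ

lemma norm_yb (η : ℝ → ℝ) (θ : ℝ) : ‖yb η θ‖ = √(1 + 2 * η θ) := by
  simp [yb, abs_of_nonneg (sqrt_nonneg _)]

lemma sqrt_near {t r : ℝ} (hr : r ≤ rho) (ht : |t| ≤ r) :
    1 - 2 * r ≤ √(1 + 2 * t) ∧ √(1 + 2 * t) ≤ 1 + 2 * r := by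
  obtain ⟨h1, h2⟩ := abs_le.1 ht
  have h0 : 0 ≤ r := (abs_nonneg _).trans ht
  have hr' : r ≤ 1 / 10 ^ 6 := hr
  have h3 := mul_le_mul_of_nonneg_left hr' h0
  constructor
  · apply le_sqrt_of_sq_le
    linarith
  · apply sqrt_le_iff.2
    constructor <;> linarith [sq_nonneg r]

lemma norm_yb_le {η : ℝ → ℝ} (h : Adm η) (θ : ℝ) : ‖yb η θ‖ ≤ 2 := by
  rw [norm_yb]
  have := (sqrt_near le_rfl (h.bd θ)).2
  norm_num [rho] at this
  linarith

lemma abs_sqrt_sub_le {a b : ℝ} (ha : |a| ≤ rho) (hb : |b| ≤ rho) :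
    |√(1 + 2 * a) - √(1 + 2 * b)| ≤ 2 * |a - b| := by
  have h1 := (sqrt_near le_rfl ha).1
  have h2 := (sqrt_near le_rfl hb).1
  have hr : rho = 1 / 10 ^ 6 := rfl
  have ha' := (abs_le.1 ha).1
  have hb' := (abs_le.1 hb).1
  have s1 := mul_self_sqrt (show 0 ≤ 1 + 2 * a by linarith)
  have s2 := mul_self_sqrt (show 0 ≤ 1 + 2 * b by linarith)
  have e : (√(1 + 2 * a) - √(1 + 2 * b)) * (√(1 + 2 * a) + √(1 + 2 * b)) = 2 * (a - b) := by
    linear_combination s1 - s2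
  have h3 : 1 ≤ √(1 + 2 * a) + √(1 + 2 * b) := by linarith
  have h4 := congrArg abs e
  rw [abs_mul, abs_mul, abs_of_pos (by linarith : (0 : ℝ) < √(1 + 2 * a) + √(1 + 2 * b)),
    abs_two] at h4
  rw [← h4]
  exact le_mul_of_one_le_right (abs_nonneg _) h3

lemma norm_yb_sub_le {η₁ η₂ : ℝ → ℝ} (h₁ : Adm η₁) (h₂ : Adm η₂) (θ : ℝ) :
    ‖yb η₁ θ - yb η₂ θ‖ ≤ 2 * |η₁ θ - η₂ θ| := by
  rw [yb, yb, circleMap_eq_mul_ce, circleMap_eq_mul_ce, ← sub_mul, norm_mul, norm_ce, mul_one,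
    ← Complex.ofReal_sub, Complex.norm_real]
  exact abs_sqrt_sub_le (h₁.bd θ) (h₂.bd θ)

lemma aux_log_lip {a b r : ℝ} (ha : 0 ≤ a) (hab : a ≤ b) (hb : b ≤ r) :
    |(π * b - π / 2 * log (1 + 2 * b)) - (π * a - π / 2 * log (1 + 2 * a))| ≤
      2 * π * r * (b - a) := by
  have hpi := pi_pos
  have h1 : log (1 + 2 * b) - log (1 + 2 * a) ≤ 2 * (b - a) := by
    rw [← log_div (by linarith) (by linarith)]
    refine (log_le_sub_one_of_pos (div_pos (by linarith) (by linarith))).trans ?_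
    rw [div_sub_one (by linarith), div_le_iff₀ (by linarith)]
    nlinarith
  have h2 : 2 * (b - a) * (1 - 2 * b) ≤ log (1 + 2 * b) - log (1 + 2 * a) := by
    have h := log_le_sub_one_of_pos (show 0 < (1 + 2 * a) / (1 + 2 * b) from div_pos (by linarith) (by linarith))
    rw [log_div (by linarith) (by linarith), div_sub_one (by linarith)] at h
    have h3 : (1 + 2 * a - (1 + 2 * b)) / (1 + 2 * b) ≤ -(2 * (b - a) * (1 - 2 * b)) := by
      rw [div_le_iff₀ (by linarith)]
      nlinarith [mul_nonneg (sub_nonneg.2 hab) (sq_nonneg b)]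
    linarith
  have h3 : 0 ≤ (b - a) * (r - b) := mul_nonneg (sub_nonneg.2 hab) (sub_nonneg.2 hb)
  rw [abs_le]
  constructor
  · have : 0 ≤ r * (b - a) := mul_nonneg (by linarith) (sub_nonneg.2 hab)
    nlinarith
  · nlinarith

lemma discPot_yb {η : ℝ → ℝ} (h : Adm η) (θ : ℝ) :
    discPot (yb η θ) + π * η θ =
      π * max (η θ) 0 - π / 2 * log (1 + 2 * max (η θ) 0) := by
  have hr : rho = 1 / 10 ^ 6 := rfl
  have hb := abs_le.1 (h.bd θ)
  rw [discPot_eq, norm_yb]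
  rcases le_or_gt (η θ) 0 with h0 | h0
  · rw [if_pos (sqrt_le_one.2 (by linarith)), max_eq_right h0, sq_sqrt (by linarith)]
    simp
    ring
  · rw [if_neg (not_le.2 (by rw [lt_sqrt (by norm_num)]; linarith)), max_eq_left h0.le,
      log_sqrt (by linarith)]
    ring

lemma discPot_yb_sub {η₁ η₂ : ℝ → ℝ} (h₁ : Adm η₁) (h₂ : Adm η₂) {r : ℝ}
    (hb₁ : ∀ θ, |η₁ θ| ≤ r) (hb₂ : ∀ θ, |η₂ θ| ≤ r) (θ : ℝ) :
    |discPot (yb η₁ θ) - discPot (yb η₂ θ) + π * (η₁ θ - η₂ θ)| ≤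
      2 * π * r * |η₁ θ - η₂ θ| := by
  have e : discPot (yb η₁ θ) - discPot (yb η₂ θ) + π * (η₁ θ - η₂ θ) =
      (discPot (yb η₁ θ) + π * η₁ θ) - (discPot (yb η₂ θ) + π * η₂ θ) := by ring
  have hr : (0 : ℝ) ≤ r := (abs_nonneg _).trans (hb₁ 0)
  rw [e, discPot_yb h₁, discPot_yb h₂]
  have hm := abs_max_sub_max_le_abs (η₁ θ) (η₂ θ) 0
  have hk : 0 ≤ 2 * π * r := by positivity
  refine le_trans ?_ (mul_le_mul_of_nonneg_left hm hk)
  have a1 : max (η₁ θ) 0 ≤ r := max_le (abs_le.1 (hb₁ θ)).2 hr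
  have a2 : max (η₂ θ) 0 ≤ r := max_le (abs_le.1 (hb₂ θ)).2 hr
  rcases le_total (max (η₁ θ) 0) (max (η₂ θ) 0) with h | h
  · rw [abs_sub_comm, abs_sub_comm (max (η₁ θ) 0), abs_of_nonneg (sub_nonneg.2 h)]
    exact aux_log_lip (le_max_right _ _) h a2
  · rw [abs_of_nonneg (sub_nonneg.2 h)]
    exact aux_log_lip (le_max_right _ _) h a1

lemma Adm.meas {η : ℝ → ℝ} (h : Adm η) : Measurable η := h.cont.measurable

lemma Adm.ms {η : ℝ → ℝ} (h : Adm η) : MeasurableSet (region η) := measurableSet_region h.meas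

lemma Adm.bounded {η : ℝ → ℝ} (h : Adm η) : Bornology.IsBounded (region η) :=
  isBounded_region h.bd8

lemma log_potential_change {η : ℝ → ℝ} (h : Adm η) {r τ : ℝ} (hr : ∀ θ, |η θ| ≤ r)
    (hτ : 0 < τ) (z₁ z₂ : ℂ) :
    |(∫ w in region η, (-log ‖z₁ - w‖ + log ‖z₂ - w‖)) - (discPot z₁ - discPot z₂)| ≤
      ‖z₁ - z₂‖ * (4 * π * (τ + r / τ)) := by
  have hb := Metric.isBounded_ball (x := (0 : ℂ)) (r := 1)
  have e : discPot z₁ - discPot z₂ =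
      ∫ w in Metric.ball (0 : ℂ) 1, (-log ‖z₁ - w‖ + log ‖z₂ - w‖) := by
    have := integral_sub (integrableOn_log_dist z₁ hb).neg (integrableOn_log_dist z₂ hb).neg
    simp only [Pi.neg_apply, sub_neg_eq_add] at this
    exact this.symm
  rw [e]
  refine (abs_setIntegral_sub_le h.ms measurableSet_ball
    ((integrableOn_log_dist z₁ h.bounded).neg.add (integrableOn_log_dist z₂ h.bounded))
    ((integrableOn_log_dist z₁ hb).neg.add (integrableOn_log_dist z₂ hb))).trans ?_
  have hs : Bornology.IsBounded (region η ∆ Metric.ball (0 : ℂ) 1) :=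
    (h.bounded.union hb).subset symmDiff_le_sup
  have h1 := setIntegral_log_dist_sub_le hs z₁ z₂ hτ
  have h2 : volume.real (region η ∆ Metric.ball (0 : ℂ) 1) ≤ 2 * π * r := by
    rw [ball_eq_region]
    exact volume_real_symmDiff_region h.meas measurable_const h.bd8 (by simp)
      (fun θ => by simpa using hr θ)
  have e2 : ∀ w, |-log ‖z₁ - w‖ + log ‖z₂ - w‖| = |log ‖z₁ - w‖ - log ‖z₂ - w‖| := fun w => by
    rw [← abs_neg]; congr 1; ring
  refine (integral_congr_ae (Eventually.of_forall e2)).trans_le ?_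
  refine h1.trans (mul_le_mul_of_nonneg_left ?_ (norm_nonneg _))
  have h3 := div_le_div_of_nonneg_right h2 hτ.le
  rw [mul_div_assoc] at h3
  linarith

lemma ae_ce_arg_ne (θ : ℝ) : ∀ᵐ w : ℂ, ce w.arg ≠ ce θ := by
  set f : ℂ →ₗ[ℝ] ℝ := Complex.imLm ∘ₗ (LinearMap.mulLeft ℝ ((starRingEnd ℂ) (ce θ))) with hf
  have hfa : ∀ w, f w = ((starRingEnd ℂ) (ce θ) * w).im := fun w => rfl
  have hc : (starRingEnd ℂ) (ce θ) * ce θ = 1 := by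
    rw [mul_comm, Complex.mul_conj, Complex.normSq_eq_norm_sq, norm_ce]; simp
  have hne : LinearMap.ker f ≠ ⊤ := by
    intro h
    have h1 : f (ce θ * Complex.I) = 0 := by
      rw [LinearMap.ker_eq_top.1 h]; rfl
    rw [hfa, ← mul_assoc, hc] at h1
    simp at h1
  have h0 := Measure.addHaar_submodule (volume : Measure ℂ) (LinearMap.ker f) hne
  refine measure_mono_null ?_ h0
  intro w hw
  have hw : ce w.arg = ce θ := not_not.1 hw
  change f w = 0
  have e : w = (‖w‖ : ℂ) * ce w.arg := by
    rw [← circleMap_eq_mul_ce, circleMap, zero_add]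
    exact (Complex.norm_mul_exp_arg_mul_I w).symm
  rw [hfa, e, hw, mul_left_comm, hc]
  simp

lemma ae_ce_ne (θ : ℝ) : ∀ᵐ t : ℝ, ce t ≠ ce θ := by
  have h := (Set.countable_singleton (ce θ)).preimage_circleMap (0 : ℂ) (one_ne_zero (α := ℝ))
  exact h.ae_notMem volume

lemma setIntegral_region_sub_le {η₁ η₂ : ℝ → ℝ} (h₁ : Adm η₁) (h₂ : Adm η₂) {d : ℝ}
    (hd : ∀ θ, |η₁ θ - η₂ θ| ≤ d) (θ : ℝ) {F : ℂ → ℝ} {B : ℝ → ℝ}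
    (hF₁ : IntegrableOn F (region η₁)) (hF₂ : IntegrableOn F (region η₂))
    (hB : Measurable B) (hBi : IntervalIntegrable B volume (-π) π)
    (hB0 : ∀ t, ce t ≠ ce θ → 0 ≤ B t)
    (hFB : ∀ w ∈ region η₁ ∆ region η₂, ce w.arg ≠ ce θ → |F w| ≤ B w.arg) :
    |(∫ w in region η₁, F w) - ∫ w in region η₂, F w| ≤ d * ∫ t in (-π)..π, B t := by
  have hpi : -π ≤ π := by linarith [pi_pos]
  obtain ⟨i1, i2⟩ := symmDiff_region_integral h₁.meas h₂.meas h₁.bd8 h₂.bd8 hB hBi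
  have hm : MeasurableSet (region η₁ ∆ region η₂) := h₁.ms.symmDiff h₂.ms
  refine (abs_setIntegral_sub_le h₁.ms h₂.ms hF₁ hF₂).trans ?_
  calc ∫ w in region η₁ ∆ region η₂, |F w| ≤ ∫ w in region η₁ ∆ region η₂, B w.arg := by
        refine integral_mono_ae ?_ i1 ?_
        · exact ((hF₁.union hF₂).mono_set symmDiff_le_sup).abs
        · filter_upwards [ae_restrict_of_ae (ae_ce_arg_ne θ), ae_restrict_mem hm] with w hw hw'
          exact hFB w hw' hw
    _ = ∫ t in (-π)..π, |η₁ t - η₂ t| * B t := i2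
    _ ≤ ∫ t in (-π)..π, d * B t := by
        have hc : Continuous fun t => |η₁ t - η₂ t| := (h₁.cont.sub h₂.cont).abs
        refine intervalIntegral.integral_mono_ae hpi (hBi.continuousOn_mul hc.continuousOn)
          (hBi.const_mul d) ?_
        filter_upwards [ae_ce_ne θ] with t ht
        exact mul_le_mul_of_nonneg_right (hd t) (hB0 t ht)
    _ = _ := intervalIntegral.integral_const_mul _ _

lemma norm_mul_sub_sq {a b : ℂ} (ha : ‖a‖ = 1) (hb : ‖b‖ = 1) (r s : ℝ) :
    ‖(r : ℂ) * a - s * b‖ ^ 2 = (r - s) ^ 2 + r * s * ‖a - b‖ ^ 2 := by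
  have h1 : a.re * a.re + a.im * a.im = 1 := by
    rw [← Complex.normSq_apply, Complex.normSq_eq_norm_sq, ha, one_pow]
  have h2 : b.re * b.re + b.im * b.im = 1 := by
    rw [← Complex.normSq_apply, Complex.normSq_eq_norm_sq, hb, one_pow]
  simp only [← Complex.normSq_eq_norm_sq, Complex.normSq_apply, Complex.sub_re, Complex.sub_im,
    Complex.re_ofReal_mul, Complex.im_ofReal_mul]
  linear_combination (r ^ 2 - r * s) * h1 + (s ^ 2 - r * s) * h2

/-- Majorant of the oscillation of the logarithmic kernel in a thin annulus. -/
def ringMaj (q θ t : ℝ) : ℝ :=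
  log ‖ce t - (1 + 6 * q : ℝ) * ce θ‖ - log ‖ce t - ce θ‖ - log (1 - 2 * q)

lemma abs_log_ring_le {q θ t r s : ℝ} (hq0 : 0 ≤ q) (hq : q ≤ rho)
    (h : ce t ≠ ce θ) (hr : 1 - 2 * q ≤ r ∧ r ≤ 1 + 2 * q)
    (hs : 1 - 2 * q ≤ s ∧ s ≤ 1 + 2 * q) :
    |log ‖(r : ℂ) * ce θ - s * ce t‖ - log ‖ce t - ce θ‖| ≤ ringMaj q θ t := by
  obtain ⟨r1, r2⟩ := hr
  obtain ⟨s1, s2⟩ := hs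
  have hq : q ≤ 1 / 10 ^ 6 := hq
  have hp : 0 < 1 - 2 * q := by linarith
  have hr0 : 0 < r := by linarith
  have hs0 : 0 < s := by linarith
  set D := ‖ce t - ce θ‖ with hD
  have hD0 : 0 < D := norm_pos_iff.2 (sub_ne_zero.2 h)
  have e1 := norm_mul_sub_sq (norm_ce θ) (norm_ce t) r s
  rw [norm_sub_rev (ce θ) (ce t), ← hD] at e1
  have e2 := norm_mul_sub_sq (norm_ce t) (norm_ce θ) 1 (1 + 6 * q)
  rw [← hD, Complex.ofReal_one, one_mul, one_mul] at e2
  set N := ‖(r : ℂ) * ce θ - s * ce t‖ with hN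
  set K := ‖ce t - (1 + 6 * q : ℝ) * ce θ‖ with hK
  have hD2 : 0 < D ^ 2 := by positivity
  have hrs : (1 - 2 * q) ^ 2 ≤ r * s := by nlinarith
  have hrs2 : r * s ≤ (1 + 2 * q) ^ 2 := by nlinarith
  have hKD : D ≤ K := by
    refine (abs_le_of_sq_le_sq' ?_ (norm_nonneg _)).2
    rw [e2]
    linarith [mul_nonneg hq0 hD2.le, sq_nonneg (1 - (1 + 6 * q))]
  have hK0 : 0 < K := by linarith
  have hlow : (1 - 2 * q) * D ≤ N := by
    refine (abs_le_of_sq_le_sq' ?_ (norm_nonneg _)).2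
    rw [e1, mul_pow]
    have := mul_le_mul_of_nonneg_right hrs hD2.le
    linarith [sq_nonneg (r - s)]
  have hN0 : 0 < N := lt_of_lt_of_le (by positivity) hlow
  have hup : (1 - 2 * q) * N ≤ K := by
    refine (abs_le_of_sq_le_sq' ?_ (norm_nonneg _)).2
    rw [mul_pow, e1, e2]
    have h1 : (r - s) ^ 2 ≤ (4 * q) ^ 2 := sq_le_sq' (by linarith) (by linarith)
    have h2 := mul_le_mul_of_nonneg_right hrs2 hD2.le
    have h3 : (1 - 2 * q) ^ 2 * ((r - s) ^ 2 + r * s * D ^ 2) ≤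
        (1 - 2 * q) ^ 2 * ((4 * q) ^ 2 + (1 + 2 * q) ^ 2 * D ^ 2) :=
      mul_le_mul_of_nonneg_left (by linarith) (sq_nonneg _)
    refine h3.trans ?_
    have h4 : (1 - 2 * q) ^ 2 ≤ 1 := pow_le_one₀ hp.le (by linarith)
    have h5 : ((1 - 2 * q) * (1 + 2 * q)) ^ 2 ≤ 1 :=
      pow_le_one₀ (mul_nonneg hp.le (by linarith)) (by nlinarith)
    have h6 := mul_le_mul_of_nonneg_right h4 (sq_nonneg (4 * q))
    have h7 := mul_le_mul_of_nonneg_right h5 hD2.le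
    have h8 := mul_nonneg hq0 hD2.le
    linarith [sq_nonneg q]
  have l1 := log_le_log (by positivity) hlow
  rw [log_mul hp.ne' hD0.ne'] at l1
  have l2 := log_le_log (by positivity) hup
  rw [log_mul hp.ne' hN0.ne'] at l2
  have l3 := log_le_log hD0 hKD
  rw [ringMaj, ← hK, ← hD, abs_le]
  constructor <;> linarith

lemma intervalIntegrable_ringMaj (q θ a b : ℝ) : IntervalIntegrable (ringMaj q θ) volume a b :=
  ((intervalIntegrable_log_circle 1 _ a b).sub (intervalIntegrable_log_circle 1 _ a b)).sub
    intervalIntegrable_const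

lemma integral_log_ce (θ : ℝ) : ∫ t in (-π)..π, log ‖ce t - ce θ‖ = 0 := by
  have := integral_log_circle one_pos (ce θ)
  rw [norm_ce, max_self, log_one, mul_zero] at this
  exact this

lemma integral_ringMaj_le {q : ℝ} (hq0 : 0 ≤ q) (hq : q ≤ rho) (θ : ℝ) :
    ∫ t in (-π)..π, ringMaj q θ t ≤ 21 * π * q := by
  have h1 : IntervalIntegrable (fun t => log ‖ce t - (1 + 6 * q : ℝ) * ce θ‖) volume (-π) π :=
    intervalIntegrable_log_circle 1 _ _ _
  have h2 : IntervalIntegrable (fun t => log ‖ce t - ce θ‖) volume (-π) π :=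
    intervalIntegrable_log_circle 1 _ _ _
  have hq : q ≤ 1 / 10 ^ 6 := hq
  have e1 : ∫ t in (-π)..π, log ‖ce t - (1 + 6 * q : ℝ) * ce θ‖ = _ :=
    integral_log_circle one_pos ((1 + 6 * q : ℝ) * ce θ)
  rw [norm_mul, norm_ce, mul_one, Complex.norm_real, norm_of_nonneg (by linarith),
    max_eq_right (by linarith)] at e1
  have e : ∫ t in (-π)..π, ringMaj q θ t =
      2 * π * log (1 + 6 * q) - 0 - 2 * π * log (1 - 2 * q) := by
    unfold ringMaj
    rw [intervalIntegral.integral_sub (h1.sub h2) intervalIntegrable_const,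
      intervalIntegral.integral_sub h1 h2, intervalIntegral.integral_const]
    rw [e1, integral_log_ce, smul_eq_mul]
    ring
  rw [e]
  have l1 : log (1 + 6 * q) ≤ 6 * q := by
    have := log_le_sub_one_of_pos (show 0 < 1 + 6 * q by linarith); linarith
  have l2 : -log (1 - 2 * q) ≤ 4.1 * q := by
    have := one_sub_inv_le_log_of_pos (show 0 < 1 - 2 * q by linarith)
    have h3 : (1 - 2 * q)⁻¹ ≤ 1 + 4.1 * q := by
      rw [inv_le_iff_one_le_mul₀ (by linarith)]
      nlinarith
    linarith
  have hpi := pi_pos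
  nlinarith

lemma ringMaj_nonneg {q θ t : ℝ} (hq0 : 0 ≤ q) (hq : q ≤ rho) (h : ce t ≠ ce θ) : 0 ≤ ringMaj q θ t :=
  (abs_nonneg _).trans (abs_log_ring_le (r := 1) (s := 1) hq0 hq h
    (by constructor <;> linarith) (by constructor <;> linarith))

lemma measurable_ringMaj (q θ : ℝ) : Measurable (ringMaj q θ) := by
  have := continuous_ce.measurable
  unfold ringMaj
  fun_prop

lemma symmDiff_region_norm {η₁ η₂ : ℝ → ℝ} {q : ℝ} (hq : q ≤ rho)
    (hb₁ : ∀ θ, |η₁ θ| ≤ q) (hb₂ : ∀ θ, |η₂ θ| ≤ q) {w : ℂ}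
    (hw : w ∈ region η₁ ∆ region η₂) : 1 - 2 * q ≤ ‖w‖ ∧ ‖w‖ ≤ 1 + 2 * q := by
  have key : ∀ {η η' : ℝ → ℝ}, (∀ θ, |η θ| ≤ q) → (∀ θ, |η' θ| ≤ q) → w ∈ region η → w ∉ region η' →
      1 - 2 * q ≤ ‖w‖ ∧ ‖w‖ ≤ 1 + 2 * q := by
    intro η η' h h' hm hm'
    have a1 : ‖w‖ ^ 2 < 1 + 2 * η w.arg := hm
    have a2 : 1 + 2 * η' w.arg ≤ ‖w‖ ^ 2 := not_lt.1 hm'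
    constructor
    · refine (sqrt_near hq (h' w.arg)).1.trans ?_
      exact sqrt_le_iff.2 ⟨norm_nonneg _, a2⟩
    · refine le_trans ?_ (sqrt_near hq (h w.arg)).2
      exact le_sqrt_of_sq_le a1.le
  rcases hw with ⟨a, b⟩ | ⟨a, b⟩
  · exact key hb₁ hb₂ a b
  · exact key hb₂ hb₁ a b

lemma eq_norm_mul_ce_arg (w : ℂ) : w = (‖w‖ : ℂ) * ce w.arg := by
  rw [← circleMap_eq_mul_ce, circleMap, zero_add]
  exact (Complex.norm_mul_exp_arg_mul_I w).symm

lemma abs_log_yb_sub_le {η₁ η₂ η : ℝ → ℝ} {q : ℝ} (hq : q ≤ rho)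
    (hb₁ : ∀ θ, |η₁ θ| ≤ q) (hb₂ : ∀ θ, |η₂ θ| ≤ q) (hb : ∀ θ, |η θ| ≤ q) {w : ℂ} {θ : ℝ}
    (hw : w ∈ region η₁ ∆ region η₂) (hne : ce w.arg ≠ ce θ) :
    |log ‖yb η θ - w‖ - log ‖ce w.arg - ce θ‖| ≤ ringMaj q θ w.arg := by
  have := abs_log_ring_le ((abs_nonneg _).trans (hb 0)) hq hne (sqrt_near hq (hb θ))
    (symmDiff_region_norm hq hb₁ hb₂ hw)
  rw [← eq_norm_mul_ce_arg, ← circleMap_eq_mul_ce] at this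
  exact this

lemma log_region_change {η₁ η₂ η : ℝ → ℝ} (h₁ : Adm η₁) (h₂ : Adm η₂) {q : ℝ}
    (hq : q ≤ rho) (hb₁ : ∀ θ, |η₁ θ| ≤ q) (hb₂ : ∀ θ, |η₂ θ| ≤ q) (hb : ∀ θ, |η θ| ≤ q) {d : ℝ}
    (hd : ∀ θ, |η₁ θ - η₂ θ| ≤ d) (θ : ℝ) :
    |(∫ w in region η₁, log ‖yb η θ - w‖) - (∫ w in region η₂, log ‖yb η θ - w‖) -
      ∫ t in (-π)..π, (η₁ t - η₂ t) * log ‖ce t - ce θ‖| ≤ d * (21 * π * q) := by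
  have hq0 : 0 ≤ q := (abs_nonneg _).trans (hb 0)
  have hm : Measurable fun t => log ‖ce t - ce θ‖ := by
    have := continuous_ce.measurable
    fun_prop
  have hi : IntervalIntegrable (fun t => log ‖ce t - ce θ‖) volume (-π) π :=
    intervalIntegrable_log_circle 1 (ce θ) _ _
  obtain ⟨a1, b1⟩ := region_integral h₁.meas h₁.bd8 hm hi
  obtain ⟨a2, b2⟩ := region_integral h₂.meas h₂.bd8 hm hi
  have j1 := integrableOn_log_dist (yb η θ) h₁.bounded
  have j2 := integrableOn_log_dist (yb η θ) h₂.bounded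
  have e : ∫ t in (-π)..π, (η₁ t - η₂ t) * log ‖ce t - ce θ‖ =
      (∫ w in region η₁, log ‖ce w.arg - ce θ‖) - ∫ w in region η₂, log ‖ce w.arg - ce θ‖ := by
    rw [b1, b2, ← intervalIntegral.integral_sub]
    · congr 1; ext t; ring
    · exact hi.continuousOn_mul (by have := h₁.cont; fun_prop)
    · exact hi.continuousOn_mul (by have := h₂.cont; fun_prop)
  have key := setIntegral_region_sub_le h₁ h₂ hd θ (j1.sub a1) (j2.sub a2) (measurable_ringMaj q θ)
    (intervalIntegrable_ringMaj q θ _ _) (fun t ht => ringMaj_nonneg hq0 hq ht)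
    (fun w hw hne => abs_log_yb_sub_le hq hb₁ hb₂ hb hw hne)
  have f1 := integral_sub j1 a1
  have f2 := integral_sub j2 a2
  have hd0 : 0 ≤ d := (abs_nonneg _).trans (hd 0)
  have := mul_le_mul_of_nonneg_left (integral_ringMaj_le hq0 hq θ) hd0
  simp only [Pi.sub_apply] at key
  rw [f1, f2] at key
  rw [e]
  refine le_trans (le_of_eq ?_) (key.trans this)
  congr 1
  ring

section Kernel

variable {R : ℂ → ℂ → ℝ} {ν : ℝ}

lemma KernelBound.integrableOn {M : ℝ} (hK : KernelBound R M ν) (hRm : ∀ z, Measurable (R z))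
    {z : ℂ} (hz : ‖z‖ ≤ M) {E : Set ℂ} (hE : E ⊆ Metric.closedBall 0 M) :
    IntegrableOn (R z) E := by
  have hb : Bornology.IsBounded (Metric.closedBall (0 : ℂ) M) := Metric.isBounded_closedBall
  refine IntegrableOn.mono_set ?_ hE
  have h : IntegrableOn (fun w => ν * (1 + |log ‖z - w‖|)) (Metric.closedBall 0 M) :=
    ((integrableOn_const hb.measure_lt_top.ne).add (integrableOn_log_dist z hb).abs).const_mul ν
  refine h.mono' (hRm z).aestronglyMeasurable ?_
  filter_upwards [ae_restrict_of_ae (ae_ne_pair z z volume),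
    ae_restrict_mem measurableSet_closedBall] with w hw hw'
  exact hK.size z w hz (mem_closedBall_zero_iff.1 hw') (Ne.symm hw.1)

lemma Adm.subset_closedBall {η : ℝ → ℝ} (h : Adm η) : region η ⊆ Metric.closedBall 0 2 :=
  (region_subset_ball h.bd8).trans Metric.ball_subset_closedBall

lemma Adm.volume_le {η : ℝ → ℝ} (h : Adm η) : volume.real (region η) ≤ 4 * π := by
  have h1 : volume.real (region η) ≤ volume.real (Metric.ball (0 : ℂ) 2) :=
    measureReal_mono (region_subset_ball h.bd8) Metric.isBounded_ball.measure_lt_top.ne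
  refine h1.trans (le_of_eq ?_)
  rw [Measure.real, Complex.volume_ball]
  simp
  norm_num [NNReal.pi]

lemma kernel_point_change {M : ℝ} (hM : 2 ≤ M) (hK : KernelBound R M ν) (hν : 0 ≤ ν)
    (hRm : ∀ z, Measurable (R z)) {η : ℝ → ℝ} (h : Adm η) {z₁ z₂ : ℂ} (hz₁ : ‖z₁‖ ≤ M)
    (hz₂ : ‖z₂‖ ≤ M) :
    |(∫ w in region η, R z₁ w) - ∫ w in region η, R z₂ w| ≤ ν * ‖z₁ - z₂‖ * (16 * π) := by
  have hs := h.subset_closedBall.trans (Metric.closedBall_subset_closedBall hM)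
  rw [← integral_sub (hK.integrableOn hRm hz₁ hs) (hK.integrableOn hRm hz₂ hs)]
  refine abs_integral_le_integral_abs.trans ?_
  have hv := h.volume_le
  refine (setIntegral_abs_sub_le (z₁ := z₁) (z₂ := z₂) h.bounded.measure_lt_top.ne
    (by positivity) h.ms fun w hw h1 h2 =>
      hK.lip z₁ z₂ w hz₁ hz₂ (mem_closedBall_zero_iff.1 (hs hw)) h1 h2).trans ?_
  exact mul_le_mul_of_nonneg_left (by linarith) (by positivity)

lemma kernel_region_change (hK : KernelBound R 2 ν) (hν : 0 ≤ ν) (hRm : ∀ z, Measurable (R z))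
    {η₁ η₂ η : ℝ → ℝ} (h₁ : Adm η₁) (h₂ : Adm η₂) (h : Adm η) {d : ℝ}
    (hd : ∀ θ, |η₁ θ - η₂ θ| ≤ d) (θ : ℝ) :
    |(∫ w in region η₁, R (yb η θ) w) - ∫ w in region η₂, R (yb η θ) w| ≤ d * (ν * (6 * π)) := by
  have hr0 : (0 : ℝ) ≤ rho := by norm_num [rho]
  have hm : Measurable fun t => log ‖ce t - ce θ‖ := by
    have := continuous_ce.measurable
    fun_prop
  have hi : IntervalIntegrable (fun t => log ‖ce t - ce θ‖) volume (-π) π :=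
    intervalIntegrable_log_circle 1 (ce θ) _ _
  have hz := norm_yb_le h θ
  set B : ℝ → ℝ := fun t => ν * (1 + (2 * log 2 - log ‖ce t - ce θ‖ + ringMaj rho θ t)) with hB
  have iB : IntervalIntegrable B volume (-π) π :=
    (intervalIntegrable_const.add ((intervalIntegrable_const.sub hi).add
      (intervalIntegrable_ringMaj rho θ _ _))).const_mul ν
  have hlog : ∀ t, ce t ≠ ce θ → |log ‖ce t - ce θ‖| ≤ 2 * log 2 - log ‖ce t - ce θ‖ := by
    intro t ht
    have h0 : 0 < ‖ce t - ce θ‖ := norm_pos_iff.2 (sub_ne_zero.2 ht)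
    have h2 : ‖ce t - ce θ‖ ≤ 2 := by
      refine (norm_sub_le _ _).trans ?_
      rw [norm_ce, norm_ce]; norm_num
    have := log_le_log h0 h2
    have l2 := log_pos one_lt_two
    rw [abs_le]
    constructor <;> linarith
  have key := setIntegral_region_sub_le h₁ h₂ hd θ (hK.integrableOn hRm hz h₁.subset_closedBall)
    (hK.integrableOn hRm hz h₂.subset_closedBall) (B := B)
    (by have := measurable_ringMaj rho θ; fun_prop) iB
    (fun t ht => by
      have := ringMaj_nonneg hr0 le_rfl ht
      have := (abs_nonneg _).trans (hlog t ht)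
      positivity)
    (fun w hw hne => by
      have a1 := abs_log_yb_sub_le le_rfl h₁.bd h₂.bd h.bd hw hne
      have a2 := hlog w.arg hne
      have a3 : |log ‖yb η θ - w‖| ≤ |log ‖yb η θ - w‖ - log ‖ce w.arg - ce θ‖| +
          |log ‖ce w.arg - ce θ‖| := by
        have := abs_add_le (log ‖yb η θ - w‖ - log ‖ce w.arg - ce θ‖) (log ‖ce w.arg - ce θ‖)
        rwa [sub_add_cancel] at this
      have hw2 : ‖w‖ ≤ 2 := by
        have := (symmDiff_region_norm le_rfl h₁.bd h₂.bd hw).2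
        norm_num [rho] at this
        linarith
      have hne2 : yb η θ ≠ w := by
        rintro rfl
        apply hne
        have hp : 0 < √(1 + 2 * η θ) := by
          have := (sqrt_near le_rfl (h.bd θ)).1
          norm_num [rho] at this
          linarith
        have e := eq_norm_mul_ce_arg (yb η θ)
        rw [norm_yb] at e
        have e' : yb η θ = (√(1 + 2 * η θ) : ℂ) * ce θ := by rw [yb, circleMap_eq_mul_ce]
        rw [e'] at e
        have := mul_left_cancel₀ (by exact_mod_cast hp.ne') e
        rw [← e'] at this
        exact this.symm
      refine (hK.size _ w hz hw2 hne2).trans (mul_le_mul_of_nonneg_left ?_ hν)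
      linarith)
  refine key.trans (mul_le_mul_of_nonneg_left ?_ ((abs_nonneg _).trans (hd 0)))
  rw [hB, intervalIntegral.integral_const_mul]
  refine mul_le_mul_of_nonneg_left ?_ hν
  rw [intervalIntegral.integral_add intervalIntegrable_const
    ((intervalIntegrable_const.sub hi).add (intervalIntegrable_ringMaj rho θ _ _)),
    intervalIntegral.integral_add (intervalIntegrable_const.sub hi) (intervalIntegrable_ringMaj rho θ _ _),
    intervalIntegral.integral_sub intervalIntegrable_const hi, integral_log_ce,
    intervalIntegral.integral_const, intervalIntegral.integral_const, smul_eq_mul, smul_eq_mul]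
  have h3 : (∫ t in (-π)..π, ringMaj rho θ t) ≤ 21 * π * (1 / 10 ^ 6) :=
    integral_ringMaj_le hr0 le_rfl θ
  have h4 := log_two_lt_d9
  have hpi := pi_pos
  nlinarith

end Kernel

/-- The potential of `region η` for the kernel `-log ‖z - w‖ + R z w`. -/
def Phi (R : ℂ → ℂ → ℝ) (η : ℝ → ℝ) (z : ℂ) : ℝ := ∫ w in region η, (-log ‖z - w‖ + R z w)

/-- The mean of a boundary perturbation. -/
def I0 (η : ℝ → ℝ) : ℝ := ∫ t in (-π)..π, η t

/-- The first cosine moment of a boundary perturbation. -/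
def I1 (η : ℝ → ℝ) : ℝ := ∫ t in (-π)..π, η t * cos t

/-- The normalised travelling term. -/
def Xq (δ : ℝ) (z : ℂ) : ℝ := z.re + δ / 2 * z.re ^ 2

/-- The fixed point operator for the boundary perturbation. -/
def Sop (R : ℂ → ℂ → ℝ) (δ : ℝ) (η : ℝ → ℝ) (θ : ℝ) : ℝ :=
  η θ + 1 / π * (Phi R η (yb η θ) + log 2 / 2 * I0 η - I1 η / 2 * Xq δ (yb η θ))

lemma ce_re (t : ℝ) : (ce t).re = cos t := by
  simp [ce, circleMap, Complex.exp_ofReal_mul_I_re]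

lemma ce_im (t : ℝ) : (ce t).im = sin t := by
  simp [ce, circleMap, Complex.exp_ofReal_mul_I_im]

lemma norm_ce_sub_sq (t θ : ℝ) : ‖ce t - ce θ‖ ^ 2 = 2 - 2 * cos (t - θ) := by
  rw [← Complex.normSq_eq_norm_sq, Complex.normSq_apply, Complex.sub_re, Complex.sub_im, ce_re,
    ce_re, ce_im, ce_im, cos_sub]
  linear_combination sin_sq_add_cos_sq t + sin_sq_add_cos_sq θ

lemma intervalIntegrable_log_ce (θ a b : ℝ) :
    IntervalIntegrable (fun t => log ‖ce t - ce θ‖) volume a b :=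
  intervalIntegrable_log_circle 1 _ _ _

lemma integral_odd_eq_zero {f : ℝ → ℝ} (h : ∀ t, f (-t) = -f t) (a : ℝ) :
    ∫ t in (-a)..a, f t = 0 := by
  have h1 := intervalIntegral.integral_comp_neg (a := -a) (b := a) (f := f)
  simp only [h, neg_neg, intervalIntegral.integral_neg] at h1
  linarith

lemma linear_kernel_nonneg {t θ : ℝ} (h : ce t ≠ ce θ) :
    0 ≤ -log ‖ce t - ce θ‖ + log 2 / 2 - cos (t - θ) / 2 := by
  have h0 : 0 < ‖ce t - ce θ‖ := norm_pos_iff.2 (sub_ne_zero.2 h)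
  have e := norm_ce_sub_sq t θ
  have e2 : ‖ce t - ce θ‖ ^ 2 = 2 * (1 - cos (t - θ)) := by rw [e]; ring
  have hp : 0 < 1 - cos (t - θ) := by nlinarith [pow_pos h0 2]
  have l := congrArg log e2
  rw [log_pow, log_mul two_ne_zero hp.ne'] at l
  have := log_le_sub_one_of_pos hp
  push_cast at l
  linarith

lemma linear_part_le {Δ : ℝ → ℝ} (hc : Continuous Δ) (he : ∀ t, Δ (-t) = Δ t) {d : ℝ}
    (hd : ∀ t, |Δ t| ≤ d) (θ : ℝ) :
    |-(∫ t in (-π)..π, Δ t * log ‖ce t - ce θ‖) + log 2 / 2 * (∫ t in (-π)..π, Δ t) -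
      (∫ t in (-π)..π, Δ t * cos t) / 2 * cos θ| ≤ d * (π * log 2) := by
  have hpi : -π ≤ π := by linarith [pi_pos]
  have hi := intervalIntegrable_log_ce θ (-π) π
  set g : ℝ → ℝ := fun t => -log ‖ce t - ce θ‖ + log 2 / 2 - cos (t - θ) / 2 with hg
  have hci : IntervalIntegrable (fun t => cos (t - θ) / 2) volume (-π) π :=
    Continuous.intervalIntegrable (by fun_prop) _ _
  have hgi : IntervalIntegrable g volume (-π) π := (hi.neg.add intervalIntegrable_const).sub hci
  have hcos0 : ∫ t in (-π)..π, cos (t - θ) / 2 = 0 := by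
    rw [intervalIntegral.integral_div, intervalIntegral.integral_comp_sub_right (fun t => cos t)]
    rw [integral_cos]
    rw [show π - θ = (-π - θ) + 2 * π by ring, sin_add_two_pi, sub_self, zero_div]
  have hgint : ∫ t in (-π)..π, g t = π * log 2 := by
    rw [hg]
    have e1 := intervalIntegral.integral_sub (hi.neg.add (intervalIntegrable_const (c := log 2 / 2))) hci
    have e2 := intervalIntegral.integral_add hi.neg
      (intervalIntegrable_const (c := log 2 / 2) (μ := volume) (a := -π) (b := π))
    have e3 : ∫ t in (-π)..π, -log ‖ce t - ce θ‖ = 0 := by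
      rw [intervalIntegral.integral_neg, integral_log_ce, neg_zero]
    simp only [Pi.neg_apply] at e1 e2
    rw [e1, e2, e3, hcos0, intervalIntegral.integral_const, smul_eq_mul]
    ring
  have hsin : ∫ t in (-π)..π, Δ t * sin t = 0 :=
    integral_odd_eq_zero (fun t => by rw [he, sin_neg]; ring) π
  have e : -(∫ t in (-π)..π, Δ t * log ‖ce t - ce θ‖) + log 2 / 2 * (∫ t in (-π)..π, Δ t) -
      (∫ t in (-π)..π, Δ t * cos t) / 2 * cos θ = ∫ t in (-π)..π, Δ t * g t := by
    have i1 : IntervalIntegrable (fun t => Δ t * log ‖ce t - ce θ‖) volume (-π) π :=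
      hi.continuousOn_mul hc.continuousOn
    have i2 : IntervalIntegrable (fun t => log 2 / 2 * Δ t) volume (-π) π :=
      Continuous.intervalIntegrable (by fun_prop) _ _
    have i3 : IntervalIntegrable (fun t => cos θ / 2 * (Δ t * cos t)) volume (-π) π :=
      Continuous.intervalIntegrable (by fun_prop) _ _
    have i4 : IntervalIntegrable (fun t => sin θ / 2 * (Δ t * sin t)) volume (-π) π :=
      Continuous.intervalIntegrable (by fun_prop) _ _
    have : ∀ t, Δ t * g t = log 2 / 2 * Δ t - Δ t * log ‖ce t - ce θ‖ -
        cos θ / 2 * (Δ t * cos t) - sin θ / 2 * (Δ t * sin t) := by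
      intro t; simp only [hg, cos_sub]; ring
    simp_rw [this]
    rw [intervalIntegral.integral_sub ((i2.sub i1).sub i3) i4,
      intervalIntegral.integral_sub (i2.sub i1) i3, intervalIntegral.integral_sub i2 i1,
      intervalIntegral.integral_const_mul, intervalIntegral.integral_const_mul,
      intervalIntegral.integral_const_mul, hsin]
    ring
  rw [e]
  refine (intervalIntegral.abs_integral_le_integral_abs hpi).trans ?_
  rw [← hgint, ← intervalIntegral.integral_const_mul]
  refine intervalIntegral.integral_mono_ae hpi ?_ (hgi.const_mul d) ?_
  · exact (hgi.continuousOn_mul hc.continuousOn).abs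
  · filter_upwards [ae_ce_ne θ] with t ht
    have := linear_kernel_nonneg ht
    change |Δ t * g t| ≤ d * g t
    rw [abs_mul, abs_of_nonneg (show 0 ≤ g t from this)]
    exact mul_le_mul_of_nonneg_right (hd t) this

lemma abs_integral_le_of_abs_le {f : ℝ → ℝ} {d : ℝ} (h : ∀ t, |f t| ≤ d) :
    |∫ t in (-π)..π, f t| ≤ 2 * π * d := by
  have := intervalIntegral.norm_integral_le_of_norm_le_const (a := -π) (b := π) (C := d)
    (f := f) (fun x _ => h x)
  rw [show π - -π = 2 * π by ring, abs_of_pos two_pi_pos] at this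
  rw [← Real.norm_eq_abs]
  linarith

lemma abs_I1_le {η : ℝ → ℝ} {d : ℝ} (h : ∀ t, |η t| ≤ d) : |I1 η| ≤ 2 * π * d := by
  refine abs_integral_le_of_abs_le fun t => ?_
  rw [abs_mul]
  exact (mul_le_of_le_one_right (abs_nonneg _) (abs_cos_le_one t)).trans (h t)

lemma I0_sub {η₁ η₂ : ℝ → ℝ} (h₁ : Continuous η₁) (h₂ : Continuous η₂) :
    I0 η₁ - I0 η₂ = ∫ t in (-π)..π, (η₁ t - η₂ t) :=
  (intervalIntegral.integral_sub (h₁.intervalIntegrable _ _) (h₂.intervalIntegrable _ _)).symm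

lemma I1_sub {η₁ η₂ : ℝ → ℝ} (h₁ : Continuous η₁) (h₂ : Continuous η₂) :
    I1 η₁ - I1 η₂ = ∫ t in (-π)..π, (η₁ t - η₂ t) * cos t := by
  rw [I1, I1, ← intervalIntegral.integral_sub]
  · congr 1; ext t; ring
  · exact Continuous.intervalIntegrable (by fun_prop) _ _
  · exact Continuous.intervalIntegrable (by fun_prop) _ _

section Kernel

variable {R : ℂ → ℂ → ℝ} {ν : ℝ}

lemma Phi_eq_sub {M : ℝ} (hM : 2 ≤ M) (hK : KernelBound R M ν) (hRm : ∀ z, Measurable (R z))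
    {η : ℝ → ℝ} (h : Adm η) {z : ℂ} (hz : ‖z‖ ≤ M) :
    Phi R η z = (∫ w in region η, R z w) - ∫ w in region η, log ‖z - w‖ := by
  have e := integral_sub (hK.integrableOn hRm hz
    (h.subset_closedBall.trans (Metric.closedBall_subset_closedBall hM)))
    (integrableOn_log_dist z h.bounded)
  rw [Phi, ← e]
  congr 1; ext w; ring

lemma Phi_change (hK : KernelBound R 2 ν) (hν : 0 ≤ ν) (hRm : ∀ z, Measurable (R z))
    {η₁ η₂ : ℝ → ℝ} (h₁ : Adm η₁) (h₂ : Adm η₂) {q τ : ℝ} (hq : q ≤ rho)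
    (hb₁ : ∀ θ, |η₁ θ| ≤ q) (hb₂ : ∀ θ, |η₂ θ| ≤ q) (hτ : 0 < τ) {d : ℝ}
    (hd : ∀ θ, |η₁ θ - η₂ θ| ≤ d) (θ : ℝ) :
    |Phi R η₁ (yb η₁ θ) - Phi R η₂ (yb η₂ θ) + π * (η₁ θ - η₂ θ) +
      ∫ t in (-π)..π, (η₁ t - η₂ t) * log ‖ce t - ce θ‖| ≤
      d * (π * (23 * q + 8 * (τ + q / τ) + 38 * ν)) := by
  have z1 := norm_yb_le h₁ θ
  have z2 := norm_yb_le h₂ θ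
  have hpi := pi_pos
  have hy := (norm_yb_sub_le h₁ h₂ θ).trans (mul_le_mul_of_nonneg_left (hd θ) zero_le_two)
  have a1 := log_potential_change h₁ hb₁ hτ (yb η₁ θ) (yb η₂ θ)
  have a2 := discPot_yb_sub h₁ h₂ hb₁ hb₂ θ
  have a3 := log_region_change h₁ h₂ hq hb₁ hb₂ hb₂ hd θ
  have a4 := kernel_point_change le_rfl hK hν hRm h₁ z1 z2
  have a5 := kernel_region_change hK hν hRm h₁ h₂ h₂ hd θ
  have e := integral_sub (integrableOn_log_dist (yb η₂ θ) h₁.bounded)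
    (integrableOn_log_dist (yb η₁ θ) h₁.bounded)
  have e' : ∫ w in region η₁, (-log ‖yb η₁ θ - w‖ + log ‖yb η₂ θ - w‖) =
      ∫ w in region η₁, (log ‖yb η₂ θ - w‖ - log ‖yb η₁ θ - w‖) := by
    congr 1; ext w; ring
  rw [e', e] at a1
  rw [Phi_eq_sub le_rfl hK hRm h₁ z1, Phi_eq_sub le_rfl hK hRm h₂ z2]
  have hq0 : 0 ≤ q := (abs_nonneg _).trans (hb₁ 0)
  have b1 : ‖yb η₁ θ - yb η₂ θ‖ * (4 * π * (τ + q / τ)) ≤ 2 * d * (4 * π * (τ + q / τ)) :=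
    mul_le_mul_of_nonneg_right hy (by positivity)
  have b2 : 2 * π * q * |η₁ θ - η₂ θ| ≤ 2 * π * q * d :=
    mul_le_mul_of_nonneg_left (hd θ) (by positivity)
  have b4 : ν * ‖yb η₁ θ - yb η₂ θ‖ * (16 * π) ≤ ν * (2 * d) * (16 * π) :=
    mul_le_mul_of_nonneg_right (mul_le_mul_of_nonneg_left hy hν) (by positivity)
  rw [abs_le] at *
  constructor <;> linarith [a1.1, a1.2, a2.1, a2.2, a3.1, a3.2, a4.1, a4.2, a5.1, a5.2]

lemma Xq_sub_le {δ : ℝ} (hδ0 : 0 ≤ δ) (hδ : δ ≤ 1) {z₁ z₂ : ℂ} (h₁ : ‖z₁‖ ≤ 2) (h₂ : ‖z₂‖ ≤ 2) :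
    |Xq δ z₁ - Xq δ z₂| ≤ 3 * ‖z₁ - z₂‖ := by
  have e : Xq δ z₁ - Xq δ z₂ = (z₁ - z₂).re * (1 + δ / 2 * (z₁.re + z₂.re)) := by
    simp only [Xq, Complex.sub_re]; ring
  have c1 := abs_le.1 ((Complex.abs_re_le_norm z₁).trans h₁)
  have c2 := abs_le.1 ((Complex.abs_re_le_norm z₂).trans h₂)
  rw [e, abs_mul, mul_comm]
  refine mul_le_mul ?_ (Complex.abs_re_le_norm _) (abs_nonneg _) (by norm_num)
  rw [abs_le]
  constructor <;> nlinarith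

lemma Xq_yb_sub_cos_le {δ : ℝ} (hδ0 : 0 ≤ δ) {η : ℝ → ℝ} (h : Adm η) (θ : ℝ) :
    |Xq δ (yb η θ) - cos θ| ≤ 2 * rho + 2 * δ := by
  have c1 := abs_le.1 ((Complex.abs_re_le_norm _).trans (norm_yb_le h θ))
  have h1 := sqrt_near le_rfl (h.bd θ)
  have e : (yb η θ).re = √(1 + 2 * η θ) * cos θ := by
    rw [yb, circleMap_eq_mul_ce, Complex.re_ofReal_mul, ce_re]
  have h2 : |√(1 + 2 * η θ) * cos θ - cos θ| ≤ 2 * rho := by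
    rw [← sub_one_mul, abs_mul]
    refine (mul_le_of_le_one_right (abs_nonneg _) (abs_cos_le_one θ)).trans ?_
    rw [abs_le]; constructor <;> linarith
  have h3 : (yb η θ).re ^ 2 ≤ 4 := by nlinarith
  have h4 := mul_le_mul_of_nonneg_left h3 (by linarith : 0 ≤ δ / 2)
  have h5 : 0 ≤ δ / 2 * (yb η θ).re ^ 2 := by positivity
  rw [Xq]
  rw [← e] at h2
  rw [abs_le] at *
  constructor <;> linarith [h2.1, h2.2]

lemma Sop_sub_le (hK : KernelBound R 2 ν) (hν : 0 ≤ ν) (hν1 : ν ≤ 1 / 10 ^ 9)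
    (hRm : ∀ z, Measurable (R z)) {δ : ℝ} (hδ0 : 0 ≤ δ) (hδ : δ ≤ 1 / 100)
    {η₁ η₂ : ℝ → ℝ} (h₁ : Adm η₁) (h₂ : Adm η₂) {d : ℝ}
    (hd : ∀ θ, |η₁ θ - η₂ θ| ≤ d) (θ : ℝ) :
    |Sop R δ η₁ θ - Sop R δ η₂ θ| ≤ 4 / 5 * d := by
  have hpi := pi_pos
  have hd0 : 0 ≤ d := (abs_nonneg _).trans (hd 0)
  have a1 := Phi_change hK hν hRm h₁ h₂ le_rfl h₁.bd h₂.bd (τ := 1 / 1000) (by norm_num) hd θ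
  have a2 := linear_part_le (h₁.cont.sub h₂.cont) (fun t => by simp [h₁.even, h₂.even]) hd θ
  simp only [Pi.sub_apply] at a2
  rw [← I0_sub h₁.cont h₂.cont, ← I1_sub h₁.cont h₂.cont] at a2
  have a3 : |I1 η₁ - I1 η₂| ≤ 2 * π * d := by
    rw [I1_sub h₁.cont h₂.cont]
    exact abs_I1_le hd
  have a4 := abs_I1_le h₁.bd
  have hX := Xq_sub_le hδ0 (by linarith) (norm_yb_le h₁ θ) (norm_yb_le h₂ θ)
  have hy := (norm_yb_sub_le h₁ h₂ θ).trans (mul_le_mul_of_nonneg_left (hd θ) zero_le_two)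
  have a5 : |I1 η₁ * (Xq δ (yb η₁ θ) - Xq δ (yb η₂ θ))| ≤ 2 * π * rho * (6 * d) := by
    rw [abs_mul]
    exact mul_le_mul a4 (by linarith) (abs_nonneg _) (by norm_num [rho]; positivity)
  have a6 : |(I1 η₁ - I1 η₂) * (Xq δ (yb η₂ θ) - cos θ)| ≤ 2 * π * d * (2 * rho + 2 * δ) := by
    rw [abs_mul]
    exact mul_le_mul a3 (Xq_yb_sub_cos_le hδ0 h₂ θ) (abs_nonneg _) (by positivity)
  have e : Sop R δ η₁ θ - Sop R δ η₂ θ = 1 / π * (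
      (Phi R η₁ (yb η₁ θ) - Phi R η₂ (yb η₂ θ) + π * (η₁ θ - η₂ θ) +
      ∫ t in (-π)..π, (η₁ t - η₂ t) * log ‖ce t - ce θ‖) +
      (-(∫ t in (-π)..π, (η₁ t - η₂ t) * log ‖ce t - ce θ‖) + log 2 / 2 * (I0 η₁ - I0 η₂) -
      (I1 η₁ - I1 η₂) / 2 * cos θ) - 1 / 2 * (I1 η₁ * (Xq δ (yb η₁ θ) - Xq δ (yb η₂ θ))) -
      1 / 2 * ((I1 η₁ - I1 η₂) * (Xq δ (yb η₂ θ) - cos θ))) := by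
    rw [Sop, Sop]
    field_simp
    ring
  rw [e, abs_mul, abs_of_pos (by positivity : 0 < 1 / π), one_div, inv_mul_le_iff₀ hpi]
  have hfin : d * (π * (23 * rho + 8 * (1 / 1000 + rho / (1 / 1000)) + 38 * ν)) + d * (π * log 2) +
      1 / 2 * (2 * π * rho * (6 * d)) + 1 / 2 * (2 * π * d * (2 * rho + 2 * δ)) ≤ π * (4 / 5 * d) := by
    have hl := log_two_lt_d9
    have : 23 * rho + 8 * (1 / 1000 + rho / (1 / 1000)) + 38 * ν + log 2 + 8 * rho + 2 * δ ≤ 4 / 5 := by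
      norm_num [rho] at *
      linarith
    have h2 := mul_le_mul_of_nonneg_left this (by positivity : 0 ≤ π * d)
    linarith
  refine le_trans ?_ hfin
  rw [abs_le] at *
  constructor <;> linarith [a1.1, a1.2, a2.1, a2.2, a5.1, a5.2, a6.1, a6.2]

end Kernel

lemma integral_one_add_log_le {E : Set ℂ} (hEm : MeasurableSet E)
    (hE : E ⊆ Metric.closedBall 0 2) (hv : volume.real E ≤ 4 * π) {z : ℂ} (hz : ‖z‖ ≤ 2) :
    IntegrableOn (fun w => 1 + |log ‖z - w‖|) E ∧
    ∫ w in E, (1 + |log ‖z - w‖|) ≤ 26 * π := by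
  have hb : Bornology.IsBounded E := Metric.isBounded_closedBall.subset hE
  have hf : volume E ≠ ⊤ := hb.measure_lt_top.ne
  have i1 : IntegrableOn (fun w => 1 + |log ‖z - w‖|) E :=
    (integrableOn_const hf).add (integrableOn_log_dist z hb).abs
  have i2 := integrableOn_inv_dist z hf
  have i3 : IntegrableOn (fun _ : ℂ => (5 : ℝ)) E := integrableOn_const hf
  refine ⟨i1, ?_⟩
  calc ∫ w in E, (1 + |log ‖z - w‖|) ≤ ∫ w in E, (5 + ‖z - w‖⁻¹) := by
        refine setIntegral_mono_on i1 (i3.add i2) hEm fun w hw => ?_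
        have h1 := abs_log_le (norm_nonneg (z - w))
        have h2 := norm_sub_le z w
        have h3 := mem_closedBall_zero_iff.1 (hE hw)
        linarith
    _ = 5 * volume.real E + ∫ w in E, ‖z - w‖⁻¹ := by
        rw [integral_add i3 i2, setIntegral_const, smul_eq_mul, mul_comm]
    _ ≤ 26 * π := by
        have := setIntegral_inv_dist_le z hf one_pos
        linarith

section Kernel

variable {R : ℂ → ℂ → ℝ} {ν : ℝ}

lemma kernel_size_le (hK : KernelBound R 2 ν) (hν : 0 ≤ ν) (hRm : ∀ z, Measurable (R z))
    {η : ℝ → ℝ} (h : Adm η) {z : ℂ} (hz : ‖z‖ ≤ 2) :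
    |∫ w in region η, R z w| ≤ ν * (26 * π) := by
  obtain ⟨i1, h1⟩ := integral_one_add_log_le h.ms h.subset_closedBall h.volume_le hz
  refine abs_integral_le_integral_abs.trans ?_
  calc ∫ w in region η, |R z w| ≤ ∫ w in region η, ν * (1 + |log ‖z - w‖|) := by
        refine integral_mono_ae (hK.integrableOn hRm hz h.subset_closedBall).abs (i1.const_mul ν) ?_
        filter_upwards [ae_restrict_of_ae (ae_ne_pair z z volume), ae_restrict_mem h.ms] with w hw hw'
        exact hK.size z w hz (mem_closedBall_zero_iff.1 (h.subset_closedBall hw')) (Ne.symm hw.1)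
    _ = ν * ∫ w in region η, (1 + |log ‖z - w‖|) := integral_const_mul _ _
    _ ≤ _ := mul_le_mul_of_nonneg_left h1 hν

lemma yb_zero (θ : ℝ) : yb (fun _ => 0) θ = ce θ := by
  simp [yb, ce]

lemma Sop_zero_le (hK : KernelBound R 2 ν) (hν : 0 ≤ ν) (hRm : ∀ z, Measurable (R z)) (δ θ : ℝ) :
    |Sop R δ (fun _ => 0) θ| ≤ 26 * ν := by
  have hz : ‖ce θ‖ ≤ 2 := by rw [norm_ce]; norm_num
  have h0 : ∫ w in region (fun _ => 0), log ‖ce θ - w‖ = 0 := by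
    have := discPot_eq (ce θ)
    rw [norm_ce, if_pos le_rfl, discPot, integral_neg, ball_eq_region] at this
    linarith
  have h1 := kernel_size_le hK hν hRm adm_zero hz
  have e : Sop R δ (fun _ => 0) θ = 1 / π * ∫ w in region (fun _ => 0), R (ce θ) w := by
    rw [Sop, yb_zero, Phi_eq_sub le_rfl hK hRm adm_zero hz, h0, I0, I1]
    simp
  rw [e, abs_mul, abs_of_pos (by positivity : 0 < 1 / π), one_div, inv_mul_le_iff₀ pi_pos]
  linarith

lemma Phi_sub_le (hK : KernelBound R 2 ν) (hν : 0 ≤ ν) (hRm : ∀ z, Measurable (R z))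
    {η : ℝ → ℝ} (h : Adm η) {z₁ z₂ : ℂ} (hz₁ : ‖z₁‖ ≤ 2) (hz₂ : ‖z₂‖ ≤ 2) :
    |Phi R η z₁ - Phi R η z₂| ≤ (12 * π + 16 * π * ν) * ‖z₁ - z₂‖ := by
  rw [Phi_eq_sub le_rfl hK hRm h hz₁, Phi_eq_sub le_rfl hK hRm h hz₂]
  have a1 := kernel_point_change le_rfl hK hν hRm h hz₁ hz₂
  have a2 := setIntegral_log_dist_sub_le h.bounded z₁ z₂ one_pos
  have a3 := abs_integral_le_integral_abs (μ := volume.restrict (region η))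
    (f := fun w => log ‖z₁ - w‖ - log ‖z₂ - w‖)
  rw [integral_sub (integrableOn_log_dist _ h.bounded) (integrableOn_log_dist _ h.bounded)] at a3
  have hv := h.volume_le
  have a4 : ‖z₁ - z₂‖ * (2 * (2 * π * 1 + volume.real (region η) / 1)) ≤
      ‖z₁ - z₂‖ * (2 * (2 * π * 1 + 4 * π / 1)) :=
    mul_le_mul_of_nonneg_left (by linarith) (norm_nonneg _)
  have a5 := a3.trans (a2.trans a4)
  rw [abs_le] at *
  constructor <;> linarith [a1.1, a1.2, a5.1, a5.2]

lemma Adm.continuous_yb {η : ℝ → ℝ} (h : Adm η) : Continuous (yb η) := by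
  have e : yb η = fun θ => ((√(1 + 2 * η θ) : ℝ) : ℂ) * ce θ := by
    ext θ; rw [yb, circleMap_eq_mul_ce]
  have h1 := h.cont
  have h2 := continuous_ce
  rw [e]
  fun_prop

lemma Adm.periodic_yb {η : ℝ → ℝ} (h : Adm η) : Function.Periodic (yb η) (2 * π) := fun θ => by
  rw [yb, yb, h.per, periodic_circleMap]

lemma ce_neg (θ : ℝ) : ce (-θ) = conj (ce θ) := by
  apply Complex.ext
  · rw [Complex.conj_re, ce_re, ce_re, cos_neg]
  · rw [Complex.conj_im, ce_im, ce_im, sin_neg]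

lemma Adm.yb_neg {η : ℝ → ℝ} (h : Adm η) (θ : ℝ) : yb η (-θ) = conj (yb η θ) := by
  rw [yb, yb, h.even, circleMap_eq_mul_ce, circleMap_eq_mul_ce, ce_neg, map_mul, Complex.conj_ofReal]

lemma Adm.conj_mem {η : ℝ → ℝ} (h : Adm η) (z : ℂ) : conj z ∈ region η ↔ z ∈ region η := by
  have : η (conj z).arg = η z.arg := by
    rw [Complex.arg_conj]
    split_ifs with h'
    · rw [h']
    · exact h.even _
  simp only [region, Set.mem_ofPred_eq, Complex.norm_conj, this]

lemma Adm.setIntegral_conj {η : ℝ → ℝ} (h : Adm η) (f : ℂ → ℝ) :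
    ∫ w in region η, f (conj w) = ∫ w in region η, f w := by
  have hmp : MeasurePreserving (Complex.conjLIE : ℂ → ℂ) volume volume :=
    Complex.conjLIE.measurePreserving
  have hme : MeasurableEmbedding (Complex.conjLIE : ℂ → ℂ) :=
    Complex.conjLIE.toHomeomorph.measurableEmbedding
  have := hmp.setIntegral_preimage_emb hme f (region η)
  have e : (Complex.conjLIE : ℂ → ℂ) ⁻¹' region η = region η := by
    ext w; exact h.conj_mem w
  rw [e] at this
  exact this

lemma Phi_conj (hRe : ∀ z w, R (conj z) (conj w) = R z w) {η : ℝ → ℝ} (h : Adm η) (z : ℂ) :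
    Phi R η (conj z) = Phi R η z := by
  rw [Phi, ← h.setIntegral_conj, Phi]
  congr 1
  ext w
  rw [hRe, ← map_sub, Complex.norm_conj]

lemma continuous_Sop (hK : KernelBound R 2 ν) (hν : 0 ≤ ν) (hRm : ∀ z, Measurable (R z)) (δ : ℝ)
    {η : ℝ → ℝ} (h : Adm η) : Continuous (Sop R δ η) := by
  have hy := h.continuous_yb
  have hL : LipschitzOnWith (Real.toNNReal (12 * π + 16 * π * ν)) (Phi R η)
      (Metric.closedBall 0 2) := by
    refine LipschitzOnWith.of_dist_le_mul fun z₁ h1 z₂ h2 => ?_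
    rw [Real.dist_eq, dist_eq_norm, Real.coe_toNNReal _ (by positivity)]
    exact Phi_sub_le hK hν hRm h (mem_closedBall_zero_iff.1 h1) (mem_closedBall_zero_iff.1 h2)
  have hP : Continuous fun θ => Phi R η (yb η θ) :=
    hL.continuousOn.comp_continuous hy fun θ => mem_closedBall_zero_iff.2 (norm_yb_le h θ)
  have hη := h.cont
  have hre : Continuous fun θ => (yb η θ).re := Complex.continuous_re.comp hy
  unfold Sop Xq
  fun_prop

lemma adm_Sop (hK : KernelBound R 2 ν) (hν : 0 ≤ ν) (hν1 : ν ≤ 1 / 10 ^ 9)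
    (hRm : ∀ z, Measurable (R z)) (hRe : ∀ z w, R (conj z) (conj w) = R z w)
    {δ : ℝ} (hδ0 : 0 ≤ δ) (hδ : δ ≤ 1 / 100) {η : ℝ → ℝ} (h : Adm η) : Adm (Sop R δ η) where
  cont := continuous_Sop hK hν hRm δ h
  per θ := by rw [Sop, Sop, h.per, h.periodic_yb]
  even θ := by
    rw [Sop, Sop, h.even, h.yb_neg, Phi_conj hRe h, Xq, Xq, Complex.conj_re]
  bd θ := by
    have h1 := Sop_sub_le hK hν hν1 hRm hδ0 hδ h adm_zero (d := rho) (fun θ => by simpa using h.bd θ) θ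
    have h2 := Sop_zero_le hK hν hRm δ θ
    have h3 := abs_add_le (Sop R δ η θ - Sop R δ (fun _ => 0) θ) (Sop R δ (fun _ => 0) θ)
    rw [sub_add_cancel] at h3
    norm_num [rho] at *
    linarith

lemma exists_fixed_point (hK : KernelBound R 2 ν) (hν : 0 ≤ ν) (hν1 : ν ≤ 1 / 10 ^ 9)
    (hRm : ∀ z, Measurable (R z)) (hRe : ∀ z w, R (conj z) (conj w) = R z w)
    {δ : ℝ} (hδ0 : 0 ≤ δ) (hδ : δ ≤ 1 / 100) :
    ∃ η, Adm η ∧ Sop R δ η = η ∧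
      ∀ ζ, Adm ζ → ∀ e, (∀ θ, |Sop R δ ζ θ - ζ θ| ≤ e) → ∀ θ, |η θ - ζ θ| ≤ 5 * e := by
  set K : Set (BoundedContinuousFunction ℝ ℝ) := {f | Adm f} with hKdef
  have hrho : (0 : ℝ) ≤ rho := by norm_num [rho]
  have hKc : IsClosed K := by
    have e : K = ⋂ θ, ({f | f (θ + 2 * π) = f θ} ∩ {f | f (-θ) = f θ} ∩ {f | |f θ| ≤ rho}) := by
      ext f
      simp only [hKdef, Set.mem_ofPred_eq, Set.mem_iInter, Set.mem_inter_iff]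
      exact ⟨fun h θ => ⟨⟨h.per θ, h.even θ⟩, h.bd θ⟩,
        fun h => ⟨f.continuous, fun θ => (h θ).1.1, fun θ => (h θ).1.2, fun θ => (h θ).2⟩⟩
    have hev : ∀ θ : ℝ, Continuous fun f : BoundedContinuousFunction ℝ ℝ => f θ := fun θ =>
      continuous_eval_const θ
    rw [e]
    refine isClosed_iInter fun θ => ((isClosed_eq (hev _) (hev _)).inter
      (isClosed_eq (hev _) (hev _))).inter (isClosed_le (hev θ).abs continuous_const)
  let mkB : (η : ℝ → ℝ) → Adm η → BoundedContinuousFunction ℝ ℝ := fun η h =>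
    BoundedContinuousFunction.ofNormedAddCommGroup η h.cont rho fun θ => h.bd θ
  have hmk : ∀ η h, (mkB η h : ℝ → ℝ) = η := fun η h => rfl
  let T : K → K := fun f => ⟨mkB (Sop R δ f.1) (adm_Sop hK hν hν1 hRm hRe hδ0 hδ f.2),
    adm_Sop hK hν hν1 hRm hRe hδ0 hδ f.2⟩
  have hT : ContractingWith (4 / 5 : NNReal) T := by
    refine ⟨by rw [← NNReal.coe_lt_coe]; norm_num, LipschitzWith.of_dist_le_mul fun f g => ?_⟩
    rw [Subtype.dist_eq]
    refine (BoundedContinuousFunction.dist_le (by positivity)).2 fun θ => ?_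
    have := Sop_sub_le hK hν hν1 hRm hδ0 hδ f.2 g.2 (d := dist f g)
      (fun θ => by rw [← Real.dist_eq]; exact BoundedContinuousFunction.dist_coe_le_dist θ) θ
    rw [Real.dist_eq]
    push_cast
    exact this
  have : CompleteSpace K := hKc.completeSpace_coe
  have : Nonempty K := ⟨⟨mkB (fun _ => 0) adm_zero, adm_zero⟩⟩
  set f := ContractingWith.fixedPoint T hT with hf
  have hfix : T f = f := hT.fixedPoint_isFixedPt
  refine ⟨f.1, f.2, ?_, fun ζ hζ e he θ => ?_⟩
  · exact congrArg (fun g : K => (g.1 : ℝ → ℝ)) hfix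
  · have h1 := hT.dist_fixedPoint_le ⟨mkB ζ hζ, hζ⟩
    rw [← hf] at h1
    have he0 : 0 ≤ e := (abs_nonneg _).trans (he 0)
    have h2 : dist (⟨mkB ζ hζ, hζ⟩ : K) (T ⟨mkB ζ hζ, hζ⟩) ≤ e := by
      rw [Subtype.dist_eq]
      refine (BoundedContinuousFunction.dist_le he0).2 fun θ => ?_
      rw [dist_comm, Real.dist_eq]
      exact he θ
    have h3 : |f.1 θ - ζ θ| ≤ dist (⟨mkB ζ hζ, hζ⟩ : K) f := by
      rw [dist_comm, ← Real.dist_eq]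
      exact BoundedContinuousFunction.dist_coe_le_dist (f := f.1) (g := mkB ζ hζ) θ
    refine h3.trans (h1.trans ?_)
    push_cast
    rw [div_le_iff₀ (by norm_num)]
    linarith

end Kernel

lemma continuous_sin_mul_log : Continuous fun t : ℝ => sin t * log (2 - 2 * cos t) := by
  have hu : ∀ t : ℝ, 0 ≤ 2 - 2 * cos t := fun t => by linarith [cos_le_one t]
  have hb : ∀ t : ℝ, |sin t * log (2 - 2 * cos t)| ≤
      2 * |√(2 - 2 * cos t) * log √(2 - 2 * cos t)| := by
    intro t
    have e : log (2 - 2 * cos t) = 2 * log √(2 - 2 * cos t) := by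
      rw [log_sqrt (hu t)]; ring
    have hs : |sin t| ≤ √(2 - 2 * cos t) := by
      apply abs_le_sqrt
      nlinarith [sin_sq_add_cos_sq t, sq_nonneg (1 - cos t)]
    rw [e, abs_mul, abs_mul, abs_mul, abs_two, abs_of_nonneg (sqrt_nonneg _)]
    nlinarith [mul_le_mul_of_nonneg_right hs (abs_nonneg (log √(2 - 2 * cos t)))]
  have hc : Continuous fun t : ℝ => 2 * |√(2 - 2 * cos t) * log √(2 - 2 * cos t)| := by
    have := continuous_mul_log.comp (by fun_prop : Continuous fun t : ℝ => √(2 - 2 * cos t))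
    exact continuous_const.mul this.abs
  rw [continuous_iff_continuousAt]
  intro t
  by_cases h : 2 - 2 * cos t = 0
  · have h0 := hc.tendsto t
    rw [h] at h0
    simp only [sqrt_zero, zero_mul, abs_zero, mul_zero] at h0
    have : Tendsto (fun t : ℝ => sin t * log (2 - 2 * cos t)) (nhds t) (nhds 0) :=
      squeeze_zero_norm hb h0
    rw [ContinuousAt, h, log_zero, mul_zero]
    exact this
  · exact (continuous_sin.continuousAt).mul (ContinuousAt.log (by fun_prop) h)

lemma log_norm_ce_sub_one (t : ℝ) : log ‖ce t - ce 0‖ = log (2 - 2 * cos t) / 2 := by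
  have := norm_ce_sub_sq t 0
  rw [sub_zero] at this
  rw [← this, log_pow]; push_cast; ring

lemma integral_cos_mul_log_ce_zero :
    ∫ t in (-π)..π, cos t * log ‖ce t - ce 0‖ = -π := by
  have hp : Function.Periodic (fun t => cos t * log ‖ce t - ce 0‖) (2 * π) := fun t => by
    simp only [cos_add_two_pi, periodic_ce t]
  rw [intervalIntegral_periodic_eq hp]
  have hF : Continuous fun t : ℝ => sin t * log (2 - 2 * cos t) / 2 - (t + sin t) / 2 := by
    have := continuous_sin_mul_log
    fun_prop
  rw [intervalIntegral.integral_eq_sub_of_hasDerivAt_of_le two_pi_pos.le hF.continuousOn]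
  · simp
  · intro t ht
    have hc : cos t < 1 := by
      refine lt_of_le_of_ne (cos_le_one t) fun h => ?_
      have := (cos_eq_one_iff_of_lt_of_lt (by linarith [ht.1, pi_pos]) ht.2).1 h
      exact ht.1.ne' this
    have hne : 2 - 2 * cos t ≠ 0 := by linarith
    have h1 : HasDerivAt (fun t : ℝ => 2 - 2 * cos t) (2 * sin t) t := by
      simpa using ((hasDerivAt_cos t).const_mul 2).const_sub 2
    have h2 := (((hasDerivAt_sin t).mul (h1.log hne)).div_const 2).sub
      (((hasDerivAt_id t).add (hasDerivAt_sin t)).div_const 2)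
    refine h2.congr_deriv ?_
    rw [log_norm_ce_sub_one]
    have hne' : 1 - cos t ≠ 0 := by linarith
    have e : sin t * (2 * sin t / (2 - 2 * cos t)) = 1 + cos t := by
      rw [show 2 - 2 * cos t = 2 * (1 - cos t) by ring]
      field_simp
      linear_combination sin_sq_add_cos_sq t
    rw [e]; ring
  · exact (intervalIntegrable_log_ce 0 _ _).continuousOn_mul continuous_cos.continuousOn

lemma integral_cos_mul_log_ce (θ : ℝ) :
    ∫ t in (-π)..π, cos t * log ‖ce t - ce θ‖ = -π * cos θ := by
  have hp : Function.Periodic (fun t => cos t * log ‖ce t - ce θ‖) (2 * π) := fun t => by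
    simp only [cos_add_two_pi, periodic_ce t]
  have hp2 : Function.Periodic (fun t => cos (t + θ) * log ‖ce t - ce 0‖) (2 * π) := fun t => by
    simp only [periodic_ce t, show t + 2 * π + θ = t + θ + 2 * π by ring, cos_add_two_pi]
  have h1 := hp.intervalIntegral_add_eq (-π + θ) (-π)
  rw [show -π + 2 * π = π by ring, show -π + θ + 2 * π = π + θ by ring,
    ← intervalIntegral.integral_comp_add_right (fun t => cos t * log ‖ce t - ce θ‖) θ] at h1
  rw [← h1]
  have e : ∀ t, cos (t + θ) * log ‖ce (t + θ) - ce θ‖ =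
      cos θ * (cos t * log ‖ce t - ce 0‖) - sin θ * (sin t * log ‖ce t - ce 0‖) := by
    intro t
    have hn : ‖ce (t + θ) - ce θ‖ = ‖ce t - ce 0‖ := by
      rw [← sq_eq_sq₀ (norm_nonneg _) (norm_nonneg _), norm_ce_sub_sq, norm_ce_sub_sq]
      ring_nf
    rw [hn, cos_add]; ring
  simp_rw [e]
  have i := intervalIntegrable_log_ce 0 (-π) π
  rw [intervalIntegral.integral_sub ((i.continuousOn_mul continuous_cos.continuousOn).const_mul _)
    ((i.continuousOn_mul continuous_sin.continuousOn).const_mul _),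
    intervalIntegral.integral_const_mul, intervalIntegral.integral_const_mul,
    integral_cos_mul_log_ce_zero, integral_odd_eq_zero (f := fun t => sin t * log ‖ce t - ce 0‖)]
  · ring
  · intro t
    rw [sin_neg, log_norm_ce_sub_one, log_norm_ce_sub_one, cos_neg]; ring

lemma measurable_Rk (δ : ℝ) (z : ℂ) : Measurable (Rk δ z) := by
  have h := continuous_bker.measurable
  have hp : Measurable (px δ) := by unfold px; fun_prop
  have ha : Measurable (am δ z) := by unfold am; fun_prop
  unfold Rk
  fun_prop

lemma px_conj (δ : ℝ) (z : ℂ) : px δ (conj z) = px δ z := by simp [px]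

lemma Rk_conj (δ : ℝ) (z w : ℂ) : Rk δ (conj z) (conj w) = Rk δ z w := by
  simp only [Rk, am, px_conj, ← map_sub, Complex.norm_conj]

lemma adm_cos {b : ℝ} (h0 : 0 ≤ b) (hb : b ≤ rho) : Adm (fun θ => b * cos θ) where
  cont := by fun_prop
  per θ := by simp
  even θ := by simp
  bd θ := by
    rw [abs_mul, abs_of_nonneg h0]
    nlinarith [abs_cos_le_one θ]

lemma integral_disc_re : ∫ w in Metric.ball (0 : ℂ) 1, w.re = 0 := by
  have hmp : MeasurePreserving (fun w : ℂ => -w) volume volume := Measure.measurePreserving_neg _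
  have hme : MeasurableEmbedding (fun w : ℂ => -w) := (MeasurableEquiv.neg ℂ).measurableEmbedding
  have := hmp.setIntegral_preimage_emb hme (fun w => w.re) (Metric.ball 0 1)
  have e : (fun w : ℂ => -w) ⁻¹' Metric.ball 0 1 = Metric.ball 0 1 := by
    ext w; simp
  rw [e] at this
  simp only [Complex.neg_re, integral_neg] at this
  linarith

lemma integral_log_disc_ce (θ : ℝ) : ∫ w in region (fun _ => 0), log ‖ce θ - w‖ = 0 := by
  have := discPot_eq (ce θ)
  rw [norm_ce, if_pos le_rfl, discPot, integral_neg, ball_eq_region] at this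
  linarith

lemma volume_real_unit_ball : volume.real (Metric.ball (0 : ℂ) 1) = π := by
  rw [Measure.real, Complex.volume_ball]
  simp

lemma integral_Rk_disc {δ : ℝ} (hδ : 0 < δ) (hM : δ * 2 ≤ 1 / 4) (hL : 1 ≤ -log δ)
    (hL2 : δ * -log δ ≤ 1) (θ : ℝ) :
    |(∫ w in region (fun _ => 0), Rk δ (ce θ) w) - δ * -log δ * (π / 2 * cos θ)| ≤
      δ * ((40 + 3 * |bker 0|) * 2 ^ 2) * (26 * π) := by
  have hz : ‖ce θ‖ ≤ 2 := by rw [norm_ce]; norm_num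
  have hb := Metric.isBounded_ball (x := (0 : ℂ)) (r := 1)
  obtain ⟨i1, h1⟩ := integral_one_add_log_le adm_zero.ms adm_zero.subset_closedBall
    adm_zero.volume_le hz
  obtain ⟨C, -, hC⟩ := kernelBound_Rk (M := 2) (by norm_num)
  have iR : IntegrableOn (Rk δ (ce θ)) (region fun _ => 0) :=
    (hC δ hδ hM hL hL2).integrableOn (measurable_Rk δ) hz adm_zero.subset_closedBall
  have ir : IntegrableOn (fun w : ℂ => w.re) (Metric.ball (0 : ℂ) 1) :=
    (Complex.continuous_re.continuousOn.integrableOn_compact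
      (isCompact_closedBall (0 : ℂ) 1)).mono_set Metric.ball_subset_closedBall
  have ic : IntegrableOn (fun _ : ℂ => δ * -log δ * (cos θ / 2)) (Metric.ball (0 : ℂ) 1) :=
    integrableOn_const hb.measure_lt_top.ne
  have il : IntegrableOn (fun w : ℂ => δ * -log δ * ((ce θ).re / 2 + 3 * w.re / 2))
      (region fun _ => 0) := by
    rw [← ball_eq_region]
    refine (ic.add (ir.const_mul (δ * -log δ * (3 / 2)))).congr (Eventually.of_forall fun w => ?_)
    simp only [Pi.add_apply, ce_re]; ring
  have e : ∫ w in region (fun _ => 0), δ * -log δ * ((ce θ).re / 2 + 3 * w.re / 2) =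
      δ * -log δ * (π / 2 * cos θ) := by
    rw [← ball_eq_region]
    have : ∀ w : ℂ, δ * -log δ * ((ce θ).re / 2 + 3 * w.re / 2) =
        δ * -log δ * (cos θ / 2) + δ * -log δ * (3 / 2) * w.re := fun w => by rw [ce_re]; ring
    simp_rw [this]
    rw [integral_add ic (ir.const_mul _), integral_const_mul (δ * -log δ * (3 / 2)),
      integral_disc_re, setIntegral_const, volume_real_unit_ball, smul_eq_mul]
    ring
  rw [← e, ← integral_sub iR il]
  refine abs_integral_le_integral_abs.trans ?_
  refine (setIntegral_mono_on (g := fun w => δ * ((40 + 3 * |bker 0|) * 2 ^ 2) *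
    (1 + |log ‖ce θ - w‖|)) (iR.sub il).abs (i1.const_mul _) adm_zero.ms fun w hw => ?_).trans ?_
  · exact Rk_expand hδ (by norm_num) hM hL2 hz
      (mem_closedBall_zero_iff.1 (adm_zero.subset_closedBall hw))
  · rw [integral_const_mul]
    exact mul_le_mul_of_nonneg_left h1 (by positivity)

/-- A constant controlling the remainder kernel on the disc of radius two. -/
def Ck : ℝ := (kernelBound_Rk (M := 2) (by norm_num)).choose

lemma Ck_pos : 0 < Ck := (kernelBound_Rk (M := 2) (by norm_num)).choose_spec.1

/-- The range of core parameters for which the fixed point argument applies. -/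
structure Small (δ : ℝ) : Prop where
  pos : 0 < δ
  le : δ ≤ 1 / 100
  one_le_log : 1 ≤ -log δ
  mul : δ * -log δ ≤ 1
  ker : Ck * (δ * -log δ) ≤ 1 / 10 ^ 9

lemma Small.kernelBound {δ : ℝ} (h : Small δ) : KernelBound (Rk δ) 2 (Ck * (δ * -log δ)) :=
  (kernelBound_Rk (M := 2) (by norm_num)).choose_spec.2 δ h.pos (by linarith [h.le]) h.one_le_log h.mul

lemma Small.b_pos {δ : ℝ} (h : Small δ) : 0 < δ * -log δ :=
  mul_pos h.pos (by linarith [h.one_le_log])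

lemma Small.ker_nonneg {δ : ℝ} (h : Small δ) : 0 ≤ Ck * (δ * -log δ) :=
  (mul_pos Ck_pos h.b_pos).le

open Classical in
/-- The boundary perturbation of the rescaled core. -/
def etaF (δ : ℝ) : ℝ → ℝ :=
  if h : Small δ then (exists_fixed_point h.kernelBound h.ker_nonneg h.ker (measurable_Rk δ)
    (Rk_conj δ) h.pos.le h.le).choose else fun _ => 0

lemma Small.etaF_spec {δ : ℝ} (h : Small δ) : Adm (etaF δ) ∧ Sop (Rk δ) δ (etaF δ) = etaF δ ∧
    ∀ ζ, Adm ζ → ∀ e, (∀ θ, |Sop (Rk δ) δ ζ θ - ζ θ| ≤ e) → ∀ θ, |etaF δ θ - ζ θ| ≤ 5 * e := by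
  rw [etaF, dif_pos h]
  exact (exists_fixed_point h.kernelBound h.ker_nonneg h.ker (measurable_Rk δ)
    (Rk_conj δ) h.pos.le h.le).choose_spec

lemma tendsto_b : Tendsto (fun δ : ℝ => δ * -log δ) (𝓝[>] 0) (𝓝 0) := by
  have h := (Real.continuous_mul_log.tendsto 0).neg
  rw [zero_mul, neg_zero] at h
  exact (tendsto_nhdsWithin_of_tendsto_nhds h).congr fun δ => by ring

lemma tendsto_L : Tendsto (fun δ : ℝ => -log δ) (𝓝[>] 0) atTop :=
  tendsto_neg_atBot_atTop.comp tendsto_log_nhdsGT_zero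

lemma eventually_lt_nhdsGT {a : ℝ} (ha : 0 < a) : ∀ᶠ δ : ℝ in 𝓝[>] 0, δ < a :=
  eventually_nhdsWithin_of_eventually_nhds (eventually_lt_nhds ha)

lemma eventually_small : ∀ᶠ δ : ℝ in 𝓝[>] 0, Small δ := by
  have h1 : Tendsto (fun δ : ℝ => Ck * (δ * -log δ)) (𝓝[>] 0) (𝓝 0) := by
    simpa using tendsto_b.const_mul Ck
  filter_upwards [self_mem_nhdsWithin, eventually_lt_nhdsGT (a := 1 / 100) (by norm_num),
    tendsto_L.eventually_ge_atTop 1, tendsto_b.eventually_lt_const one_pos,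
    h1.eventually_lt_const (u := 1 / 10 ^ 9) (by norm_num)] with δ a1 a2 a3 a4 a5
  exact ⟨a1, a2.le, a3, a4.le, a5.le⟩

/-- The size of the error of the first order approximation of `etaF δ`. -/
def errF (δ : ℝ) : ℝ :=
  23 * (δ * -log δ) + 16 * √(δ * -log δ) + 38 * (Ck * (δ * -log δ)) +
    26 * ((40 + 3 * |bker 0|) * 4) * (-log δ)⁻¹ + 3 * (δ * -log δ) + δ / 4

lemma tendsto_errF : Tendsto errF (𝓝[>] 0) (𝓝 0) := by
  have hb := tendsto_b
  have hs : Tendsto (fun δ : ℝ => √(δ * -log δ)) (𝓝[>] 0) (𝓝 0) := by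
    have := (continuous_sqrt.tendsto 0).comp hb
    rwa [sqrt_zero] at this
  have hL := tendsto_inv_atTop_zero.comp tendsto_L
  have hd : Tendsto (fun δ : ℝ => δ) (𝓝[>] 0) (𝓝 0) := tendsto_nhdsWithin_of_tendsto_nhds tendsto_id
  have := (((((hb.const_mul 23).add (hs.const_mul 16)).add ((hb.const_mul Ck).const_mul 38)).add
    (hL.const_mul (26 * ((40 + 3 * |bker 0|) * 4)))).add (hb.const_mul 3)).add (hd.div_const 4)
  simp only [mul_zero, add_zero, zero_div] at this
  exact this

lemma Sop_cos_sub_le {δ : ℝ} (h : Small δ) (hb : δ * -log δ ≤ rho) (θ : ℝ) :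
    |Sop (Rk δ) δ (fun θ => δ * -log δ * cos θ) θ - δ * -log δ * cos θ| ≤
      δ * -log δ * errF δ := by
  have hR := integral_Rk_disc h.pos (by linarith [h.le]) h.one_le_log h.mul θ
  have hK := h.kernelBound
  have hν := h.ker_nonneg
  have hL : 0 < -log δ := by linarith [h.one_le_log]
  have hδ := h.pos
  have hδ1 := h.le
  have hpi := pi_pos
  have herr : errF δ = 23 * (δ * -log δ) + 16 * √(δ * -log δ) + 38 * (Ck * (δ * -log δ)) +
    26 * ((40 + 3 * |bker 0|) * 4) * (-log δ)⁻¹ + 3 * (δ * -log δ) + δ / 4 := rfl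
  have hbL : δ * -log δ * (-log δ)⁻¹ = δ := by rw [mul_assoc, mul_inv_cancel₀ hL.ne', mul_one]
  have hb0 := h.b_pos
  generalize hbdef : δ * -log δ = b at *
  have hA := adm_cos hb0.le hb
  have hc : ∀ θ, |b * cos θ| ≤ b := fun θ => by
    rw [abs_mul, abs_of_pos hb0]; exact mul_le_of_le_one_right hb0.le (abs_cos_le_one θ)
  have a1 := Phi_change hK hν (measurable_Rk δ) hA adm_zero (q := b) (τ := √b) hb hc
    (fun _ => by simpa using hb0.le) (sqrt_pos.2 hb0) (d := b) (fun θ => by simpa using hc θ) θ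
  have e1 : ∫ t in (-π)..π, (b * cos t - 0) * log ‖ce t - ce θ‖ = -π * (b * cos θ) := by
    have : ∀ t, (b * cos t - 0) * log ‖ce t - ce θ‖ = b * (cos t * log ‖ce t - ce θ‖) :=
      fun t => by ring
    simp_rw [this]
    rw [intervalIntegral.integral_const_mul, integral_cos_mul_log_ce]; ring
  have hbs : b / √b = √b := div_sqrt
  have e2 : Phi (Rk δ) (fun _ => 0) (yb (fun _ => 0) θ) =
      ∫ w in region (fun _ => 0), Rk δ (ce θ) w := by
    rw [yb_zero, Phi_eq_sub le_rfl hK (measurable_Rk δ) adm_zero (by rw [norm_ce]; norm_num),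
      integral_log_disc_ce, sub_zero]
  rw [e1, e2, hbs, sub_zero, show ∀ x y : ℝ, x + π * (b * cos θ) + -π * (b * cos θ) = x from
    fun x _ => by ring] at a1
  swap
  · exact 0
  have eI0 : I0 (fun θ => b * cos θ) = 0 := by
    rw [I0, intervalIntegral.integral_const_mul, integral_cos]; simp
  have eI1 : I1 (fun θ => b * cos θ) = π * b := by
    have : ∀ t, b * cos t * cos t = b * cos t ^ 2 := fun t => by ring
    simp_rw [I1, this]
    rw [intervalIntegral.integral_const_mul, integral_cos_sq]
    simp; ring
  have hX : |Xq δ (yb (fun θ => b * cos θ) θ) - cos θ| ≤ 6 * b + δ / 2 := by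
    have x1 := Xq_sub_le hδ.le (by linarith) (norm_yb_le hA θ) (norm_yb_le adm_zero θ)
    have x2 := norm_yb_sub_le hA adm_zero θ
    rw [sub_zero] at x2
    replace x2 := x2.trans (mul_le_mul_of_nonneg_left (hc θ) zero_le_two)
    have x4 : |Xq δ (yb (fun _ => 0) θ) - cos θ| ≤ δ / 2 := by
      rw [yb_zero, Xq, ce_re, add_sub_cancel_left, abs_of_nonneg (by positivity)]
      exact mul_le_of_le_one_right (by positivity) (cos_sq_le_one θ)
    rw [abs_le] at *
    constructor <;> linarith [x1.1, x1.2, x4.1, x4.2]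
  have e3 : Sop (Rk δ) δ (fun θ => b * cos θ) θ - b * cos θ = 1 / π * (
      (Phi (Rk δ) (fun θ => b * cos θ) (yb (fun θ => b * cos θ) θ) -
        ∫ w in region (fun _ => 0), Rk δ (ce θ) w) +
      ((∫ w in region (fun _ => 0), Rk δ (ce θ) w) - b * (π / 2 * cos θ)) -
      π * b / 2 * (Xq δ (yb (fun θ => b * cos θ) θ) - cos θ)) := by
    rw [Sop, eI0, eI1]; ring
  rw [e3, abs_mul, abs_of_pos (by positivity : 0 < 1 / π), one_div, inv_mul_le_iff₀ hpi, herr]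
  have a3 : |π * b / 2 * (Xq δ (yb (fun θ => b * cos θ) θ) - cos θ)| ≤ π * b / 2 * (6 * b + δ / 2) := by
    rw [abs_mul, abs_of_pos (by positivity : 0 < π * b / 2)]
    exact mul_le_mul_of_nonneg_left hX (by positivity)
  have e4 : π * (b * (26 * ((40 + 3 * |bker 0|) * 4) * (-log δ)⁻¹)) =
      δ * ((40 + 3 * |bker 0|) * 2 ^ 2) * (26 * π) := by
    linear_combination π * 26 * ((40 + 3 * |bker 0|) * 4) * hbL
  rw [abs_le] at *
  constructor <;> linarith [a1.1, a1.2, a3.1, a3.2, hR.1, hR.2]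

lemma eventually_etaF_close : ∀ᶠ δ : ℝ in 𝓝[>] 0, Small δ ∧
    ∀ θ, |etaF δ θ - δ * -log δ * cos θ| ≤ 5 * (δ * -log δ * errF δ) := by
  filter_upwards [eventually_small, tendsto_b.eventually_lt_const (u := rho) (by norm_num [rho])]
    with δ h hb
  exact ⟨h, h.etaF_spec.2.2 _ (adm_cos h.b_pos.le hb.le) _ (Sop_cos_sub_le h hb.le)⟩

lemma tendsto_I1_etaF : Tendsto (fun δ => I1 (etaF δ) / (δ * -log δ)) (𝓝[>] 0) (𝓝 π) := by
  rw [tendsto_iff_norm_sub_tendsto_zero]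
  refine squeeze_zero' (Eventually.of_forall fun _ => norm_nonneg _) ?_
    (g := fun δ => 10 * π * errF δ) (by simpa using tendsto_errF.const_mul (10 * π))
  filter_upwards [eventually_etaF_close] with δ ⟨h, hc⟩
  have hb := h.b_pos
  generalize δ * -log δ = b at *
  have e := I1_sub h.etaF_spec.1.cont (η₂ := fun θ => b * cos θ) (by fun_prop)
  have h1 := abs_I1_le hc
  rw [I1, ← e] at h1
  have eI1 : I1 (fun θ => b * cos θ) = π * b := by
    have : ∀ t, b * cos t * cos t = b * cos t ^ 2 := fun t => by ring
    simp_rw [I1, this]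
    rw [intervalIntegral.integral_const_mul, integral_cos_sq]
    simp; ring
  rw [eI1] at h1
  rw [Real.norm_eq_abs, show I1 (etaF δ) / b - π = (I1 (etaF δ) - π * b) / b by field_simp,
    abs_div, abs_of_pos hb, div_le_iff₀ hb]
  linarith

/-- The sup size of the boundary perturbation. -/
def qF (δ : ℝ) : ℝ := min rho (δ * -log δ + |5 * (δ * -log δ * errF δ)|)

lemma tendsto_qF : Tendsto qF (𝓝[>] 0) (𝓝 0) := by
  have := (tendsto_const_nhds (x := rho) (f := 𝓝[>] (0 : ℝ))).min
    (tendsto_b.add ((tendsto_b.mul tendsto_errF).const_mul 5).abs)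
  simp only [mul_zero, abs_zero, add_zero] at this
  rwa [min_eq_right (by norm_num [rho])] at this

lemma eventually_etaF_le : ∀ᶠ δ : ℝ in 𝓝[>] 0, Small δ ∧ ∀ θ, |etaF δ θ| ≤ qF δ := by
  filter_upwards [eventually_etaF_close] with δ ⟨h, hc⟩
  refine ⟨h, fun θ => le_min (h.etaF_spec.1.bd θ) ?_⟩
  have h1 := (hc θ).trans (le_abs_self _)
  have hb := h.b_pos
  have h2 : |δ * -log δ * cos θ| ≤ δ * -log δ := by
    rw [abs_mul, abs_of_pos hb]; exact mul_le_of_le_one_right hb.le (abs_cos_le_one θ)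
  rw [abs_le] at h1 h2 ⊢
  constructor <;> linarith [h1.1, h1.2]

lemma mem_region_iff {η : ℝ → ℝ} (z : ℂ) : z ∈ region η ↔ ‖z‖ < ‖yb η z.arg‖ := by
  rw [norm_yb, lt_sqrt (norm_nonneg z)]
  rfl

lemma norm_sub_yb (η : ℝ → ℝ) (z : ℂ) : ‖z - yb η z.arg‖ = |‖z‖ - ‖yb η z.arg‖| := by
  have h1 : yb η z.arg = (‖yb η z.arg‖ : ℂ) * ce z.arg := by
    rw [norm_yb, yb, circleMap_eq_mul_ce]
  have h2 : z - yb η z.arg = ((‖z‖ - ‖yb η z.arg‖ : ℝ) : ℂ) * ce z.arg := by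
    rw [Complex.ofReal_sub, sub_mul, ← eq_norm_mul_ce_arg z, ← h1]
  rw [h2, norm_mul, norm_ce, mul_one, Complex.norm_real, Real.norm_eq_abs]

/-- The radial profile of the potential of the unit disc. -/
def radPot (r : ℝ) : ℝ := if r ≤ 1 then π / 2 * (1 - r ^ 2) else -π * log r

lemma discPot_eq_radPot (z : ℂ) : discPot z = radPot ‖z‖ := discPot_eq z

lemma radPot_decrease {a b M : ℝ} (ha : 0 ≤ a) (hab : a ≤ b) (hb : 3 / 4 ≤ b) (hbM : b ≤ M)
    (hM : 1 ≤ M) : (b - a) / M ≤ radPot a - radPot b := by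
  have hpi := pi_gt_three
  have hM0 : 0 < M := by linarith
  have in1 : ∀ {a b : ℝ}, 0 ≤ a → a ≤ b → 3 / 4 ≤ b →
      (b - a) / M ≤ π / 2 * (1 - a ^ 2) - π / 2 * (1 - b ^ 2) := by
    intro a b ha hab hb
    have h1 : (b - a) / M ≤ b - a := div_le_self (by linarith) hM
    have h2 : (b - a) * 1 ≤ (b - a) * (π / 2 * (b + a)) :=
      mul_le_mul_of_nonneg_left (by nlinarith) (by linarith)
    linarith [show π / 2 * (1 - a ^ 2) - π / 2 * (1 - b ^ 2) = (b - a) * (π / 2 * (b + a)) by ring]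
  have out1 : ∀ {a b : ℝ}, 1 ≤ a → a ≤ b → b ≤ M → (b - a) / M ≤ -π * log a - -π * log b := by
    intro a b ha hab hbM
    have hb0 : 0 < b := by linarith
    have h1 := one_sub_inv_le_log_of_pos (div_pos hb0 (by linarith : 0 < a))
    rw [log_div hb0.ne' (by linarith), inv_div] at h1
    have h2 : (b - a) / M ≤ (b - a) / b := div_le_div_of_nonneg_left (by linarith) hb0 hbM
    have h3 : (b - a) / b = 1 - a / b := by field_simp
    have h4 : 0 ≤ log b - log a := sub_nonneg.2 (log_le_log (by linarith) hab)
    nlinarith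
  unfold radPot
  split_ifs with h1 h2 h2
  · exact in1 ha hab hb
  · have e1 := in1 ha h1 (by norm_num)
    have e2 := out1 le_rfl (not_le.1 h2).le hbM
    rw [log_one] at e2
    have : (b - a) / M = (1 - a) / M + (b - 1) / M := by ring
    linarith
  · exact absurd (hab.trans h2) h1
  · exact out1 (not_le.1 h1).le hab hbM

/-- The relative stream function, normalised to vanish on the boundary of the core. -/
def Theta (R : ℂ → ℂ → ℝ) (δ : ℝ) (η : ℝ → ℝ) (z : ℂ) : ℝ :=
  Phi R η z + log 2 / 2 * I0 η - I1 η / 2 * Xq δ z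

lemma Theta_yb {R : ℂ → ℂ → ℝ} {δ : ℝ} {η : ℝ → ℝ} (h : Sop R δ η = η) (θ : ℝ) :
    Theta R δ η (yb η θ) = 0 := by
  have := congrFun h θ
  rw [Sop, add_eq_left, mul_eq_zero] at this
  exact this.resolve_left (by positivity)

lemma Theta_sub_le {R : ℂ → ℂ → ℝ} {M ν δ q : ℝ} (hM : 2 ≤ M) (hK : KernelBound R M ν) (hν : 0 ≤ ν)
    (hRm : ∀ z, Measurable (R z)) (hδ : 0 ≤ δ) {η : ℝ → ℝ} (h : Adm η) (hq0 : 0 < q)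
    (hq : ∀ θ, |η θ| ≤ q) {z y : ℂ} (hz : ‖z‖ ≤ M) (hy : ‖y‖ ≤ M) :
    |Theta R δ η z - Theta R δ η y - (discPot z - discPot y)| ≤
      ‖z - y‖ * (8 * π * √q + 16 * π * ν + π * q * (1 + δ * M)) := by
  have hpi := pi_pos
  have a1 := log_potential_change h hq (sqrt_pos.2 hq0) z y
  rw [div_sqrt] at a1
  have a2 := kernel_point_change hM hK hν hRm h hz hy
  have e := integral_sub (integrableOn_log_dist y h.bounded) (integrableOn_log_dist z h.bounded)
  have e' : ∫ w in region η, (-log ‖z - w‖ + log ‖y - w‖) =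
      ∫ w in region η, (log ‖y - w‖ - log ‖z - w‖) := by
    congr 1; ext w; ring
  rw [e', e] at a1
  have a3 : |I1 η / 2 * (Xq δ z - Xq δ y)| ≤ π * q * (‖z - y‖ * (1 + δ * M)) := by
    have e : Xq δ z - Xq δ y = (z - y).re * (1 + δ / 2 * (z.re + y.re)) := by
      simp only [Xq, Complex.sub_re]; ring
    have c1 := abs_le.1 ((Complex.abs_re_le_norm z).trans hz)
    have c2 := abs_le.1 ((Complex.abs_re_le_norm y).trans hy)
    rw [e, abs_mul, abs_mul]
    refine mul_le_mul ?_ (mul_le_mul (Complex.abs_re_le_norm _) ?_ (abs_nonneg _) (norm_nonneg _))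
      (by positivity) (by positivity)
    · have := abs_I1_le hq
      rw [abs_div, abs_two]; linarith
    · have s1 := mul_le_mul_of_nonneg_left (by linarith [c1.2, c2.2] : z.re + y.re ≤ 2 * M) hδ
      have s2 := mul_le_mul_of_nonneg_left (by linarith [c1.1, c2.1] : -(2 * M) ≤ z.re + y.re) hδ
      rw [abs_le]; constructor <;> linarith
  rw [Theta, Theta, Phi_eq_sub hM hK hRm h hz, Phi_eq_sub hM hK hRm h hy]
  rw [abs_le] at *
  constructor <;> linarith [a1.1, a1.2, a2.1, a2.2, a3.1, a3.2]

lemma Theta_pos_iff {R : ℂ → ℂ → ℝ} {M ν δ q : ℝ} (hM : 2 ≤ M) (hK : KernelBound R M ν) (hν : 0 ≤ ν)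
    (hRm : ∀ z, Measurable (R z)) (hδ : 0 ≤ δ) {η : ℝ → ℝ} (h : Adm η) (hS : Sop R δ η = η)
    (hq0 : 0 < q) (hq : ∀ θ, |η θ| ≤ q)
    (hsmall : 8 * π * √q + 16 * π * ν + π * q * (1 + δ * M) < 1 / M) {z : ℂ} (hz : ‖z‖ ≤ M) :
    0 < Theta R δ η z ↔ z ∈ region η := by
  set y := yb η z.arg with hy
  have hy2 : ‖y‖ ≤ 2 := norm_yb_le h _
  have hy3 : 3 / 4 ≤ ‖y‖ := by
    have := (sqrt_near le_rfl (h.bd z.arg)).1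
    rw [hy, norm_yb]
    norm_num [rho] at this
    linarith
  have a := abs_le.1 (Theta_sub_le hM hK hν hRm hδ h hq0 hq hz (hy2.trans hM))
  rw [Theta_yb hS, sub_zero, discPot_eq_radPot, discPot_eq_radPot, norm_sub_yb] at a
  rw [mem_region_iff]
  have hM0 : 0 < M := by linarith
  rcases lt_or_ge ‖z‖ ‖y‖ with hlt | hge
  · have h1 := radPot_decrease (norm_nonneg z) hlt.le hy3 (hy2.trans hM) (by linarith)
    rw [abs_of_neg (by linarith)] at a
    have h2 := mul_lt_mul_of_pos_left hsmall (by linarith : 0 < -(‖z‖ - ‖y‖))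
    have h3 : (‖y‖ - ‖z‖) / M = -(‖z‖ - ‖y‖) * (1 / M) := by ring
    exact iff_of_true (by linarith [a.1]) hlt
  · have h1 := radPot_decrease (norm_nonneg y) hge (hy3.trans hge) hz (by linarith)
    rw [abs_of_nonneg (by linarith)] at a
    have h2 := mul_le_mul_of_nonneg_left hsmall.le (by linarith : 0 ≤ ‖z‖ - ‖y‖)
    have h3 : (‖z‖ - ‖y‖) / M = (‖z‖ - ‖y‖) * (1 / M) := by ring
    exact iff_of_false (by linarith [a.2]) (not_lt.2 hge)

/-- The rescaled core. -/
def Df (δ : ℝ) : Set ℂ := region (etaF δ)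

/-- The rescaled translation speed. -/
def vf (δ : ℝ) : ℝ := I1 (etaF δ) / (4 * δ)

/-- The rescaled flux constant. -/
def mf (δ : ℝ) : ℝ := cst δ * (π + I0 (etaF δ)) - log 2 / 2 * I0 (etaF δ) - vf δ

/-- The rescaled stream function. -/
def Uf (δ : ℝ) (z : ℂ) : ℝ := ∫ w in Df δ, kd δ z w

lemma volume_real_region {η : ℝ → ℝ} (h : Adm η) : volume.real (region η) = π + I0 η := by
  have := (region_integral h.meas h.bd8 (G := fun _ => 1) measurable_const
    intervalIntegrable_const).2
  rw [setIntegral_const, smul_eq_mul, mul_one] at this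
  rw [this]
  simp_rw [mul_one]
  rw [intervalIntegral.integral_add intervalIntegrable_const (h.cont.intervalIntegrable _ _),
    intervalIntegral.integral_const, smul_eq_mul, I0]
  ring

lemma px_pos_of_norm_le {δ : ℝ} (h : Small δ) {w : ℂ} (hw : ‖w‖ ≤ 2) : 3 / 4 ≤ px δ w :=
  (px_bounds h.pos (by linarith [h.le]) hw).2.1

lemma Small.adm {δ : ℝ} (h : Small δ) : Adm (etaF δ) := h.etaF_spec.1

lemma Small.norm_le {δ : ℝ} (h : Small δ) {w : ℂ} (hw : w ∈ Df δ) : ‖w‖ ≤ 2 :=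
  mem_closedBall_zero_iff.1 (h.adm.subset_closedBall hw)

lemma continuous_px (δ : ℝ) : Continuous (px δ) := by unfold px; fun_prop

lemma continuousOn_am {δ : ℝ} (z : ℂ) : Continuous (am δ z) := by
  have := continuous_px δ
  unfold am; fun_prop

lemma integrableOn_Rk {δ : ℝ} (h : Small δ) {z : ℂ} (hz : 0 < px δ z) :
    IntegrableOn (Rk δ z) (Metric.closedBall 0 2) := by
  have hc := isCompact_closedBall (0 : ℂ) 2
  have h1 : IntegrableOn (fun w => (am δ z w - 1) * log ‖z - w‖) (Metric.closedBall 0 2) :=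
    IntegrableOn.continuousOn_mul ((continuousOn_am z).sub continuous_const).continuousOn
      (integrableOn_log_dist z Metric.isBounded_closedBall) hc
  have hne : ∀ w ∈ Metric.closedBall (0 : ℂ) 2, px δ z * px δ w ≠ 0 := fun w hw =>
    (mul_pos hz (by linarith [px_pos_of_norm_le h (mem_closedBall_zero_iff.1 hw)])).ne'
  have hpc := continuous_px δ
  have hac := continuousOn_am (δ := δ) z
  have hl : ContinuousOn (fun w => log (px δ z * px δ w)) (Metric.closedBall 0 2) :=
    ContinuousOn.log (by fun_prop) hne
  have hb : ContinuousOn (fun w => bker (δ * ‖z - w‖ / √(px δ z * px δ w))) (Metric.closedBall 0 2) := by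
    refine continuous_bker.comp_continuousOn (ContinuousOn.div (by fun_prop) (by fun_prop) ?_)
    intro w hw
    exact (sqrt_pos.2 (lt_of_le_of_ne (mul_pos hz (by
      linarith [px_pos_of_norm_le h (mem_closedBall_zero_iff.1 hw)])).le (hne w hw).symm)).ne'
  have h2 : ContinuousOn (fun w => (am δ z w - 1) * -log δ + am δ z w * (log (px δ z * px δ w) / 2) +
      (am δ z w * bker (δ * ‖z - w‖ / √(px δ z * px δ w)) - bker 0) / 2) (Metric.closedBall 0 2) := by
    fun_prop
  refine ((h2.integrableOn_compact hc).sub h1).congr (Eventually.of_forall fun w => ?_)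
  simp only [Pi.sub_apply, Rk]; ring

lemma Uf_eq {δ : ℝ} (h : Small δ) {z : ℂ} (hz : 0 < px δ z) :
    IntegrableOn (kd δ z) (Df δ) ∧
    Uf δ z = Phi (Rk δ) (etaF δ) z + cst δ * (π + I0 (etaF δ)) := by
  have i1 := (integrableOn_Rk h hz).mono_set h.adm.subset_closedBall
  have i2 := integrableOn_log_dist z h.adm.bounded
  have i3 : IntegrableOn (fun w => -log ‖z - w‖ + Rk δ z w) (region (etaF δ)) := i2.neg.add i1
  have i4 : IntegrableOn (fun _ : ℂ => cst δ) (region (etaF δ)) :=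
    integrableOn_const h.adm.bounded.measure_lt_top.ne
  have e : ∀ᵐ w ∂volume.restrict (Df δ), -log ‖z - w‖ + Rk δ z w + cst δ = kd δ z w := by
    filter_upwards [ae_restrict_of_ae (ae_ne_pair z z volume), ae_restrict_mem h.adm.ms] with w hw hw'
    exact (kd_eq h.pos hz (by linarith [px_pos_of_norm_le h (h.norm_le hw')]) hw.1.symm).symm
  refine ⟨(i3.add i4).congr e, ?_⟩
  rw [Uf, ← integral_congr_ae e, Df, integral_add i3 i4, setIntegral_const,
    volume_real_region h.adm, smul_eq_mul, Phi]
  ring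

lemma Uf_sub_eq_Theta {δ : ℝ} (h : Small δ) {z : ℂ} (hz : 0 < px δ z) :
    Uf δ z - vf δ * px δ z ^ 2 - mf δ = Theta (Rk δ) δ (etaF δ) z := by
  have hδ := h.pos.ne'
  rw [(Uf_eq h hz).2, mf, Theta, vf, Xq, px]
  field_simp
  ring

lemma qF_pos {δ : ℝ} (h : Small δ) : 0 < qF δ :=
  lt_min (by norm_num [rho]) (add_pos_of_pos_of_nonneg h.b_pos (abs_nonneg _))

lemma eventually_near {M : ℝ} (hM : 2 ≤ M) : ∀ᶠ δ : ℝ in 𝓝[>] 0, Small δ ∧ ∀ z, ‖z‖ ≤ M →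
    0 < px δ z ∧ (mf δ < Uf δ z - vf δ * px δ z ^ 2 ↔ z ∈ Df δ) := by
  obtain ⟨C, hC, hK⟩ := kernelBound_Rk (M := M) (by linarith)
  have hd : Tendsto (fun δ : ℝ => δ) (𝓝[>] 0) (𝓝 0) := tendsto_nhdsWithin_of_tendsto_nhds tendsto_id
  have hq := tendsto_qF
  have hs : Tendsto (fun δ : ℝ => √(qF δ)) (𝓝[>] 0) (𝓝 0) := by
    have := (continuous_sqrt.tendsto 0).comp hq
    rwa [sqrt_zero] at this
  have ht := ((hs.const_mul (8 * π)).add ((tendsto_b.const_mul C).const_mul (16 * π))).add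
    ((hq.const_mul π).mul ((hd.mul_const M).const_add 1))
  simp only [mul_zero, zero_mul, add_zero] at ht
  have hdM := hd.mul_const M
  rw [zero_mul] at hdM
  filter_upwards [eventually_etaF_le, ht.eventually_lt_const (u := 1 / M) (by positivity),
    hdM.eventually_lt_const (u := 1 / 4) (by norm_num)] with δ ⟨h, hb⟩ h1 h2
  refine ⟨h, fun z hz => ?_⟩
  have hp : 0 < px δ z := by linarith [(px_bounds h.pos h2.le hz).2.1]
  refine ⟨hp, ?_⟩
  rw [Df, ← Theta_pos_iff hM (hK δ h.pos h2.le h.one_le_log h.mul) (mul_pos hC h.b_pos).le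
    (measurable_Rk δ) h.pos.le h.adm h.etaF_spec.2.1 (qF_pos h) hb h1 hz, ← Uf_sub_eq_Theta h hp,
    sub_pos]

lemma tendsto_I0_etaF : Tendsto (fun δ => I0 (etaF δ)) (𝓝[>] 0) (𝓝 0) := by
  have h := tendsto_qF.const_mul (2 * π)
  rw [mul_zero] at h
  refine squeeze_zero_norm' ?_ h
  filter_upwards [eventually_etaF_le] with δ ⟨_, hb⟩
  have := intervalIntegral.norm_integral_le_of_norm_le_const (a := -π) (b := π) (f := etaF δ)
    (C := qF δ) fun θ _ => hb θ
  rw [I0]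
  refine this.trans (le_of_eq ?_)
  rw [abs_of_pos (by linarith [pi_pos])]
  ring

lemma tendsto_vf : Tendsto (fun δ => vf δ / -log δ) (𝓝[>] 0) (𝓝 (π / 4)) := by
  refine (tendsto_I1_etaF.div_const 4).congr' ?_
  filter_upwards [eventually_small] with δ h
  have := h.pos.ne'
  have : -log δ ≠ 0 := by linarith [h.one_le_log]
  have : log δ ≠ 0 := by linarith [h.one_le_log]
  rw [vf]
  field_simp

/-- The area of the rescaled core. -/
def volD (δ : ℝ) : ℝ := π + I0 (etaF δ)

lemma tendsto_volD : Tendsto volD (𝓝[>] 0) (𝓝 π) := by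
  have := tendsto_I0_etaF.const_add π
  rwa [add_zero] at this

lemma Uf_le_of_kd_le {δ B : ℝ} (h : Small δ) {z : ℂ} (hz : 0 < px δ z)
    (hB : ∀ w ∈ Df δ, kd δ z w ≤ B) : Uf δ z ≤ volD δ * B := by
  have := setIntegral_mono_on (Uf_eq h hz).1
    (integrableOn_const (C := B) (h.adm.bounded.measure_lt_top (μ := volume)).ne) h.adm.ms hB
  refine this.trans (le_of_eq ?_)
  rw [setIntegral_const, smul_eq_mul, Df, volume_real_region h.adm, volD]

lemma kd_le_log {δ : ℝ} (h : Small δ) {z w : ℂ} (hz : 0 < px δ z) (hw : ‖w‖ ≤ 2) (hr : 4 ≤ ‖z‖) :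
    kd δ z w ≤ √(px δ z) * (1 + 4 * δ) *
      log (1 + 8 * √(px δ z) * √(px δ w) / (δ * ‖z‖)) := by
  have hδ := h.pos
  have hle := h.le
  obtain ⟨-, hQ1, -⟩ := px_bounds hδ (by linarith) hw
  have hQ0 : 0 < px δ w := by linarith
  have hQ2 : px δ w ≤ 1 + 2 * δ := by
    have := mul_le_mul_of_nonneg_left ((Complex.re_le_norm w).trans hw) hδ.le
    rw [px]; linarith
  have hd : ‖z‖ / 2 ≤ ‖z - w‖ := by linarith [norm_sub_norm_le z w]
  have hd0 : 0 < δ * ‖z - w‖ := mul_pos hδ (by linarith)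
  have hs : 0 < √(px δ z * px δ w) := sqrt_pos.2 (mul_pos hz hQ0)
  have hlog : 1 + 4 / (δ * ‖z - w‖ / √(px δ z * px δ w)) ≤
      1 + 8 * √(px δ z) * √(px δ w) / (δ * ‖z‖) := by
    rw [mul_assoc, ← sqrt_mul hz.le, div_div_eq_mul_div, add_le_add_iff_left,
      div_le_div_iff₀ hd0 (mul_pos hδ (by linarith))]
    have := mul_le_mul_of_nonneg_left hd (mul_pos hs hδ).le
    linarith
  have h1 := (neg_log_add_bker_le (div_pos hd0 hs)).trans (log_le_log (by positivity) hlog)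
  have hsq : px δ w * √(px δ w) ≤ 1 + 4 * δ := by
    have : √(px δ w) ≤ 1 + δ := by
      rw [sqrt_le_left (by linarith)]; nlinarith
    calc _ ≤ (1 + 2 * δ) * (1 + δ) := mul_le_mul hQ2 this (sqrt_nonneg _) (by linarith)
      _ ≤ _ := by nlinarith
  have hl0 : 0 ≤ log (1 + 8 * √(px δ z) * √(px δ w) / (δ * ‖z‖)) := by
    refine log_nonneg (le_add_of_nonneg_right ?_)
    have := mul_pos hδ (by linarith : 0 < ‖z‖)
    positivity
  exact (mul_le_mul_of_nonneg_left h1 (by positivity)).trans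
    (mul_le_mul_of_nonneg_right (mul_le_mul_of_nonneg_left hsq (sqrt_nonneg _)) hl0)

lemma kd_le_of_far {δ : ℝ} (h : Small δ) {z w : ℂ} (hz : 0 < px δ z) (hw : ‖w‖ ≤ 2) (hr : 4 ≤ ‖z‖)
    (hN : 1 / 10 ≤ δ * ‖z‖) : kd δ z w ≤ 300 := by
  have hδ := h.pos
  have hle := h.le
  obtain ⟨-, hQ1, hQ2⟩ := px_bounds hδ (by linarith) hw
  refine (kd_le_log h hz hw hr).trans ?_
  have hP : px δ z ≤ 11 * (δ * ‖z‖) := by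
    have := mul_le_mul_of_nonneg_left (Complex.re_le_norm z) hδ.le
    rw [px]; linarith
  have hQ : √(px δ w) ≤ 2 := by rw [sqrt_le_left (by norm_num)]; linarith
  have hx : 0 ≤ 8 * √(px δ z) * √(px δ w) / (δ * ‖z‖) := by positivity
  have h1 : log (1 + 8 * √(px δ z) * √(px δ w) / (δ * ‖z‖)) ≤
      16 * √(px δ z) / (δ * ‖z‖) := by
    have := log_le_sub_one_of_pos (x := 1 + 8 * √(px δ z) * √(px δ w) / (δ * ‖z‖)) (by linarith)
    refine this.trans ?_
    rw [add_sub_cancel_left]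
    refine div_le_div_of_nonneg_right ?_ (by linarith)
    have := mul_le_mul_of_nonneg_left hQ (by positivity : 0 ≤ 8 * √(px δ z))
    linarith
  have h2 := mul_le_mul_of_nonneg_left h1 (by positivity : 0 ≤ √(px δ z) * (1 + 4 * δ))
  refine h2.trans ?_
  have h3 : √(px δ z) * (1 + 4 * δ) * (16 * √(px δ z) / (δ * ‖z‖)) =
      16 * (1 + 4 * δ) * (px δ z / (δ * ‖z‖)) := by
    rw [show √(px δ z) * (1 + 4 * δ) * (16 * √(px δ z) / (δ * ‖z‖)) =
      16 * (1 + 4 * δ) * ((√(px δ z) * √(px δ z)) / (δ * ‖z‖)) by ring, mul_self_sqrt hz.le]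
  rw [h3]
  have h4 : px δ z / (δ * ‖z‖) ≤ 11 := by rwa [div_le_iff₀ (by linarith)]
  nlinarith [div_nonneg hz.le (by linarith : 0 ≤ δ * ‖z‖)]

lemma kd_le_of_mid {δ : ℝ} (h : Small δ) {z w : ℂ} (hz : 0 < px δ z) (hw : ‖w‖ ≤ 2) (hr : 4 ≤ ‖z‖)
    (hN : δ * ‖z‖ < 1 / 10) :
    kd δ z w ≤ (1 + δ * z.re / 2) * (1 + 4 * δ) * log (10 / (δ * ‖z‖)) := by
  have hδ := h.pos
  have hle := h.le
  have hN0 : 0 < δ * ‖z‖ := mul_pos hδ (by linarith)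
  obtain ⟨-, hQ1, hQ2⟩ := px_bounds hδ (by linarith) hw
  refine (kd_le_log h hz hw hr).trans ?_
  have hp : |δ * z.re| ≤ δ * ‖z‖ := by
    rw [abs_mul, abs_of_pos hδ]; exact mul_le_mul_of_nonneg_left (Complex.abs_re_le_norm z) hδ.le
  have hp' := abs_le.1 hp
  have hP : √(px δ z) ≤ 1 + δ * z.re / 2 := by
    rw [px, sqrt_le_left (by linarith)]; nlinarith [sq_nonneg (δ * z.re)]
  have hQw : px δ w ≤ 1 + 2 * δ := by
    have := mul_le_mul_of_nonneg_left ((Complex.re_le_norm w).trans hw) hδ.le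
    rw [px]; linarith
  have hQ : √(px δ w) ≤ 1 + δ := by
    rw [sqrt_le_left (by linarith)]; nlinarith
  have hx : 0 ≤ 8 * √(px δ z) * √(px δ w) / (δ * ‖z‖) := by positivity
  have hPQ : √(px δ z) * √(px δ w) ≤ 105 / 100 * (101 / 100) :=
    mul_le_mul (by linarith) (by linarith) (sqrt_nonneg _) (by norm_num)
  have hin : 1 + 8 * √(px δ z) * √(px δ w) / (δ * ‖z‖) ≤ 10 / (δ * ‖z‖) := by
    rw [le_div_iff₀ hN0, add_mul, div_mul_cancel₀ _ hN0.ne']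
    linarith
  have h1 := log_le_log (by linarith) hin
  have h0 : 0 ≤ log (10 / (δ * ‖z‖)) := log_nonneg (by rw [le_div_iff₀ hN0]; linarith)
  exact (mul_le_mul_of_nonneg_left h1 (by positivity)).trans
    (mul_le_mul_of_nonneg_right (mul_le_mul_of_nonneg_right hP (by linarith)) h0)

lemma far_inequality {N r p L v c δ : ℝ} (hN0 : 0 < N) (hN : N < 1 / 10) (hr : 0 ≤ log r)
    (hp : |p| ≤ N) (hL : L = log r - log N) (hv0 : 0 ≤ v) (hv : |4 * v - L| ≤ 1 / 10 * L)
    (hδ : 0 ≤ δ) (hδL : 5 * (δ * (3 + L)) ≤ 1) (hc : 2 * (c + 5) ≤ log r) :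
    (1 + p / 2) * (1 + 4 * δ) * log (10 / N) ≤ v * (1 + p) ^ 2 + (L - c - v) := by
  have h10 : log 10 ≤ 3 := by
    rw [log_le_iff_le_exp (by norm_num)]
    have : (2.7 : ℝ) ≤ exp 1 := by linarith [exp_one_gt_d9]
    calc (10 : ℝ) ≤ 2.7 ^ 3 := by norm_num
      _ ≤ exp 1 ^ 3 := by gcongr
      _ = exp 3 := by rw [← exp_nat_mul]; norm_num
  have h10' : 0 ≤ log 10 := log_nonneg (by norm_num)
  rw [log_div (by norm_num) hN0.ne']
  have hlN : 0 ≤ -log N := by have := log_nonpos hN0.le (by linarith); linarith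
  have hNl : N * -log N ≤ 1 := by
    have := log_le_sub_one_of_pos (inv_pos.2 hN0)
    rw [log_inv] at this
    have := mul_le_mul_of_nonneg_left this hN0.le
    rw [mul_sub, mul_inv_cancel₀ hN0.ne'] at this
    linarith
  have hL0 : 0 ≤ L := by linarith
  have hp' := abs_le.1 hp
  set l := log 10 - log N with hl
  have hl0 : 0 ≤ l := by linarith
  have hlL : l ≤ 3 + L := by linarith
  have e1 : (1 + p / 2) * (4 * δ) * l ≤ 1 := by
    have a1 : (1 + p / 2) * 4 ≤ 5 := by linarith
    have a2 : δ * l ≤ δ * (3 + L) := mul_le_mul_of_nonneg_left hlL hδ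
    have a3 : 0 ≤ δ * l := mul_nonneg hδ hl0
    calc (1 + p / 2) * (4 * δ) * l = ((1 + p / 2) * 4) * (δ * l) := by ring
      _ ≤ 5 * (δ * l) := mul_le_mul_of_nonneg_right a1 a3
      _ ≤ 1 := by linarith
  have e2 : |p * (l / 2 - 2 * v)| ≤ N * (L / 20 + log r / 2 + 3 / 2) := by
    rw [abs_mul]
    refine mul_le_mul hp ?_ (abs_nonneg _) hN0.le
    rw [abs_le] at *
    constructor <;> linarith [hv.1, hv.2]
  have e3 : N * (L / 20 + log r / 2 + 3 / 2) ≤ 6 / 100 * log r + 1 / 4 := by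
    have : N * log r ≤ 1 / 10 * log r := mul_le_mul_of_nonneg_right hN.le hr
    rw [hL]
    linarith
  have e4 : 0 ≤ v * p ^ 2 := by positivity
  have e5 := (le_abs_self _).trans (e2.trans e3)
  linarith

lemma eventually_far : ∃ M : ℝ, 2 ≤ M ∧ ∀ᶠ δ : ℝ in 𝓝[>] 0, Small δ ∧ 0 < mf δ ∧
    ∀ z, M < ‖z‖ → 0 < px δ z → Uf δ z - vf δ * px δ z ^ 2 ≤ mf δ := by
  set c : ℝ := |bker 0| / 2 + 1 with hc
  have hc1 : 1 ≤ c := by have := abs_nonneg (bker 0); linarith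
  refine ⟨exp (2 * (c + 5)), ?_, ?_⟩
  · linarith [add_one_le_exp (2 * (c + 5))]
  have t1 : Tendsto (fun δ => vf δ / -log δ / volD δ) (𝓝[>] 0) (𝓝 (1 / 4)) := by
    have := tendsto_vf.div tendsto_volD pi_ne_zero
    rwa [show π / 4 / π = 1 / 4 by field_simp] at this
  have t2 : Tendsto (fun δ => log 2 / 2 * I0 (etaF δ) / volD δ) (𝓝[>] 0) (𝓝 0) := by
    have := (tendsto_I0_etaF.const_mul (log 2 / 2)).div tendsto_volD pi_ne_zero
    rwa [mul_zero, zero_div] at this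
  have hd : Tendsto (fun δ : ℝ => δ) (𝓝[>] 0) (𝓝 0) := tendsto_nhdsWithin_of_tendsto_nhds tendsto_id
  have t3 : Tendsto (fun δ : ℝ => 5 * (δ * 3 + δ * -log δ)) (𝓝[>] 0) (𝓝 0) := by
    have := ((hd.mul_const 3).add tendsto_b).const_mul 5
    simpa using this
  filter_upwards [eventually_small, tendsto_volD.eventually_const_lt (u := 3) pi_gt_three,
    t1.eventually_const_lt (u := 9 / 40) (by norm_num),
    t1.eventually_lt_const (u := 11 / 40) (by norm_num),
    t2.eventually_lt_const (u := 1 / 2) (by norm_num),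
    t3.eventually_lt_const (u := 1) (by norm_num),
    tendsto_L.eventually_ge_atTop (10 * c + 30000)] with δ h hV hv1 hv2 hI hδL hL
  have hδ := h.pos
  set L := -log δ with hLdef
  have hL0 : 0 < L := by linarith
  have hV0 : 0 < volD δ := by linarith
  set v := vf δ / volD δ with hvdef
  rw [show vf δ / L / volD δ = v / L by rw [hvdef]; ring] at hv1 hv2
  rw [lt_div_iff₀ hL0] at hv1
  rw [div_lt_iff₀ hL0] at hv2
  have hvf : vf δ = volD δ * v := by rw [hvdef]; field_simp
  have hm : volD δ * (L - c - v) < mf δ := by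
    have e : mf δ = volD δ * (cst δ - log 2 / 2 * I0 (etaF δ) / volD δ - v) := by
      rw [mul_sub, mul_sub, mul_div_cancel₀ _ hV0.ne', ← hvf, mf, volD]; ring
    rw [e]
    refine mul_lt_mul_of_pos_left ?_ hV0
    rw [cst]
    linarith [neg_abs_le (bker 0)]
  have hm0 : 0 < volD δ * (L - c - v) := mul_pos hV0 (by linarith)
  refine ⟨h, hm0.trans hm, fun z hzM hz => ?_⟩
  have hr4 : 4 ≤ ‖z‖ := by linarith [add_one_le_exp (2 * (c + 5))]
  have hP2 : 0 ≤ px δ z ^ 2 := sq_nonneg _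
  have hv0 : 0 ≤ v := by linarith
  rcases le_or_gt (1 / 10) (δ * ‖z‖) with hN | hN
  · have := Uf_le_of_kd_le h hz fun w hw => kd_le_of_far h hz (h.norm_le hw) hr4 hN
    have h1 : volD δ * 300 ≤ volD δ * (L - c - v) := mul_le_mul_of_nonneg_left (by linarith) hV0.le
    have h2 : 0 ≤ vf δ * px δ z ^ 2 := by rw [hvf]; positivity
    linarith
  · have := Uf_le_of_kd_le h hz fun w hw => kd_le_of_mid h hz (h.norm_le hw) hr4 hN
    have hN0 : 0 < δ * ‖z‖ := mul_pos hδ (by linarith)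
    have hp : |δ * z.re| ≤ δ * ‖z‖ := by
      rw [abs_mul, abs_of_pos hδ]
      exact mul_le_mul_of_nonneg_left (Complex.abs_re_le_norm z) hδ.le
    have hlr : 2 * (c + 5) ≤ log ‖z‖ := by
      rw [le_log_iff_exp_le (by linarith)]; exact hzM.le
    have key := far_inequality (L := L) (v := v) (c := c) (δ := δ) hN0 hN (by linarith) hp
      (by rw [log_mul hδ.ne' (by linarith)]; linarith) hv0
      (by rw [abs_le]; constructor <;> linarith) hδ.le (by linarith) hlr
    have h1 := mul_le_mul_of_nonneg_left key hV0.le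
    have h2 : vf δ * px δ z ^ 2 = volD δ * (v * (1 + δ * z.re) ^ 2) := by rw [hvf, px]; ring
    rw [mul_add] at h1
    linarith

lemma exists_local_bound {X : Type*} [TopologicalSpace X] {U : Set X} {a : X → ℂ → ℝ} {K : Set ℂ}
    (hK : IsCompact K) (ha : ContinuousOn a.uncurry (U ×ˢ K)) {t : X} (ht : t ∈ U) :
    ∃ B, 0 ≤ B ∧ ∀ᶠ s in 𝓝[U] t, ∀ w ∈ K, |a s w| ≤ B := by
  obtain ⟨v, hv, h⟩ := hK.mem_uniformity_of_prod ha ht (Metric.dist_mem_uniformity one_pos)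
  have hc : ContinuousOn (a t) K :=
    ha.comp (f := fun w => (t, w)) (by fun_prop) fun w hw => ⟨ht, hw⟩
  obtain ⟨B, hB⟩ := hK.exists_bound_of_continuousOn hc
  refine ⟨|B| + 1, by positivity, ?_⟩
  filter_upwards [hv] with s hs w hw
  have h1 : dist (a s w) (a t w) < 1 := h s hs w hw
  have h2 := hB w hw
  rw [Real.dist_eq] at h1
  rw [Real.norm_eq_abs] at h2
  have h3 := abs_sub_abs_le_abs_sub (a s w) (a t w)
  linarith [le_abs_self B]

lemma continuousOn_slice {X : Type*} [TopologicalSpace X] {U : Set X} {a : X → ℂ → ℝ} {K : Set ℂ}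
    (ha : ContinuousOn a.uncurry (U ×ˢ K)) {t : X} (ht : t ∈ U) : ContinuousOn (a t) K :=
  ha.comp (f := fun w => (t, w)) (by fun_prop) fun _ hw => ⟨ht, hw⟩

lemma continuousOn_log_integral {X : Type*} [TopologicalSpace X] [FirstCountableTopology X]
    {U : Set X} {zf : X → ℂ} {a c : X → ℂ → ℝ} {D K : Set ℂ} (hD : MeasurableSet D)
    (hK : IsCompact K) (hDK : D ⊆ K) (hz : ContinuousOn zf U)
    (ha : ContinuousOn a.uncurry (U ×ˢ K)) (hc : ContinuousOn c.uncurry (U ×ˢ K)) :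
    ContinuousOn (fun t => ∫ w in D, (a t w * log ‖zf t - w‖ + c t w)) U := by
  intro t ht
  have hb : Bornology.IsBounded D := hK.isBounded.subset hDK
  obtain ⟨A, hA0, hA⟩ := exists_local_bound hK ha ht
  obtain ⟨C, hC0, hC⟩ := exists_local_bound hK hc ht
  have ia : ∀ s ∈ U, ∀ y : ℂ, IntegrableOn (fun w => a s w * log ‖y - w‖) D := fun s hs y =>
    (IntegrableOn.continuousOn_mul (continuousOn_slice ha hs)
      (integrableOn_log_dist y hK.isBounded) hK).mono_set hDK
  have ic : ∀ s ∈ U, IntegrableOn (c s) D := fun s hs =>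
    ((continuousOn_slice hc hs).integrableOn_compact hK).mono_set hDK
  have i0 := integrableOn_log_dist (zf t) hb
  have h1 : ContinuousWithinAt (fun s => ∫ w in D, (a s w * log ‖zf t - w‖ + c s w)) U t := by
    refine continuousWithinAt_of_dominated (bound := fun w => A * |log ‖zf t - w‖| + C) ?_ ?_ ?_ ?_
    · filter_upwards [self_mem_nhdsWithin] with s hs
      exact ((ia s hs _).add (ic s hs)).aestronglyMeasurable
    · filter_upwards [hA, hC] with s h1 h2
      filter_upwards [ae_restrict_mem hD] with w hw
      rw [Real.norm_eq_abs]
      refine (abs_add_le _ _).trans (add_le_add ?_ (h2 w (hDK hw)))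
      rw [abs_mul]
      exact mul_le_mul_of_nonneg_right (h1 w (hDK hw)) (abs_nonneg _)
    · exact (i0.abs.const_mul A).add (integrableOn_const hb.measure_lt_top.ne)
    · filter_upwards [ae_restrict_mem hD] with w hw
      have k1 : ContinuousWithinAt (fun s => a s w) U t :=
        (ha.comp (f := fun s => (s, w)) (s := U) (by fun_prop) fun s hs => ⟨hs, hDK hw⟩) t ht
      have k2 : ContinuousWithinAt (fun s => c s w) U t :=
        (hc.comp (f := fun s => (s, w)) (s := U) (by fun_prop) fun s hs => ⟨hs, hDK hw⟩) t ht
      exact (k1.mul_const _).add k2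
  have h2 : Tendsto (fun s => ∫ w in D, a s w * (log ‖zf s - w‖ - log ‖zf t - w‖)) (𝓝[U] t) (𝓝 0) := by
    set G : ℝ := 2 * (2 * π * 1 + volume.real D / 1) with hG
    have hlim : Tendsto (fun s => A * (‖zf s - zf t‖ * G)) (𝓝[U] t) (𝓝 0) := by
      have h0 := ((((hz t ht).tendsto.sub_const (zf t)).norm).mul_const G).const_mul A
      simpa using h0
    refine squeeze_zero_norm' ?_ hlim
    filter_upwards [hA, self_mem_nhdsWithin] with s h1 hs
    have is := (integrableOn_log_dist (zf s) hb).sub i0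
    refine (norm_integral_le_integral_norm _).trans ?_
    have e : ∫ w in D, A * |log ‖zf s - w‖ - log ‖zf t - w‖| ≤ A * (‖zf s - zf t‖ * G) := by
      rw [integral_const_mul A]
      exact mul_le_mul_of_nonneg_left (setIntegral_log_dist_sub_le hb _ _ one_pos) hA0
    refine le_trans (setIntegral_mono_on ?_ (is.abs.const_mul A) hD fun w hw => ?_) e
    · refine Integrable.norm (((ia s hs (zf s)).sub (ia s hs (zf t))).congr
        (Eventually.of_forall fun w => ?_))
      simp only [Pi.sub_apply]; ring
    · rw [Real.norm_eq_abs, abs_mul]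
      exact mul_le_mul_of_nonneg_right (h1 w (hDK hw)) (abs_nonneg _)
  have h3 := h1.tendsto.add h2
  rw [add_zero] at h3
  refine h3.congr' ?_
  filter_upwards [self_mem_nhdsWithin] with s hs
  have is : IntegrableOn (fun w => a s w * (log ‖zf s - w‖ - log ‖zf t - w‖)) D := by
    refine ((ia s hs (zf s)).sub (ia s hs (zf t))).congr (Eventually.of_forall fun w => ?_)
    simp only [Pi.sub_apply]; ring
  have is' : IntegrableOn (fun w => a s w * log ‖zf t - w‖ + c s w) D := (ia s hs _).add (ic s hs)
  rw [← integral_add is' is]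
  congr 1; ext w; ring

/-- The parameters for which the rescaled kernel is regular off the diagonal. -/
def regularSet : Set (ℝ × ℂ) := {p | 0 < p.1 ∧ p.1 < 1 / 8 ∧ 0 < px p.1 p.2}

lemma continuousOn_potential {D : Set ℂ} (hD : MeasurableSet D)
    (hDK : D ⊆ Metric.closedBall 0 2) :
    ContinuousOn (fun p : ℝ × ℂ => ∫ w in D, (-log ‖p.2 - w‖ + Rk p.1 p.2 w)) regularSet := by
  set K := Metric.closedBall (0 : ℂ) 2 with hK
  have hKc : IsCompact K := isCompact_closedBall _ _
  have hQ : ∀ q ∈ regularSet ×ˢ K, 0 < px q.1.1 q.1.2 * px q.1.1 q.2 := fun q hq => by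
    obtain ⟨⟨h1, h2, h3⟩, h4⟩ := hq
    refine mul_pos h3 ?_
    linarith [(px_bounds h1 (by linarith) (mem_closedBall_zero_iff.1 h4)).2.1]
  have cp1 : Continuous fun q : (ℝ × ℂ) × ℂ => px q.1.1 q.1.2 := by unfold px; fun_prop
  have cp2 : Continuous fun q : (ℝ × ℂ) × ℂ => px q.1.1 q.2 := by unfold px; fun_prop
  have cam : Continuous fun q : (ℝ × ℂ) × ℂ => am q.1.1 q.1.2 q.2 := by unfold am; fun_prop
  have cl : ContinuousOn (fun q : (ℝ × ℂ) × ℂ => log (px q.1.1 q.1.2 * px q.1.1 q.2))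
      (regularSet ×ˢ K) := ContinuousOn.log (by fun_prop) fun q hq => (hQ q hq).ne'
  have cd : ContinuousOn (fun q : (ℝ × ℂ) × ℂ => log q.1.1) (regularSet ×ˢ K) :=
    ContinuousOn.log (by fun_prop) fun q hq => hq.1.1.ne'
  have cb : ContinuousOn (fun q : (ℝ × ℂ) × ℂ =>
      bker (q.1.1 * ‖q.1.2 - q.2‖ / √(px q.1.1 q.1.2 * px q.1.1 q.2))) (regularSet ×ˢ K) :=
    continuous_bker.comp_continuousOn (ContinuousOn.div (by fun_prop) (by fun_prop)
      fun q hq => (sqrt_pos.2 (hQ q hq)).ne')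
  refine (continuousOn_log_integral (X := ℝ × ℂ) (zf := fun p => p.2)
    (a := fun p w => -am p.1 p.2 w)
    (c := fun p w => (am p.1 p.2 w - 1) * -log p.1 + am p.1 p.2 w * (log (px p.1 p.2 * px p.1 w) / 2) +
      (am p.1 p.2 w * bker (p.1 * ‖p.2 - w‖ / √(px p.1 p.2 * px p.1 w)) - bker 0) / 2)
    hD hKc hDK (by fun_prop) ?_ ?_).congr ?_
  · exact cam.neg.continuousOn
  · have cam' := cam.continuousOn (s := regularSet ×ˢ K)
    simp only [Function.uncurry_def]
    exact (((cam'.sub continuousOn_const).mul cd.neg).add (cam'.mul (cl.div_const 2))).add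
      (((cam'.mul cb).sub continuousOn_const).div_const 2)
  · intro p _
    simp only [Rk]
    congr 1; ext w; ring

lemma continuousOn_Uf {δ : ℝ} (h : Small δ) : ContinuousOn (Uf δ) {z | 0 < px δ z} := by
  have h1 := (continuousOn_potential h.adm.ms h.adm.subset_closedBall).comp
    (f := fun z : ℂ => (δ, z)) (s := {z | 0 < px δ z}) (by fun_prop)
    fun z hz => ⟨h.pos, by linarith [h.le], hz⟩
  exact (h1.add (continuousOn_const (c := cst δ * (π + I0 (etaF δ))))).congr fun z hz => (Uf_eq h hz).2

lemma etaF_tendsto {δ₁ : ℝ} (h : ∀ δ ∈ Set.Ioo 0 δ₁, Small δ) {δ : ℝ} (hδ : δ ∈ Set.Ioo 0 δ₁)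
    {e : ℝ} (he : 0 < e) : ∀ᶠ s in 𝓝[Set.Ioo 0 δ₁] δ, ∀ θ, |etaF s θ - etaF δ θ| ≤ e := by
  have hS := h δ hδ
  set η := etaF δ with hη
  have hA : Adm η := hS.adm
  have hc := (continuousOn_potential hA.ms hA.subset_closedBall).comp
    (f := fun p : ℝ × ℝ => (p.1, yb η p.2)) (s := Set.Ioo 0 δ₁ ×ˢ Set.Icc (-π) π)
    (by have := hA.continuous_yb; fun_prop) fun p hp => ⟨hp.1.1, by linarith [(h _ hp.1).le],
      by linarith [px_pos_of_norm_le (h _ hp.1) (norm_yb_le hA p.2)]⟩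
  have hS' : ContinuousOn (fun s θ => Sop (Rk s) s η θ).uncurry
      (Set.Ioo 0 δ₁ ×ˢ Set.Icc (-π) π) := by
    have c1 := hA.cont
    have c2 := hA.continuous_yb
    simp only [Function.uncurry_def, Sop, Phi, Xq]
    refine ContinuousOn.add (by fun_prop) (continuousOn_const.mul ?_)
    refine ContinuousOn.sub (ContinuousOn.add hc (by fun_prop)) (by fun_prop)
  obtain ⟨v, hv, hv'⟩ := isCompact_Icc.mem_uniformity_of_prod hS' hδ
    (Metric.dist_mem_uniformity (show 0 < e / 5 by positivity))
  filter_upwards [hv, self_mem_nhdsWithin] with s hs hsU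
  have hp : Function.Periodic (fun θ => |Sop (Rk s) s η θ - η θ|) (2 * π) := fun θ => by
    simp only [Sop]
    rw [hA.per, hA.periodic_yb]
  have := (h s hsU).etaF_spec.2.2 η hA (e / 5) fun θ => by
    obtain ⟨y, hy, hye⟩ := hp.exists_mem_Ico (by positivity) θ (-π)
    rw [hye]
    have hd := hv' s hs y ⟨hy.1, by linarith [hy.2]⟩
    have e1 : Sop (Rk δ) δ η y = η y := congrFun hS.etaF_spec.2.1 y
    change dist (Sop (Rk s) s η y) (Sop (Rk δ) δ η y) < e / 5 at hd
    rw [e1, Real.dist_eq] at hd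
    exact hd.le
  intro θ
  linarith [this θ]

/-- The rescaled circulation. -/
def circD (δ : ℝ) : ℝ := ∫ w in Df δ, px δ w

lemma integrableOn_px {η : ℝ → ℝ} (h : Adm η) (δ : ℝ) : IntegrableOn (px δ) (region η) :=
  ((continuous_px δ).continuousOn.integrableOn_compact (isCompact_closedBall 0 2)).mono_set
    h.subset_closedBall

lemma continuousOn_vf {δ₁ : ℝ} (h : ∀ δ ∈ Set.Ioo 0 δ₁, Small δ) :
    ContinuousOn vf (Set.Ioo 0 δ₁) := by
  have h1 : ContinuousOn (fun δ => I1 (etaF δ)) (Set.Ioo 0 δ₁) := by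
    intro δ hδ
    refine Metric.tendsto_nhds.2 fun e he => ?_
    filter_upwards [etaF_tendsto h hδ (show 0 < e / (4 * π) by positivity),
      self_mem_nhdsWithin] with s hs hsU
    have := intervalIntegral.norm_integral_le_of_norm_le_const (a := -π) (b := π)
      (f := fun t => (etaF s t - etaF δ t) * cos t) (C := e / (4 * π)) fun θ _ => by
        rw [norm_mul, Real.norm_eq_abs, Real.norm_eq_abs]
        exact (mul_le_of_le_one_right (abs_nonneg _) (abs_cos_le_one θ)).trans (hs θ)
    rw [Real.dist_eq, I1_sub (h s hsU).adm.cont (h δ hδ).adm.cont]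
    refine this.trans_lt ?_
    rw [abs_of_pos (by linarith [pi_pos] : 0 < π - -π)]
    have : e / (4 * π) * (π - -π) = e / 2 := by field_simp; norm_num
    linarith
  exact h1.div (by fun_prop) fun δ hδ => by have := hδ.1; positivity

lemma continuousOn_circD {δ₁ : ℝ} (h : ∀ δ ∈ Set.Ioo 0 δ₁, Small δ) :
    ContinuousOn circD (Set.Ioo 0 δ₁) := by
  intro δ hδ
  refine Metric.tendsto_nhds.2 fun e he => ?_
  have hd : Tendsto (fun s : ℝ => |s - δ| * 2 * (4 * π)) (𝓝[Set.Ioo 0 δ₁] δ) (𝓝 0) := by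
    have : Continuous (fun s : ℝ => |s - δ| * 2 * (4 * π)) := by fun_prop
    have h0 := this.tendsto δ
    simp only [sub_self, abs_zero, zero_mul] at h0
    exact tendsto_nhdsWithin_of_tendsto_nhds h0
  filter_upwards [etaF_tendsto h hδ (show 0 < e / (8 * π) by positivity),
    self_mem_nhdsWithin, hd.eventually_lt_const (half_pos he)] with s hs hsU hsd
  have hA := (h s hsU).adm
  have hB := (h δ hδ).adm
  have a1 := abs_setIntegral_sub_le hA.ms hB.ms (integrableOn_px hA s) (integrableOn_px hB s)
  have a2 : ∫ w in region (etaF s) ∆ region (etaF δ), |px s w| ≤ 2 * (2 * π * (e / (8 * π))) := by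
    have hsub : region (etaF s) ∆ region (etaF δ) ⊆ Metric.closedBall 0 2 :=
      symmDiff_le_sup.trans (Set.union_subset hA.subset_closedBall hB.subset_closedBall)
    have hm := hA.ms.symmDiff hB.ms
    have hfin : volume (region (etaF s) ∆ region (etaF δ)) ≠ ⊤ :=
      (Metric.isBounded_closedBall.subset hsub).measure_lt_top.ne
    have i1 : IntegrableOn (fun w => |px s w|) (region (etaF s) ∆ region (etaF δ)) :=
      (((continuous_px s).abs.continuousOn.integrableOn_compact
        (isCompact_closedBall 0 2))).mono_set hsub
    have := setIntegral_mono_on i1 (integrableOn_const (C := (2 : ℝ)) hfin) hm fun w hw => by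
      have hw2 := mem_closedBall_zero_iff.1 (hsub hw)
      obtain ⟨-, k1, k2⟩ := px_bounds (h s hsU).pos (by linarith [(h s hsU).le]) hw2
      rw [abs_of_pos (by linarith)]; linarith
    rw [setIntegral_const, smul_eq_mul] at this
    have := volume_real_symmDiff_region hA.meas hB.meas hA.bd8 hB.bd8 hs
    linarith
  have a3 : |(∫ w in region (etaF δ), px s w) - ∫ w in region (etaF δ), px δ w| ≤
      |s - δ| * 2 * (4 * π) := by
    rw [← integral_sub (integrableOn_px hB s) (integrableOn_px hB δ)]
    have := norm_setIntegral_le_of_norm_le_const (μ := volume) (C := |s - δ| * 2)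
      (f := fun w => px s w - px δ w) hB.bounded.measure_lt_top fun w hw => by
        have hw2 := mem_closedBall_zero_iff.1 (hB.subset_closedBall hw)
        rw [show px s w - px δ w = (s - δ) * w.re by unfold px; ring, norm_mul]
        exact mul_le_mul_of_nonneg_left ((Complex.abs_re_le_norm w).trans hw2) (norm_nonneg _)
    exact this.trans (mul_le_mul_of_nonneg_left hB.volume_le (by positivity))
  have a4 : 2 * (2 * π * (e / (8 * π))) = e / 2 := by field_simp; norm_num
  rw [Real.dist_eq, circD, circD, Df, Df]
  rw [abs_le] at a1 a3
  rw [abs_lt]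
  constructor <;> linarith [a1.1, a1.2, a3.1, a3.2]

lemma tendsto_circD : Tendsto circD (𝓝[>] 0) (𝓝 π) := by
  have hd : Tendsto (fun δ : ℝ => δ * 2 * (4 * π)) (𝓝[>] 0) (𝓝 0) := by
    have : Continuous (fun s : ℝ => s * 2 * (4 * π)) := by fun_prop
    have h0 := this.tendsto 0
    simp only [zero_mul] at h0
    exact tendsto_nhdsWithin_of_tendsto_nhds h0
  have h : Tendsto (fun δ => circD δ - volD δ) (𝓝[>] 0) (𝓝 0) := by
    refine squeeze_zero_norm' ?_ hd
    filter_upwards [eventually_small] with δ h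
    have hA := h.adm
    have i1 : IntegrableOn (fun _ : ℂ => (1 : ℝ)) (region (etaF δ)) :=
      integrableOn_const hA.bounded.measure_lt_top.ne
    have e : volD δ = ∫ w in region (etaF δ), (1 : ℝ) := by
      rw [setIntegral_const, smul_eq_mul, mul_one, volume_real_region hA, volD]
    rw [e, circD, Df, ← integral_sub (integrableOn_px hA δ) i1]
    have := norm_setIntegral_le_of_norm_le_const (μ := volume) (C := δ * 2)
      (f := fun w => px δ w - 1) hA.bounded.measure_lt_top fun w hw => by
        have hw2 := mem_closedBall_zero_iff.1 (hA.subset_closedBall hw)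
        rw [show px δ w - 1 = δ * w.re by unfold px; ring, norm_mul, Real.norm_eq_abs,
          abs_of_pos h.pos]
        exact mul_le_mul_of_nonneg_left ((Complex.abs_re_le_norm w).trans hw2) h.pos.le
    exact this.trans (mul_le_mul_of_nonneg_left hA.volume_le (by linarith [h.pos]))
  have := h.add tendsto_volD
  simpa using this

lemma exists_uniform_core : ∃ δ₁ : ℝ, 0 < δ₁ ∧ ∀ δ ∈ Set.Ioo 0 δ₁, Small δ ∧ 0 < mf δ ∧
    ∀ z, 0 < px δ z → (mf δ < Uf δ z - vf δ * px δ z ^ 2 ↔ z ∈ Df δ) := by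
  obtain ⟨M, hM, hf⟩ := eventually_far
  obtain ⟨δ₁, h0, h⟩ := mem_nhdsGT_iff_exists_Ioo_subset.1 (hf.and (eventually_near hM))
  refine ⟨δ₁, h0, fun δ hδ => ?_⟩
  obtain ⟨⟨h1, h2, h3⟩, -, h4⟩ := h hδ
  refine ⟨h1, h2, fun z hz => ?_⟩
  rcases le_or_gt ‖z‖ M with hzM | hzM
  · exact (h4 z hzM).2
  · refine iff_of_false (not_lt.2 (h3 z hzM hz)) fun hm => ?_
    linarith [h1.norm_le hm]

/-- The similarity `z ↦ (s + c re z, c im z)` from `ℂ` onto the plane. -/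
def place (s c : ℝ) (hc : c ≠ 0) : ℂ ≃ₜ Plane :=
  (Homeomorph.smulOfNeZero c hc).trans ((Homeomorph.addLeft (s : ℂ)).trans
    Complex.orthonormalBasisOneI.repr.toHomeomorph)

section
variable {s c : ℝ} {hc : c ≠ 0}

lemma place_apply (z : ℂ) : place s c hc z = Complex.orthonormalBasisOneI.repr ((s : ℂ) + c • z) := rfl

lemma place_zero (z : ℂ) : place s c hc z 0 = s + c * z.re := by
  rw [place_apply, Complex.orthonormalBasisOneI_repr_apply]
  simp

lemma place_one (z : ℂ) : place s c hc z 1 = c * z.im := by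
  rw [place_apply, Complex.orthonormalBasisOneI_repr_apply]
  simp

lemma dist_place (z w : ℂ) : dist (place s c hc z) (place s c hc w) = |c| * ‖z - w‖ := by
  rw [place_apply, place_apply, LinearIsometryEquiv.dist_map, dist_add_left, dist_eq_norm, ← smul_sub,
    norm_smul, Real.norm_eq_abs]

lemma setIntegral_place (f : Plane → ℝ) {D : Set ℂ} (hD : MeasurableSet D) :
    ∫ x in place s c hc '' D, f x = c ^ 2 * ∫ z in D, f (place s c hc z) := by
  have hA : MeasurableSet (place s c hc '' D) :=
    (place s c hc).measurableEmbedding.measurableSet_image.2 hD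
  have h1 : ∫ x, (place s c hc '' D).indicator f x =
      ∫ u : ℂ, (place s c hc '' D).indicator f (Complex.orthonormalBasisOneI.repr u) :=
    ((OrthonormalBasis.measurePreserving_repr Complex.orthonormalBasisOneI).integral_comp
      Complex.orthonormalBasisOneI.repr.toHomeomorph.measurableEmbedding _).symm
  have h2 := integral_add_left_eq_self (μ := (volume : Measure ℂ))
    (fun u => (place s c hc '' D).indicator f (Complex.orthonormalBasisOneI.repr u)) (s : ℂ)
  have h3 := Measure.integral_comp_smul (volume : Measure ℂ)
    (fun u => (place s c hc '' D).indicator f (Complex.orthonormalBasisOneI.repr ((s : ℂ) + u))) c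
  have h4 : ∀ z, (place s c hc '' D).indicator f (Complex.orthonormalBasisOneI.repr ((s : ℂ) + c • z)) =
      D.indicator (fun z => f (place s c hc z)) z := fun z => by
    rw [← place_apply (hc := hc)]
    by_cases hz : z ∈ D
    · rw [Set.indicator_of_mem hz, Set.indicator_of_mem (Set.mem_image_of_mem _ hz)]
    · rw [Set.indicator_of_notMem hz, Set.indicator_of_notMem]
      rwa [(place s c hc).injective.mem_set_image]
  simp_rw [h4] at h3
  rw [integral_indicator hD, h2, ← h1, integral_indicator hA, Complex.finrank_real_complex,
    smul_eq_mul, abs_of_nonneg (by positivity)] at h3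
  rw [h3, ← mul_assoc, mul_inv_cancel₀ (pow_ne_zero 2 hc), one_mul]

end

lemma gk_smul {s P Q d : ℝ} (hs : 0 < s) : gk (s * P) (s * Q) (s * d) = s ^ 2 * gk P Q d := by
  have h1 : √(s * P * (s * Q)) = s * √(P * Q) := by
    rw [show s * P * (s * Q) = s ^ 2 * (P * Q) by ring, sqrt_mul (sq_nonneg s), sqrt_sq hs.le]
  rw [gk, h1, mul_div_mul_left _ _ hs.ne', sqrt_mul hs.le, sqrt_mul hs.le, gk]
  rw [show √s * √P * (s * Q * (√s * √Q)) = (√s * √s) * s * (√P * (Q * √Q)) by ring,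
    mul_self_sqrt hs.le]
  ring

lemma Gstar_mk2_neg (a b : ℝ) {x' y' : Plane} (h0 : x' 0 = y' 0) (h1 : x' 1 = -y' 1) :
    Gstar (mk2 a (-b)) x' = Gstar (mk2 a b) y' := by
  simp only [Gstar, mk2, h0, h1]
  simp only [WithLp.equiv_symm_apply, PiLp.toLp_apply, Matrix.cons_val_zero, Matrix.cons_val_one,
    Matrix.cons_val_fin_one, Fin.isValue]
  congr! 5
  ring

lemma half_ball_subset_Df {δ : ℝ} (h : Small δ) {z : ℂ} (hz : ‖z‖ ≤ 1 / 2) : z ∈ Df δ := by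
  change ‖z‖ ^ 2 < 1 + 2 * etaF δ z.arg
  have := (abs_le.1 (h.adm.bd8 z.arg)).1
  nlinarith [norm_nonneg z]

lemma starConvex_Df {δ : ℝ} (h : Small δ) : StarConvex ℝ 0 (Df δ) := by
  rw [starConvex_zero_iff]
  intro z hz t ht0 ht1
  rcases ht0.eq_or_lt with rfl | ht
  · rw [zero_smul]
    exact half_ball_subset_Df h (by norm_num)
  · change ‖t • z‖ ^ 2 < 1 + 2 * etaF δ (t • z).arg
    rw [Complex.real_smul, Complex.arg_real_mul z ht, norm_mul, Complex.norm_real, norm_of_nonneg ht0]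
    have h1 : ‖z‖ ^ 2 < 1 + 2 * etaF δ z.arg := hz
    have h2 : (t * ‖z‖) ^ 2 ≤ ‖z‖ ^ 2 := by
      refine pow_le_pow_left₀ (by positivity) ?_ 2
      exact mul_le_of_le_one_left (norm_nonneg z) ht1
    linarith

/-- The physical core obtained from the rescaled core. -/
def ringCore (s c : ℝ) (δ : ℝ) : Set Plane :=
  (fun z => Complex.orthonormalBasisOneI.repr ((s : ℂ) + c • z)) '' Df δ

lemma ringCore_eq {s c δ : ℝ} (hc : c ≠ 0) : ringCore s c δ = place s c hc '' Df δ := rfl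

/-- The stream function generated by the physical core. -/
def ringPsi (ε s c δ : ℝ) (x : Plane) : ℝ := (∫ x' in ringCore s c δ, Gstar x x') / ε ^ 2

/-- The parameters of a rescaled ring satisfy the circulation and the speed constraints. -/
structure RingParams (κ W ε s t : ℝ) : Prop where
  eps_pos : 0 < ε
  s_pos : 0 < s
  t_pos : 0 < t
  small : Small (ε * t)
  m_pos : 0 < mf (ε * t)
  core : ∀ z, 0 < px (ε * t) z →
    (mf (ε * t) < Uf (ε * t) z - vf (ε * t) * px (ε * t) z ^ 2 ↔ z ∈ Df (ε * t))
  circ : t ^ 2 * s ^ 3 * circD (ε * t) = κ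
  speed : s ^ 2 * t ^ 2 * vf (ε * t) = π * (W * log (1 / ε))

lemma Gstar_place {s δ : ℝ} (hs : 0 < s) (h : Small δ) (hc : s * δ ≠ 0) {z w : ℂ}
    (hz : 0 < px δ z) (hw : 0 < px δ w) (hne : z ≠ w) :
    Gstar (place s (s * δ) hc z) (place s (s * δ) hc w) = s ^ 2 / (2 * π) * kd δ z w := by
  have e : ∀ z, place s (s * δ) hc z 0 = s * px δ z := fun z => by rw [place_zero, px]; ring
  have h1 := Gstar_eq_gk (place s (s * δ) hc z) (place s (s * δ) hc w) (by rw [e]; positivity)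
    (by rw [e]; positivity) ((place s (s * δ) hc).injective.ne hne)
  rw [e, e, dist_place, abs_of_pos (mul_pos hs h.pos), mul_assoc s δ, gk_smul hs] at h1
  rw [kd]
  field_simp
  linarith

namespace RingParams

variable {κ W ε s t : ℝ}

lemma c_ne (h : RingParams κ W ε s t) :
    s * (ε * t) ≠ 0 := (mul_pos h.s_pos (mul_pos h.eps_pos h.t_pos)).ne'

lemma c_pos (h : RingParams κ W ε s t) :
    0 < s * (ε * t) := mul_pos h.s_pos (mul_pos h.eps_pos h.t_pos)

lemma measurableSet_Df (h : RingParams κ W ε s t) :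
    MeasurableSet (Df (ε * t)) := h.small.adm.ms

lemma setIntegral_conj (h : RingParams κ W ε s t) (f : ℂ → ℝ) : ∫ w in Df (ε * t), f w = ∫ w in Df (ε * t), f (conj w) :=
  (h.small.adm.setIntegral_conj f).symm

lemma place_zero_eq (h : RingParams κ W ε s t) (z : ℂ) : place s (s * (ε * t)) h.c_ne z 0 = s * px (ε * t) z := by
  rw [place_zero, px]; ring

lemma ringPsi_place (h : RingParams κ W ε s t) {z : ℂ} (hz : 0 < px (ε * t) z) :
    ringPsi ε s (s * (ε * t)) (ε * t) (place s (s * (ε * t)) h.c_ne z) =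
      s ^ 4 * t ^ 2 / (2 * π) * Uf (ε * t) z := by
  have hε := h.eps_pos.ne'
  have e : ∫ w in Df (ε * t), Gstar (place s (s * (ε * t)) h.c_ne z) (place s (s * (ε * t)) h.c_ne w) =
      ∫ w in Df (ε * t), s ^ 2 / (2 * π) * kd (ε * t) z w := by
    refine integral_congr_ae ?_
    filter_upwards [ae_restrict_of_ae (ae_ne_pair z z volume), ae_restrict_mem h.small.adm.ms]
      with w hw hw'
    exact Gstar_place h.s_pos h.small h.c_ne hz
      (by linarith [px_pos_of_norm_le h.small (h.small.norm_le hw')]) hw.1.symm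
  rw [ringPsi, ringCore_eq h.c_ne, setIntegral_place _ h.measurableSet_Df]
  rw [e, integral_const_mul, Uf]
  field_simp

lemma crossSection_eq (h : RingParams κ W ε s t) :
    crossSection (ringPsi ε s (s * (ε * t)) (ε * t)) ε W
    (s ^ 4 * t ^ 2 / (2 * π) * mf (ε * t)) = ringCore s (s * (ε * t)) (ε * t) := by
  ext x
  obtain ⟨z, rfl⟩ := (place s (s * (ε * t)) h.c_ne).surjective x
  rw [ringCore_eq h.c_ne, (place s (s * (ε * t)) h.c_ne).injective.mem_set_image]
  have hs := h.s_pos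
  have ht := h.t_pos
  change 0 < place s (s * (ε * t)) h.c_ne z 0 ∧ _ ↔ _
  rw [h.place_zero_eq, mul_pos_iff_of_pos_left h.s_pos]
  constructor
  · rintro ⟨hz, h1⟩
    refine (h.core z hz).1 ?_
    rw [h.ringPsi_place hz, show W / 2 * (s * px (ε * t) z) ^ 2 * log (1 / ε) =
      s ^ 2 / (2 * π) * px (ε * t) z ^ 2 * (π * (W * log (1 / ε))) by field_simp, ← h.speed] at h1
    refine lt_of_mul_lt_mul_left (a := s ^ 4 * t ^ 2 / (2 * π)) ?_ (by positivity)
    refine h1.trans_le (le_of_eq ?_)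
    ring
  · intro hz
    have hp : 0 < px (ε * t) z := by linarith [px_pos_of_norm_le h.small (h.small.norm_le hz)]
    refine ⟨hp, ?_⟩
    have h1 := mul_lt_mul_of_pos_left ((h.core z hp).2 hz)
      (by positivity : 0 < s ^ 4 * t ^ 2 / (2 * π))
    rw [h.ringPsi_place hp, show W / 2 * (s * px (ε * t) z) ^ 2 * log (1 / ε) =
      s ^ 2 / (2 * π) * px (ε * t) z ^ 2 * (π * (W * log (1 / ε))) by field_simp, ← h.speed]
    refine h1.trans_le (le_of_eq ?_)
    ring

lemma ringCore_subset (h : RingParams κ W ε s t) :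
    ringCore s (s * (ε * t)) (ε * t) ⊆ place s (s * (ε * t)) h.c_ne '' Metric.closedBall 0 2 :=
  Set.image_mono h.small.adm.subset_closedBall

lemma isCompact_place_closedBall (h : RingParams κ W ε s t) :
    IsCompact (place s (s * (ε * t)) h.c_ne '' Metric.closedBall 0 2) :=
  (isCompact_closedBall 0 2).image (place s (s * (ε * t)) h.c_ne).continuous

lemma continuousOn_ringPsi (h : RingParams κ W ε s t) :
    ContinuousOn (ringPsi ε s (s * (ε * t)) (ε * t)) halfPlane := by
  have h1 := (continuousOn_Uf h.small).const_smul (s ^ 4 * t ^ 2 / (2 * π))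
  have hP : ∀ x ∈ halfPlane, 0 < px (ε * t) ((place s (s * (ε * t)) h.c_ne).symm x) := fun x hx => by
    have h2 := h.place_zero_eq ((place s (s * (ε * t)) h.c_ne).symm x)
    rw [Homeomorph.apply_symm_apply] at h2
    have h3 : 0 < x 0 := hx
    rw [h2] at h3
    exact (mul_pos_iff_of_pos_left h.s_pos).1 h3
  refine (h1.comp (place s (s * (ε * t)) h.c_ne).symm.continuous.continuousOn hP).congr
    fun x hx => ?_
  have h2 := h.ringPsi_place (hP x hx)
  rw [Homeomorph.apply_symm_apply] at h2
  rw [h2]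
  rfl

lemma isVortexRingStream (h : RingParams κ W ε s t) :
    IsVortexRingStream (ringPsi ε s (s * (ε * t)) (ε * t)) ε W
    (s ^ 4 * t ^ 2 / (2 * π) * mf (ε * t)) where
  continuousOn := h.continuousOn_ringPsi
  bounded := by
    rw [h.crossSection_eq]
    exact h.isCompact_place_closedBall.isBounded.subset h.ringCore_subset
  closure_subset := by
    rw [h.crossSection_eq]
    refine (closure_minimal h.ringCore_subset h.isCompact_place_closedBall.isClosed).trans ?_
    rintro _ ⟨z, hz, rfl⟩
    change 0 < place s (s * (ε * t)) h.c_ne z 0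
    rw [h.place_zero_eq]
    exact mul_pos h.s_pos (by linarith [px_pos_of_norm_le h.small (mem_closedBall_zero_iff.1 hz)])
  repr := fun x _ => by rw [h.crossSection_eq, ringPsi]

lemma centralized (h : RingParams κ W ε s t) :
    Centralized (ringPsi ε s (s * (ε * t)) (ε * t)) := by
  intro a b
  rw [ringPsi, ringPsi, ringCore_eq h.c_ne, setIntegral_place _ h.measurableSet_Df,
    setIntegral_place _ h.measurableSet_Df, h.setIntegral_conj]
  congr 3
  ext w
  refine Gstar_mk2_neg a b ?_ ?_
  · rw [place_zero, place_zero, Complex.conj_re]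
  · rw [place_one, place_one, Complex.conj_im]; ring

lemma isOpen_Df (h : RingParams κ W ε s t) :
    IsOpen (Df (ε * t)) := by
  have ho : IsOpen {z | 0 < px (ε * t) z} := isOpen_lt continuous_const (continuous_px _)
  have hc : ContinuousOn (fun z => Uf (ε * t) z - vf (ε * t) * px (ε * t) z ^ 2)
      {z | 0 < px (ε * t) z} := by
    have := continuous_px (ε * t)
    exact (continuousOn_Uf h.small).sub (by fun_prop)
  have h1 := hc.isOpen_inter_preimage ho (isOpen_Ioi (a := mf (ε * t)))
  convert h1 using 1
  ext z
  constructor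
  · intro hz
    have hp : 0 < px (ε * t) z := by linarith [px_pos_of_norm_le h.small (h.small.norm_le hz)]
    exact ⟨hp, (h.core z hp).2 hz⟩
  · rintro ⟨hp, hz⟩
    exact (h.core z hp).1 hz

lemma isOpen_ringCore (h : RingParams κ W ε s t) :
    IsOpen (ringCore s (s * (ε * t)) (ε * t)) :=
  (place s (s * (ε * t)) h.c_ne).isOpenMap _ h.isOpen_Df

lemma nonempty_Df (h : RingParams κ W ε s t) :
    (Df (ε * t)).Nonempty := ⟨0, half_ball_subset_Df h.small (by norm_num)⟩

lemma simplyConnectedSpace_ringCore (h : RingParams κ W ε s t) :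
    SimplyConnectedSpace (ringCore s (s * (ε * t)) (ε * t)) := by
  have := (starConvex_Df h.small).contractibleSpace h.nonempty_Df
  have : ContractibleSpace (ringCore s (s * (ε * t)) (ε * t)) :=
    ((place s (s * (ε * t)) h.c_ne).image (Df (ε * t))).symm.contractibleSpace
  infer_instance

lemma circulation_eq (h : RingParams κ W ε s t) :
    circulation (ringPsi ε s (s * (ε * t)) (ε * t)) ε W
    (s ^ 4 * t ^ 2 / (2 * π) * mf (ε * t)) = κ := by
  have hε := h.eps_pos.ne'
  rw [circulation, h.crossSection_eq, ringCore_eq h.c_ne, setIntegral_place _ h.measurableSet_Df]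
  simp_rw [h.place_zero_eq]
  rw [integral_const_mul, ← h.circ, circD]
  field_simp

lemma le_diam (h : RingParams κ W ε s t) :
    s * (ε * t) ≤ Metric.diam (ringCore s (s * (ε * t)) (ε * t)) := by
  have hb := h.isCompact_place_closedBall.isBounded.subset h.ringCore_subset
  have hm : ∀ r : ℝ, |r| ≤ 1 / 2 → place s (s * (ε * t)) h.c_ne (r : ℂ) ∈
      ringCore s (s * (ε * t)) (ε * t) := fun r hr =>
    Set.mem_image_of_mem _ (half_ball_subset_Df h.small (by rwa [Complex.norm_real]))
  have := Metric.dist_le_diam_of_mem hb (hm (1 / 2) (by norm_num)) (hm (-(1 / 2)) (by norm_num))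
  rw [dist_place, abs_of_pos h.c_pos, ← Complex.ofReal_sub, Complex.norm_real] at this
  norm_num at this
  exact this

lemma diam_le (h : RingParams κ W ε s t) :
    Metric.diam (ringCore s (s * (ε * t)) (ε * t)) ≤ 4 * (s * (ε * t)) := by
  refine Metric.diam_le_of_forall_dist_le (by linarith [h.c_pos]) ?_
  rintro _ ⟨z, hz, rfl⟩ _ ⟨w, hw, rfl⟩
  change dist (place s (s * (ε * t)) h.c_ne z) (place s (s * (ε * t)) h.c_ne w) ≤ _
  rw [dist_place, abs_of_pos h.c_pos]
  have := norm_sub_le z w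
  have := h.small.norm_le hz
  have := h.small.norm_le hw
  nlinarith [h.c_pos]

lemma dist_le (h : RingParams κ W ε s t) {x : Plane} (hx : x ∈ ringCore s (s * (ε * t)) (ε * t)) (r : ℝ) :
    dist x (mk2 r 0) ≤ |s - r| + 2 * (s * (ε * t)) := by
  obtain ⟨z, hz, rfl⟩ := hx
  change dist (place s (s * (ε * t)) h.c_ne z) (mk2 r 0) ≤ _
  have e : mk2 r 0 = Complex.orthonormalBasisOneI.repr (r : ℂ) := by
    ext i
    fin_cases i <;> simp [mk2]
  rw [e, place_apply, LinearIsometryEquiv.dist_map, dist_eq_norm,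
    show (s : ℂ) + (s * (ε * t)) • z - r = ((s - r : ℝ) : ℂ) + (s * (ε * t)) • z by push_cast; ring]
  refine (norm_add_le _ _).trans (add_le_add (by rw [Complex.norm_real, Real.norm_eq_abs]) ?_)
  rw [norm_smul, Real.norm_eq_abs, abs_of_pos h.c_pos, mul_comm]
  exact mul_le_mul_of_nonneg_right (h.small.norm_le hz) h.c_pos.le

end RingParams

lemma tendsto_mul_bounded {τ : ℝ → ℝ} {a b : ℝ} (ha : 0 < a)
    (hτ : ∀ᶠ ε in 𝓝[>] (0 : ℝ), τ ε ∈ Set.Icc a b) :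
    Tendsto (fun ε => ε * τ ε) (𝓝[>] 0) (𝓝[>] 0) := by
  have hd : Tendsto (fun ε : ℝ => ε) (𝓝[>] 0) (𝓝 0) := tendsto_nhdsWithin_of_tendsto_nhds tendsto_id
  refine tendsto_nhdsWithin_iff.2 ⟨?_, ?_⟩
  · have := hd.mul_const b
    rw [zero_mul] at this
    refine squeeze_zero' ?_ ?_ this
    · filter_upwards [hτ, self_mem_nhdsWithin] with ε h1 (h2 : 0 < ε)
      exact mul_nonneg h2.le (ha.le.trans h1.1)
    · filter_upwards [hτ, self_mem_nhdsWithin] with ε h1 (h2 : 0 < ε)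
      exact mul_le_mul_of_nonneg_left h1.2 h2.le
  · filter_upwards [hτ, self_mem_nhdsWithin] with ε h1 (h2 : 0 < ε)
    exact mul_pos h2 (ha.trans_le h1.1)

lemma tendsto_vf_mul {τ : ℝ → ℝ} {a b : ℝ} (ha : 0 < a)
    (hτ : ∀ᶠ ε in 𝓝[>] (0 : ℝ), τ ε ∈ Set.Icc a b) :
    Tendsto (fun ε => vf (ε * τ ε) / -log ε) (𝓝[>] 0) (𝓝 (π / 4)) := by
  have hm := tendsto_mul_bounded ha hτ
  have h1 := tendsto_vf.comp hm
  have h2 : Tendsto (fun ε => -log (τ ε) / -log ε) (𝓝[>] 0) (𝓝 0) := by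
    have hB := tendsto_L.const_div_atTop (max |log a| |log b|)
    refine squeeze_zero_norm' ?_ hB
    filter_upwards [hτ, tendsto_L.eventually_gt_atTop 0] with ε h3 h4
    rw [norm_div, Real.norm_eq_abs, Real.norm_eq_abs, abs_of_pos h4, abs_neg]
    refine div_le_div_of_nonneg_right ?_ h4.le
    exact abs_le_max_abs_abs (log_le_log ha h3.1) (log_le_log (ha.trans_le h3.1) h3.2)
  have h3 := h1.mul (h2.const_add 1)
  rw [add_zero, mul_one] at h3
  refine h3.congr' ?_
  filter_upwards [hτ, self_mem_nhdsWithin, tendsto_L.eventually_gt_atTop 0,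
    (tendsto_L.comp hm).eventually_gt_atTop 0] with ε h4 (h5 : 0 < ε) h6 h7
  have h8 : 0 < τ ε := ha.trans_le h4.1
  simp only [Function.comp_apply] at h7 ⊢
  have e : 1 + -log (τ ε) / -log ε = -log (ε * τ ε) / -log ε := by
    rw [log_mul h5.ne' h8.ne', eq_div_iff h6.ne', add_mul, div_mul_cancel₀ _ h6.ne']
    ring
  rw [e, div_mul_div_cancel₀ h7.ne']

lemma exists_ringParams {κ W : ℝ} (hκ : 0 < κ) (hW : 0 < W) : ∃ a b : ℝ, 0 < a ∧ a < b ∧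
    ∀ᶠ ε in 𝓝[>] (0 : ℝ), ∃ s, ∃ t ∈ Set.Icc a b, RingParams κ W ε s t := by
  set t₀ : ℝ := π * (8 * √(W ^ 3)) / κ with ht₀
  have hpi := pi_pos
  have ht0 : 0 < t₀ := by positivity
  have ht2 : (κ / π) ^ 2 * t₀ ^ 2 * (1 / 4) ^ 3 = W ^ 3 := by
    have : (κ / π) ^ 2 * t₀ ^ 2 * (1 / 4) ^ 3 = √(W ^ 3) ^ 2 := by
      rw [ht₀]; field_simp; norm_num
    rw [this, sq_sqrt (by positivity)]
  refine ⟨t₀ / 2, 2 * t₀, by positivity, by linarith, ?_⟩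
  obtain ⟨δ₁, hδ₁, hcore⟩ := exists_uniform_core
  obtain ⟨δ₂, hδ₂, hcirc⟩ := mem_nhdsGT_iff_exists_Ioo_subset.1
    (tendsto_circD.eventually_const_lt (u := 3) pi_gt_three)
  set F : ℝ → ℝ → ℝ := fun ε t => (κ / circD (ε * t)) ^ 2 * t ^ 2 * (vf (ε * t) / π) ^ 3 with hF
  have hlim : ∀ t, 0 < t → Tendsto (fun ε => F ε t / (-log ε) ^ 3) (𝓝[>] 0)
      (𝓝 ((κ / π) ^ 2 * t ^ 2 * (1 / 4) ^ 3)) := by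
    intro t ht
    have hτ : ∀ᶠ ε in 𝓝[>] (0 : ℝ), (fun _ => t) ε ∈ Set.Icc t t :=
      Eventually.of_forall fun _ => ⟨le_rfl, le_rfl⟩
    have h1 := tendsto_circD.comp (tendsto_mul_bounded ht hτ)
    have h2 := tendsto_vf_mul ht hτ
    have h3 := ((((tendsto_const_nhds (x := κ)).div h1 pi_ne_zero).pow 2).mul_const (t ^ 2)).mul ((h2.div_const π).pow 3)
    rw [show π / 4 / π = 1 / 4 by field_simp] at h3
    refine h3.congr fun ε => ?_
    simp only [hF, Function.comp_apply, Pi.div_apply]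
    ring
  have la := hlim (t₀ / 2) (by positivity)
  have lb := hlim (2 * t₀) (by positivity)
  have hW3 : 0 < W ^ 3 := by positivity
  have hd : Tendsto (fun ε : ℝ => ε * (2 * t₀)) (𝓝[>] 0) (𝓝 0) := by
    have : Continuous (fun s : ℝ => s * (2 * t₀)) := by fun_prop
    have h0 := this.tendsto 0
    simp only [zero_mul] at h0
    exact tendsto_nhdsWithin_of_tendsto_nhds h0
  filter_upwards [la.eventually_lt_const (u := W ^ 3)
      (by rw [← ht2]; refine mul_lt_mul_of_pos_right (mul_lt_mul_of_pos_left ?_ (by positivity))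
            (by norm_num); nlinarith),
    lb.eventually_const_lt (u := W ^ 3)
      (by rw [← ht2]; refine mul_lt_mul_of_pos_right (mul_lt_mul_of_pos_left ?_ (by positivity))
            (by norm_num); nlinarith),
    hd.eventually_lt_const (lt_min hδ₁ hδ₂), self_mem_nhdsWithin,
    tendsto_L.eventually_gt_atTop 0] with ε ha hb hε hε0 hL
  have hε0 : 0 < ε := hε0
  have hmem : ∀ t ∈ Set.Icc (t₀ / 2) (2 * t₀), 0 < t ∧ ε * t ∈ Set.Ioo 0 δ₁ ∧ ε * t ∈ Set.Ioo 0 δ₂ := by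
    intro t ht
    have h0 : 0 < t := by linarith [ht.1]
    have h1 : ε * t < min δ₁ δ₂ := (mul_le_mul_of_nonneg_left ht.2 hε0.le).trans_lt hε
    exact ⟨h0, ⟨mul_pos hε0 h0, h1.trans_le (min_le_left _ _)⟩,
      ⟨mul_pos hε0 h0, h1.trans_le (min_le_right _ _)⟩⟩
  have hc0 : ∀ t ∈ Set.Icc (t₀ / 2) (2 * t₀), 3 < circD (ε * t) := fun t ht =>
    hcirc (hmem t ht).2.2
  have hS : ∀ δ ∈ Set.Ioo 0 δ₁, Small δ := fun δ hδ => (hcore δ hδ).1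
  have hm : Set.MapsTo (fun t => ε * t) (Set.Icc (t₀ / 2) (2 * t₀)) (Set.Ioo 0 δ₁) :=
    fun t ht => (hmem t ht).2.1
  have cc := (continuousOn_circD hS).comp (by fun_prop) hm
  have cv := (continuousOn_vf hS).comp (by fun_prop) hm
  have cF : ContinuousOn (F ε) (Set.Icc (t₀ / 2) (2 * t₀)) := by
    refine ContinuousOn.mul (ContinuousOn.mul (ContinuousOn.pow (continuousOn_const.div cc
      fun t ht => ?_) 2) (by fun_prop)) ((cv.div_const π).pow 3)
    exact (by linarith [hc0 t ht] : (0:ℝ) < circD (ε * t)).ne'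
  rw [div_lt_iff₀ (by positivity)] at ha
  rw [lt_div_iff₀ (by positivity)] at hb
  obtain ⟨t, ht, hFt⟩ := intermediate_value_Icc (by linarith) cF ⟨ha.le, hb.le⟩
  obtain ⟨t0, hδ, -⟩ := hmem t ht
  obtain ⟨hs, hmf, hiff⟩ := hcore _ hδ
  have hcpos : 0 < circD (ε * t) := by linarith [hc0 t ht]
  have hq : 0 < κ / (circD (ε * t) * t ^ 2) := by positivity
  obtain ⟨s, hs0, hs3⟩ : ∃ s : ℝ, 0 < s ∧ s ^ 3 = κ / (circD (ε * t) * t ^ 2) := by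
    refine ⟨(κ / (circD (ε * t) * t ^ 2)) ^ (1 / 3 : ℝ), rpow_pos_of_pos hq _, ?_⟩
    rw [← rpow_natCast, ← rpow_mul hq.le]
    norm_num
  refine ⟨s, t, ht, hε0, hs0, t0, hs, hmf, hiff, ?_, ?_⟩
  · rw [hs3]
    generalize circD (ε * t) = C at hcpos
    field_simp
  · refine (Odd.strictMono_pow (n := 3) (by decide)).injective ?_
    have e : (π * (W * log (1 / ε))) ^ 3 = π ^ 3 * F ε t := by
      rw [hFt, one_div, log_inv]; ring
    rw [e, show (s ^ 2 * t ^ 2 * vf (ε * t)) ^ 3 = (s ^ 3) ^ 2 * t ^ 6 * vf (ε * t) ^ 3 by ring, hs3]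
    simp only [hF]
    field_simp

lemma exists_ringParams_family {κ W : ℝ} (hκ : 0 < κ) (hW : 0 < W) : ∃ a b ε₀ : ℝ, 0 < a ∧ a < b ∧
    0 < ε₀ ∧ ∃ s t : ℝ → ℝ, (∀ ε ∈ Set.Ioo 0 ε₀, t ε ∈ Set.Icc a b ∧ RingParams κ W ε (s ε) (t ε)) ∧
    Tendsto s (𝓝[>] 0) (𝓝 (κ / (4 * π * W))) := by
  obtain ⟨a, b, ha, hab, h⟩ := exists_ringParams hκ hW
  obtain ⟨ε₀, hε₀, h⟩ := mem_nhdsGT_iff_exists_Ioo_subset.1 h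
  have h' : ∀ ε, ∃ s t : ℝ, ε ∈ Set.Ioo 0 ε₀ → t ∈ Set.Icc a b ∧ RingParams κ W ε s t := by
    intro ε
    by_cases hε : ε ∈ Set.Ioo 0 ε₀
    · obtain ⟨s, t, h1, h2⟩ := h hε
      exact ⟨s, t, fun _ => ⟨h1, h2⟩⟩
    · exact ⟨0, 0, fun h => absurd h hε⟩
  choose s t hst using h'
  refine ⟨a, b, ε₀, ha, hab, hε₀, s, t, hst, ?_⟩
  have hIoo : ∀ᶠ ε in 𝓝[>] (0 : ℝ), ε ∈ Set.Ioo 0 ε₀ := Ioo_mem_nhdsGT hε₀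
  have hτ : ∀ᶠ ε in 𝓝[>] (0 : ℝ), t ε ∈ Set.Icc a b := hIoo.mono fun ε hε => (hst ε hε).1
  have h1 := tendsto_circD.comp (tendsto_mul_bounded ha hτ)
  have h2 := tendsto_vf_mul ha hτ
  have hpi := pi_pos
  have h3 := (h2.const_mul κ).div (h1.const_mul (π * W)) (by positivity)
  rw [show κ * (π / 4) / (π * W * π) = κ / (4 * π * W) by field_simp] at h3
  refine h3.congr' ?_
  filter_upwards [hIoo, tendsto_L.eventually_gt_atTop 0,
    h1.eventually_const_lt (u := 3) pi_gt_three] with ε hε hL hc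
  have hp := (hst ε hε).2
  have e1 := hp.circ
  have e2 := hp.speed
  rw [one_div, log_inv] at e2
  simp only [Function.comp_apply] at hc ⊢
  simp only [Pi.div_apply]
  have hc0 : 0 < circD (ε * t ε) := by linarith
  rw [div_eq_iff (by positivity), ← e1, mul_div_assoc', div_eq_iff hL.ne']
  linear_combination s ε * circD (ε * t ε) * e2

end VortexRing

/-- **Existence of steady vortex rings of small cross-section** (Theorem 1.1).
For every `κ > 0` and `W > 0` there exist `ε₀ > 0`, constants `0 < C₁ < C₂`, and a family
`(ψ_ε, μ_ε)` of centralized steady vortex ring stream functions with circulation exactly `κ`,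
whose cross-sections are nonempty open simply connected sets of cross-section parameter
comparable to `ε`, concentrating near the circle of radius `κ/(4πW)` as `ε → 0⁺`. -/
theorem existence_steady_vortex_ring (κ W : ℝ) (hκ : 0 < κ) (hW : 0 < W) :
    ∃ ε₀ C₁ C₂ : ℝ, 0 < ε₀ ∧ 0 < C₁ ∧ C₁ < C₂ ∧
      ∃ ψ : ℝ → Plane → ℝ, ∃ μ : ℝ → ℝ,
        (∀ ε ∈ Set.Ioc (0 : ℝ) ε₀,
          0 < μ ε ∧
          IsVortexRingStream (ψ ε) ε W (μ ε) ∧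
          Centralized (ψ ε) ∧
          (crossSection (ψ ε) ε W (μ ε)).Nonempty ∧
          IsOpen (crossSection (ψ ε) ε W (μ ε)) ∧
          SimplyConnectedSpace ↥(crossSection (ψ ε) ε W (μ ε)) ∧
          circulation (ψ ε) ε W (μ ε) = κ ∧
          C₁ * ε ≤ (1 / 2) * Metric.diam (crossSection (ψ ε) ε W (μ ε)) ∧
          (1 / 2) * Metric.diam (crossSection (ψ ε) ε W (μ ε)) < C₂ * ε) ∧
        (∀ η > (0 : ℝ), ∃ ε₁ > (0 : ℝ), ∀ ε : ℝ, 0 < ε → ε ≤ ε₀ → ε ≤ ε₁ →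
          ∀ x ∈ crossSection (ψ ε) ε W (μ ε),
            dist x (mk2 (κ / (4 * π * W)) 0) ≤ η) := by
  have hpi := pi_pos
  obtain ⟨a, b, ε₀, ha, hab, hε₀, s, t, hst, hs⟩ := VortexRing.exists_ringParams_family hκ hW
  have hb : 0 < b := ha.trans hab
  set S : ℝ := κ / (4 * π * W) with hS
  have hS0 : 0 < S := by positivity
  obtain ⟨ε₁, hε₁, hnear⟩ := mem_nhdsGT_iff_exists_Ioo_subset.1
    (hs.eventually (Metric.ball_mem_nhds S (half_pos hS0)))
  have hε₁ : 0 < ε₁ := hε₁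
  have key : ∀ ε ∈ Set.Ioc 0 (min ε₀ ε₁ / 2), 0 < ε ∧ t ε ∈ Set.Icc a b ∧
      VortexRing.RingParams κ W ε (s ε) (t ε) ∧ S / 2 < s ε ∧ s ε < 3 / 2 * S := by
    intro ε hε
    have hmin : 0 < min ε₀ ε₁ := lt_min hε₀ hε₁
    have hlt : ε < min ε₀ ε₁ := by linarith [hε.2]
    have h1 := hst ε ⟨hε.1, hlt.trans_le (min_le_left _ _)⟩
    have h2 : s ε ∈ Metric.ball S (S / 2) := hnear ⟨hε.1, hlt.trans_le (min_le_right _ _)⟩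
    rw [Metric.mem_ball, Real.dist_eq, abs_lt] at h2
    exact ⟨hε.1, h1.1, h1.2, by linarith, by linarith⟩
  refine ⟨min ε₀ ε₁ / 2, S * a / 4, 4 * S * b, half_pos (lt_min hε₀ hε₁), by positivity, ?_,
    fun ε => VortexRing.ringPsi ε (s ε) (s ε * (ε * t ε)) (ε * t ε),
    fun ε => s ε ^ 4 * t ε ^ 2 / (2 * π) * VortexRing.mf (ε * t ε), ?_, ?_⟩
  · nlinarith [mul_pos hS0 ha, mul_pos hS0 hb, mul_lt_mul_of_pos_left hab hS0]
  · intro ε hε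
    obtain ⟨he, ht, h, hs1, hs2⟩ := key ε hε
    have hs0 := h.s_pos
    have ht0 := h.t_pos
    have hm := h.m_pos
    refine ⟨by positivity, h.isVortexRingStream, h.centralized, ?_, ?_, ?_, h.circulation_eq, ?_, ?_⟩
    · rw [h.crossSection_eq]
      exact h.nonempty_Df.image _
    · rw [h.crossSection_eq]
      exact h.isOpen_ringCore
    · rw [h.crossSection_eq]
      exact h.simplyConnectedSpace_ringCore
    · rw [h.crossSection_eq]
      have h1 := h.le_diam
      have h2 : S / 2 * (ε * a) ≤ s ε * (ε * t ε) :=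
        mul_le_mul hs1.le (mul_le_mul_of_nonneg_left ht.1 he.le) (by positivity) hs0.le
      linarith
    · rw [h.crossSection_eq]
      have h1 := h.diam_le
      have h2 : s ε * (ε * t ε) ≤ 3 / 2 * S * (ε * b) :=
        mul_le_mul hs2.le (mul_le_mul_of_nonneg_left ht.2 he.le) (by positivity) (by positivity)
      have h3 : 0 < S * (ε * b) := by positivity
      linarith
  · intro η hη
    have htb : ∀ᶠ ε in nhdsWithin (0 : ℝ) (Set.Ioi 0), t ε ∈ Set.Icc a b := by
      filter_upwards [Ioo_mem_nhdsGT hε₀] with ε hε using (hst ε hε).1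
    have h1 := tendsto_nhds_of_tendsto_nhdsWithin (VortexRing.tendsto_mul_bounded ha htb)
    have h2 := ((hs.sub_const S).abs).add ((hs.mul h1).const_mul 2)
    rw [sub_self, abs_zero, mul_zero, mul_zero, add_zero] at h2
    obtain ⟨ε₂, hε₂, hsub⟩ := mem_nhdsGT_iff_exists_Ioo_subset.1 (h2.eventually_lt_const hη)
    have hε₂ : 0 < ε₂ := hε₂
    refine ⟨ε₂ / 2, half_pos hε₂, fun ε he hle hle₂ x hx => ?_⟩
    obtain ⟨-, -, h, -, -⟩ := key ε ⟨he, hle⟩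
    rw [h.crossSection_eq] at hx
    have h3 : |s ε - S| + 2 * (s ε * (ε * t ε)) < η := hsub ⟨he, by linarith⟩
    exact (h.dist_le hx S).trans h3.le
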